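/- arXiv:0810.1632 — 2 statements merged into one kernel-verified Lean document; each statement's English description precedes it below -/
import Mathlib

section
/- For any prime number q and any infinite cardinal number κ that is not strictly between ℵ₀ and the cardinality of the continuum (i.e., κ = ℵ₀ or κ ≥ 2^ℵ₀), there exists an abelian group E of cardinality κ with the following properties: (1) E is the additive group of an E-ring; (2) E is torsion-free; (3) no nonzero element of E is divisible by all powers of q; (4) E is p-divisible for every prime p ≠ q; (5) every nontrivial endomorphism f : E → E is injective. -/
universe u

/-- A witness that there is an abelian group of cardinality `κ` which is the additive
group of an E-ring with the properties (1)-(5) of Theorem 3.1 (w.r.t. the prime `q`). -/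
structure ERingWitness (q : ℕ) (κ : Cardinal.{u}) where
  /-- the underlying (additive) group, carrying a ring structure -/
  E : Type u
  [ringE : Ring E]
  card : Cardinal.mk E = κ
  /-- (1) `E` is an E-ring: every endomorphism of the additive group is left
  multiplication by a ring element -/
  ering : ∀ f : E →+ E, ∃ r : E, ∀ x : E, f x = r * x
  /-- (2) the additive group of `E` is torsion free -/
  torsionFree : ∀ (x : E) (n : ℕ), n ≠ 0 → n • x = 0 → x = 0
  /-- (3) no nonzero element is divisible by all powers of `q` -/
  qdiv : ∀ x : E, (∀ n : ℕ, ∃ y : E, q ^ n • y = x) → x = 0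
  /-- (4) `E` is `p`-divisible for every prime `p ≠ q` -/
  pdiv : ∀ p : ℕ, p.Prime → p ≠ q → ∀ x : E, ∃ y : E, p • y = x
  /-- (5) every nontrivial endomorphism of the additive group of `E` is injective -/
  endoInj : ∀ f : E →+ E, f ≠ 0 → Function.Injective f

section Padic

lemma exists_algebraicIndependent_padic (q : ℕ) [Fact q.Prime] :
    ∃ π : ℕ → ℚ_[q], AlgebraicIndependent ℚ π ∧ ∀ n, ‖π n‖ ≤ 1 := by
  have hq0 : (q : ℚ_[q]) ≠ 0 := by exact_mod_cast (Fact.out : q.Prime).ne_zero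
  have key : ∀ x : ℚ_[q], x ∈ Algebra.adjoin ℚ {x : ℚ_[q] | ‖x‖ ≤ 1} := by
    intro x
    obtain ⟨N, hN⟩ : ∃ N : ℕ, ‖(q : ℚ_[q]) ^ N * x‖ ≤ 1 := by
      obtain ⟨N, hN⟩ := exists_pow_lt_of_lt_one (show (0:ℝ) < (‖x‖ + 1)⁻¹ by positivity)
        (Padic.norm_p_lt_one (p := q))
      refine ⟨N, ?_⟩
      rw [norm_mul, norm_pow]
      calc _ ≤ (‖x‖ + 1)⁻¹ * (‖x‖ + 1) := by gcongr; linarith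
        _ = 1 := inv_mul_cancel₀ (by positivity)
    have h := Subalgebra.smul_mem _ (Algebra.subset_adjoin (R := ℚ)
      (show _ ∈ {x : ℚ_[q] | ‖x‖ ≤ 1} from hN)) (((q : ℚ) ^ N)⁻¹)
    convert h using 1
    rw [Algebra.smul_def]
    simp only [map_inv₀, map_pow, map_natCast]
    field_simp
  have : Algebra.IsAlgebraic (Algebra.adjoin ℚ {x : ℚ_[q] | ‖x‖ ≤ 1}) ℚ_[q] :=
    ⟨fun x ↦ isAlgebraic_algebraMap
      (⟨x, key x⟩ : Algebra.adjoin ℚ {x : ℚ_[q] | ‖x‖ ≤ 1})⟩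
  obtain ⟨t, ht1, ht⟩ := exists_isTranscendenceBasis_subset (R := ℚ) {x : ℚ_[q] | ‖x‖ ≤ 1}
  have hinf : t.Infinite := by
    intro hfin
    have := ht.isAlgebraic
    have h1 := Algebra.IsAlgebraic.cardinalMk_le_max
      (Algebra.adjoin ℚ (Set.range ((↑) : t → ℚ_[q]))) ℚ_[q]
    have h2 := Algebra.lift_cardinalMk_adjoin_le ℚ (Set.range ((↑) : t → ℚ_[q]))
    have h3 := continuum_le_cardinal_of_nontriviallyNormedField ℚ_[q]
    have h4 : Cardinal.mk (Set.range ((↑) : t → ℚ_[q])) ≤ Cardinal.aleph0 := by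
      rw [Subtype.range_coe]; exact hfin.lt_aleph0.le
    simp only [Cardinal.lift_id, Cardinal.mkRat] at h2
    have h5 : Cardinal.continuum ≤ Cardinal.aleph0 :=
      h3.trans (h1.trans (max_le (h2.trans (max_le (max_le le_rfl h4) le_rfl)) le_rfl))
    exact absurd h5 (not_le.mpr Cardinal.aleph0_lt_continuum)
  have := hinf.to_subtype
  refine ⟨fun n ↦ (Infinite.natEmbedding t n : t), ht.1.comp _ (Infinite.natEmbedding t).injective,
    fun n ↦ ht1 (Infinite.natEmbedding t n).2⟩

open MvPolynomial in
lemma exists_subring_valued (q : ℕ) [Fact q.Prime] : ∃ W : Subring (MvPolynomial ℕ ℚ),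
    (∀ p : ℕ, p.Prime → p ≠ q → ∀ G ∈ W, (p : ℚ)⁻¹ • G ∈ W) ∧
    (∀ G, ∃ N : ℕ, (q : ℚ) ^ N • G ∈ W) ∧
    (∀ G, (∀ n : ℕ, ((q : ℚ) ^ n)⁻¹ • G ∈ W) → G = 0) ∧
    (∀ (m : ℕ →₀ ℕ) (n : ℕ), ∃ z : ℤ, ((q : ℚ) ^ n)⁻¹ • (monomial m 1 - (z : MvPolynomial ℕ ℚ)) ∈ W) := by
  obtain ⟨π, hπ, hπ1⟩ := exists_algebraicIndependent_padic q
  have hq0 : (q : ℚ_[q]) ≠ 0 := by exact_mod_cast (Fact.out : q.Prime).ne_zero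
  have hq1 : (1:ℝ) < q := by exact_mod_cast (Fact.out : q.Prime).one_lt
  have hs : ∀ (c : ℚ) (G : MvPolynomial ℕ ℚ), ‖aeval π (c • G)‖ = ‖(c : ℚ_[q])‖ * ‖aeval π G‖ :=
    fun c G ↦ by rw [map_smul, Algebra.smul_def, norm_mul, eq_ratCast]
  suffices h : ∃ W : Subring (MvPolynomial ℕ ℚ), ∀ G, G ∈ W ↔ ‖aeval π G‖ ≤ 1 by
    obtain ⟨W, hW⟩ := h
    refine ⟨W, ?_, ?_, ?_, ?_⟩
    · intro p hp hpq G hG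
      rw [hW] at hG ⊢
      have : ‖((p : ℚ)⁻¹ : ℚ_[q])‖ = 1 := by
        rw [Rat.cast_natCast, norm_inv, inv_eq_one, Padic.norm_natCast_eq_one_iff]
        exact ((Nat.coprime_primes Fact.out hp).mpr (Ne.symm hpq))
      rw [hs, Rat.cast_inv, this, one_mul]
      exact hG
    · intro G
      obtain ⟨N, hN⟩ := exists_pow_lt_of_lt_one
        (show (0:ℝ) < (‖aeval π G‖ + 1)⁻¹ by positivity) (Padic.norm_p_lt_one (p := q))
      refine ⟨N, ?_⟩
      rw [hW, hs, Rat.cast_pow, Rat.cast_natCast, norm_pow]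
      calc _ ≤ (‖aeval π G‖ + 1)⁻¹ * (‖aeval π G‖ + 1) := by gcongr; linarith
        _ = 1 := inv_mul_cancel₀ (by positivity)
    · intro G hG
      apply hπ
      rw [map_zero]
      by_contra hne
      have hpos : 0 < ‖aeval π G‖ := norm_pos_iff.mpr hne
      obtain ⟨N, hN⟩ := exists_pow_lt_of_lt_one hpos (Padic.norm_p_lt_one (p := q))
      have h1 := hG N
      have h2 : 0 < ‖(q : ℚ_[q])‖ ^ N := by have := norm_pos_iff.mpr hq0; positivity
      rw [hW, hs, Rat.cast_inv, Rat.cast_pow, Rat.cast_natCast, norm_inv, norm_pow,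
        inv_mul_le_iff₀ h2, mul_one] at h1
      linarith
    · intro m n
      have hm : ‖aeval π (monomial m (1 : ℚ))‖ ≤ 1 := by
        rw [aeval_monomial, map_one, one_mul]
        have : (m.prod fun i k ↦ π i ^ k) ∈ PadicInt.subring q :=
          Subring.prod_mem _ fun i _ ↦ Subring.pow_mem _ (hπ1 i) _
        exact this
      obtain ⟨x, hx⟩ : ∃ x : ℤ_[q], (x : ℚ_[q]) = aeval π (monomial m (1 : ℚ)) := ⟨⟨_, hm⟩, rfl⟩
      refine ⟨(PadicInt.appr x n : ℕ), ?_⟩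
      have h := PadicInt.appr_spec n x
      rw [← PadicInt.norm_le_pow_iff_mem_span_pow, PadicInt.norm_def, PadicInt.coe_sub,
        PadicInt.coe_natCast, zpow_neg, zpow_natCast] at h
      rw [hW, hs, map_sub, ← hx, Int.cast_natCast, map_natCast, Rat.cast_inv, Rat.cast_pow,
        Rat.cast_natCast, norm_inv, norm_pow, Padic.norm_p, inv_pow, inv_inv]
      calc _ ≤ (q:ℝ)^n * ((q:ℝ)^n)⁻¹ := by gcongr
        _ = 1 := mul_inv_cancel₀ (by positivity)
  exact ⟨(PadicInt.subring q).comap (aeval π : MvPolynomial ℕ ℚ →ₐ[ℚ] ℚ_[q]).toRingHom,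
    fun G ↦ Iff.rfl⟩

open MvPolynomial in
lemma exists_subring_coeff (ι : Type u) (q : ℕ) [Fact q.Prime] :
    ∃ O : Subring (MvPolynomial ℕ (MvPolynomial ι ℚ)),
    (∀ p : ℕ, p.Prime → p ≠ q → ∀ G ∈ O, (p : ℚ)⁻¹ • G ∈ O) ∧
    (∀ G, ∃ N : ℕ, (q : ℚ) ^ N • G ∈ O) ∧
    (∀ G, (∀ n : ℕ, ((q : ℚ) ^ n)⁻¹ • G ∈ O) → G = 0) ∧
    (∀ (m : ℕ →₀ ℕ) (n : ℕ), ∃ z : ℤ,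
      ((q : ℚ) ^ n)⁻¹ • (monomial m 1 - (z : MvPolynomial ℕ (MvPolynomial ι ℚ))) ∈ O) ∧
    (∀ i, C (X i) ∈ O) := by
  obtain ⟨W, hp, hN, h0, hT⟩ := exists_subring_valued q
  let e := commAlgEquiv ℚ ℕ ι
  let O' : Subring (MvPolynomial ι (MvPolynomial ℕ ℚ)) :=
    { carrier := {G | ∀ d, coeff d G ∈ W}
      mul_mem' := fun {a b} ha hb d ↦ by
        classical
        rw [coeff_mul]; exact Subring.sum_mem _ fun x _ ↦ W.mul_mem (ha _) (hb _)
      one_mem' := fun d ↦ by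
        classical
        rw [coeff_one]; split_ifs
        · exact W.one_mem
        · exact W.zero_mem
      add_mem' := fun {a b} ha hb d ↦ W.add_mem (ha _) (hb _)
      zero_mem' := fun d ↦ W.zero_mem
      neg_mem' := fun {a} ha d ↦ by rw [coeff_neg]; exact W.neg_mem (ha _) }
  have hO' : ∀ G, G ∈ O' ↔ ∀ d, coeff d G ∈ W := fun G ↦ Iff.rfl
  refine ⟨O'.comap e.toRingEquiv.toRingHom, ?_, ?_, ?_, ?_, ?_⟩
  · intro p hp1 hpq G hG
    change e G ∈ O' at hG
    change e _ ∈ O'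
    rw [map_smul]
    intro d
    rw [coeff_smul]
    exact hp p hp1 hpq _ (hG d)
  · intro G
    choose N hN using hN
    refine ⟨(e G).support.sup (fun d ↦ N (coeff d (e G))), ?_⟩
    change e _ ∈ O'
    rw [map_smul]
    intro d
    rw [coeff_smul]
    by_cases hd : d ∈ (e G).support
    · obtain ⟨k, hk⟩ := Nat.exists_eq_add_of_le
        (Finset.le_sup (f := fun d ↦ N (coeff d (e G))) hd)
      rw [hk, add_comm, pow_add, mul_smul]
      have : ((q : ℚ) ^ k) • ((q : ℚ) ^ N (coeff d (e G)) • coeff d (e G)) =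
        ((q ^ k : ℕ) : MvPolynomial ℕ ℚ) * ((q : ℚ) ^ N (coeff d (e G)) • coeff d (e G)) := by
        rw [Algebra.smul_def ((q : ℚ) ^ k)]; simp
      rw [this]
      exact W.mul_mem (natCast_mem W _) (hN _)
    · rw [notMem_support_iff.mp hd, smul_zero]; exact W.zero_mem
  · intro G hG
    apply e.injective
    rw [map_zero]
    ext1 d
    rw [coeff_zero]
    apply h0
    intro n
    have := hG n
    change e _ ∈ O' at this
    rw [map_smul] at this
    exact this d
  · intro m n
    obtain ⟨z, hz⟩ := hT m n
    refine ⟨z, ?_⟩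
    change e _ ∈ O'
    have h1 : e (monomial m 1) = C (monomial m 1) := by
      rw [monomial_eq, monomial_eq, C_1, C_1, one_mul, one_mul, Finsupp.prod, Finsupp.prod,
        map_prod, map_prod]
      exact Finset.prod_congr rfl fun i _ ↦ by
        rw [map_pow, map_pow, commAlgEquiv_X]
    rw [map_smul, map_sub, h1, map_intCast]
    intro d
    classical
    rw [coeff_smul, ← map_intCast (C : MvPolynomial ℕ ℚ →+* MvPolynomial ι (MvPolynomial ℕ ℚ)), 
      ← map_sub, coeff_C]
    split_ifs
    · exact hz
    · rw [smul_zero]; exact W.zero_mem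
  · intro i
    change e _ ∈ O'
    rw [commAlgEquiv_C_X]
    intro d
    classical
    rw [coeff_X]
    split_ifs
    · exact W.one_mem
    · exact W.zero_mem

end Padic

section Rees

lemma exists_ratLinearMap_extension {V W : Type*} [AddCommGroup V] [Module ℚ V] [AddCommGroup W]
    [Module ℚ W] (H : AddSubgroup V) (g : H →+ W) (hH : ∀ x : V, ∃ n : ℕ, n ≠ 0 ∧ n • x ∈ H) :
    ∃ φ : V →ₗ[ℚ] W, ∀ x : H, φ x = g x := by
  choose n hn0 hn using hH
  have well : ∀ (x : V) (k : ℕ) (hk0 : k ≠ 0) (hk : k • x ∈ H),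
      (n x : ℚ)⁻¹ • g ⟨_, hn x⟩ = (k : ℚ)⁻¹ • g ⟨_, hk⟩ := by
    intro x k hk0 hk
    have h1 : k • g ⟨_, hn x⟩ = n x • g ⟨_, hk⟩ := by
      rw [← map_nsmul, ← map_nsmul]
      congr 1
      ext1
      simp only [AddSubgroup.coe_nsmul]
      rw [smul_comm]
    have hk' : (k : ℚ) ≠ 0 := by exact_mod_cast hk0
    have hn' : (n x : ℚ) ≠ 0 := by exact_mod_cast hn0 x
    rw [← Nat.cast_smul_eq_nsmul ℚ k, ← Nat.cast_smul_eq_nsmul ℚ (n x) (g _)] at h1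
    rw [inv_smul_eq_iff₀ hn', smul_comm, ← h1, smul_smul, inv_mul_cancel₀ hk', one_smul]
  let φ : V →+ W := AddMonoidHom.mk' (fun x ↦ (n x : ℚ)⁻¹ • g ⟨_, hn x⟩) (by
    intro x y
    have hx : (n x * n y) • x ∈ H := by rw [mul_comm, mul_smul]; exact H.nsmul_mem (hn x) _
    have hy : (n x * n y) • y ∈ H := by rw [mul_smul]; exact H.nsmul_mem (hn y) _
    have hxy : (n x * n y) • (x + y) ∈ H := by rw [smul_add]; exact H.add_mem hx hy
    have h0 : n x * n y ≠ 0 := mul_ne_zero (hn0 x) (hn0 y)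
    simp only [well x _ h0 hx, well y _ h0 hy, well (x + y) _ h0 hxy]
    rw [← smul_add, ← map_add]
    congr 2
    ext1
    simp only [smul_add, AddMemClass.mk_add_mk])
  refine ⟨φ.toRatLinearMap, fun x ↦ ?_⟩
  change (n x : ℚ)⁻¹ • g ⟨_, hn x⟩ = _
  rw [well x 1 one_ne_zero (by rw [one_smul]; exact x.2)]
  simp

open MvPolynomial

/-- The subring of polynomials whose `m`-th coefficient lies in `I k` whenever `k` divides `m`. -/
def reesSubring {R : Type*} [CommRing R] (I : ℕ → Ideal R) : Subring (MvPolynomial ℕ R) where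
  carrier := {G | ∀ m, ∀ k ∈ m.support, coeff m G ∈ I k}
  mul_mem' {a b} ha hb m k hk := by
    classical
    rw [coeff_mul]
    refine Ideal.sum_mem _ fun x hx ↦ ?_
    rw [Finset.HasAntidiagonal.mem_antidiagonal] at hx
    rw [← hx] at hk
    rcases Finset.mem_union.mp (Finsupp.support_add hk) with h | h
    · exact Ideal.mul_mem_right _ _ (ha _ k h)
    · exact Ideal.mul_mem_left _ _ (hb _ k h)
  one_mem' m k hk := by
    classical
    rw [coeff_one, if_neg]
    · exact Ideal.zero_mem _
    · rintro rfl; simp at hk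
  add_mem' {a b} ha hb m k hk := Ideal.add_mem _ (ha m k hk) (hb m k hk)
  zero_mem' m k hk := Ideal.zero_mem _
  neg_mem' {a} ha m k hk := by rw [coeff_neg]; exact neg_mem (ha m k hk)

lemma reesSubring.smul_mem {R : Type*} [CommRing R] [Algebra ℚ R] (I : ℕ → Ideal R)
    {G : MvPolynomial ℕ R} (hG : G ∈ reesSubring I) (c : ℚ) : c • G ∈ reesSubring I := by
  intro m k hk
  rw [coeff_smul]
  exact Submodule.smul_of_tower_mem _ _ (hG m k hk)

lemma reesSubring.monomial_mem {R : Type*} [CommRing R] (I : ℕ → Ideal R)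
    {m : ℕ →₀ ℕ} {x : R} (h : ∀ k ∈ m.support, x ∈ I k) : monomial m x ∈ reesSubring I := by
  classical
  intro m' k hk
  rw [coeff_monomial]
  split_ifs with h'
  · subst h'; exact h k hk
  · exact Ideal.zero_mem _

lemma eq_zero_of_map_one_eq_zero {R : Type*} [CommRing R] [Algebra ℚ R] (I : ℕ → Ideal R)
    (hI : ∀ φ : R →ₗ[ℚ] R, (∀ n, ∀ x ∈ I n, φ x ∈ I n) → φ 1 = 0 → φ = 0)
    (q : ℕ) (hq : q ≠ 0) (O : Subring (MvPolynomial ℕ R))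
    (hN : ∀ G, ∃ N : ℕ, (q : ℚ) ^ N • G ∈ O)
    (h0 : ∀ G, (∀ n : ℕ, ((q : ℚ) ^ n)⁻¹ • G ∈ O) → G = 0)
    (hT : ∀ (m : ℕ →₀ ℕ) (n : ℕ), ∃ z : ℤ,
      ((q : ℚ) ^ n)⁻¹ • (monomial m 1 - (z : MvPolynomial ℕ R)) ∈ O)
    (f : (reesSubring I ⊓ O : Subring _) →+ (reesSubring I ⊓ O : Subring _)) (hf : f 1 = 0) :
    f = 0 := by
  have hTO : ∀ m, monomial m (1 : R) ∈ O := by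
    intro m
    obtain ⟨z, hz⟩ := hT m 0
    rw [pow_zero, inv_one, one_smul] at hz
    simpa using O.add_mem hz (intCast_mem O z)
  have hqn : ∀ n : ℕ, ((q : ℚ) ^ n) ≠ 0 := fun n ↦ pow_ne_zero _ (by exact_mod_cast hq)
  have key : ∀ (m : ℕ →₀ ℕ) (x : MvPolynomial ℕ R) (hx : x ∈ reesSubring I ⊓ O)
      (hmx : monomial m 1 * x ∈ reesSubring I ⊓ O),
      (f ⟨_, hmx⟩ : MvPolynomial ℕ R) = monomial m 1 * (f ⟨x, hx⟩ : MvPolynomial ℕ R) := by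
    intro m x hx hmx
    rw [← sub_eq_zero]
    apply h0
    intro n
    obtain ⟨z, hz⟩ := hT m n
    set b := ((q : ℚ) ^ n)⁻¹ • (monomial m 1 - (z : MvPolynomial ℕ R)) with hb
    have hb' : ((q ^ n : ℕ) : ℚ) • b = monomial m 1 - (z : MvPolynomial ℕ R) := by
      rw [hb, Nat.cast_pow, smul_inv_smul₀ (hqn n)]
    have hbx : b * x ∈ reesSubring I ⊓ O := by
      refine ⟨?_, O.mul_mem hz hx.2⟩
      rw [hb, smul_mul_assoc, sub_mul]
      exact reesSubring.smul_mem I (sub_mem hmx.1 (mul_mem (intCast_mem _ z) hx.1)) _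
    have h1 : (q ^ n) • (⟨b * x, hbx⟩ : (reesSubring I ⊓ O : Subring _)) =
        ⟨_, hmx⟩ - z • ⟨x, hx⟩ := by
      ext1
      simp only [AddSubgroupClass.coe_sub]
      change (q ^ n) • (b * x) = monomial m 1 * x - z • x
      rw [← Nat.cast_smul_eq_nsmul ℚ, ← smul_mul_assoc, hb', sub_mul, zsmul_eq_mul]
    have h2 := congrArg (fun y ↦ (f y : MvPolynomial ℕ R)) h1
    simp only [map_nsmul, map_sub, map_zsmul] at h2
    have h3 : ((q : ℚ) ^ n)⁻¹ • ((f ⟨_, hmx⟩ : MvPolynomial ℕ R) - monomial m 1 * (f ⟨x, hx⟩ : MvPolynomial ℕ R)) =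
        (f ⟨b * x, hbx⟩ : MvPolynomial ℕ R) - b * (f ⟨x, hx⟩ : MvPolynomial ℕ R) := by
      rw [inv_smul_eq_iff₀ (hqn n), smul_sub, ← smul_mul_assoc]
      rw [Nat.cast_pow] at hb'
      rw [hb']
      have h4 : ((q : ℚ) ^ n) • (f ⟨b * x, hbx⟩ : MvPolynomial ℕ R) =
          (f ⟨_, hmx⟩ : MvPolynomial ℕ R) - z * (f ⟨x, hx⟩ : MvPolynomial ℕ R) := by
        rw [← Nat.cast_pow, Nat.cast_smul_eq_nsmul, ← zsmul_eq_mul]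
        exact h2
      rw [h4]
      ring
    rw [h3]
    exact sub_mem (f _).2.2 (mul_mem hz (f _).2.2)
  have hCB : ∀ x : R, C x ∈ reesSubring I := fun x ↦
    reesSubring.monomial_mem I (m := 0) (by simp)
  let R₀ : AddSubgroup R := O.toAddSubgroup.comap (C : R →+* MvPolynomial ℕ R).toAddMonoidHom
  have hR₀ : ∀ x, x ∈ R₀ → C x ∈ reesSubring I ⊓ O := fun x hx ↦ ⟨hCB x, hx⟩
  have hR₀N : ∀ x : R, ∃ N : ℕ, q ^ N • x ∈ R₀ := by
    intro x
    obtain ⟨N, h⟩ := hN (C x)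
    refine ⟨N, ?_⟩
    change C _ ∈ O
    rw [map_nsmul, ← Nat.cast_smul_eq_nsmul ℚ, Nat.cast_pow]
    exact h
  have hfC : ∀ x (hx : x ∈ R₀), f ⟨C x, hR₀ x hx⟩ = 0 := by
    intro x hx
    ext1
    ext1 m
    let g : R₀ →+ R := AddMonoidHom.mk' (fun x ↦ coeff m (f ⟨C x.1, hR₀ _ x.2⟩ : MvPolynomial ℕ R))
      (by
        intro a b
        rw [← coeff_add, ← Subring.coe_add, ← map_add]
        congr 3
        ext1
        simp)
    obtain ⟨φ, hφ⟩ := exists_ratLinearMap_extension R₀ g (fun x ↦ by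
      obtain ⟨N, h⟩ := hR₀N x
      exact ⟨q ^ N, pow_ne_zero _ hq, h⟩)
    have : φ = 0 := by
      apply hI
      · intro k x hx
        obtain ⟨N, hxN⟩ := hR₀N x
        have hxI : q ^ N • x ∈ I k := Submodule.smul_of_tower_mem _ _ hx
        have hT : monomial (Finsupp.single k 1) 1 * C (q ^ N • x) ∈ reesSubring I ⊓ O := by
          refine ⟨?_, mul_mem (hTO _) hxN⟩
          rw [mul_comm, C_mul_monomial, mul_one]
          apply reesSubring.monomial_mem
          intro k' hk'
          have := Finsupp.support_single_subset hk'
          rw [Finset.mem_singleton] at this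
          rw [this]
          exact hxI
        have h1 := key _ _ (hR₀ _ hxN) hT
        have h2 := (f ⟨_, hT⟩).2.1 (Finsupp.single k 1 + m) k (by simp)
        rw [h1, coeff_monomial_mul, one_mul] at h2
        have h3 := hφ ⟨_, hxN⟩
        change φ (q ^ N • x) = coeff m _ at h3
        rw [← h3, map_nsmul, ← Nat.cast_smul_eq_nsmul ℚ, Nat.cast_pow] at h2
        have h4 := Submodule.smul_of_tower_mem (I k) ((q : ℚ) ^ N)⁻¹ h2
        rwa [inv_smul_smul₀ (hqn N)] at h4
      · have h1 : (1 : R) ∈ R₀ := by change C _ ∈ O; rw [C_1]; exact O.one_mem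
        have h2 := hφ ⟨1, h1⟩
        change φ 1 = coeff m (f ⟨C 1, hR₀ _ h1⟩ : MvPolynomial ℕ R) at h2
        rw [h2]
        have : (⟨C 1, hR₀ _ h1⟩ : (reesSubring I ⊓ O : Subring _)) = 1 := by
          ext1; simp
        rw [this, hf]
        simp
    have h2 := hφ ⟨x, hx⟩
    rw [this] at h2
    exact h2.symm
  ext1 G
  choose N hN using hR₀N
  let n := (G : MvPolynomial ℕ R).support.sup (fun d ↦ N (coeff d (G : MvPolynomial ℕ R)))
  have hn : ∀ d, q ^ n • coeff d (G : MvPolynomial ℕ R) ∈ R₀ := by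
    intro d
    by_cases hd : d ∈ (G : MvPolynomial ℕ R).support
    · obtain ⟨k, hk⟩ := Nat.exists_eq_add_of_le
        (Finset.le_sup (f := fun d ↦ N (coeff d (G : MvPolynomial ℕ R))) hd)
      rw [show n = _ from hk, add_comm, pow_add, mul_smul]
      exact R₀.nsmul_mem (hN _) _
    · rw [notMem_support_iff.mp hd, smul_zero]; exact R₀.zero_mem
  have hmon : ∀ d, monomial d 1 * C (q ^ n • coeff d (G : MvPolynomial ℕ R)) ∈
      reesSubring I ⊓ O := by
    intro d
    refine ⟨?_, mul_mem (hTO _) (hn d)⟩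
    rw [mul_comm, C_mul_monomial, mul_one]
    exact reesSubring.monomial_mem I
      fun k hk ↦ Submodule.smul_of_tower_mem _ _ (G.2.1 d k hk)
  have hsum : q ^ n • G = ∑ d ∈ (G : MvPolynomial ℕ R).support,
      (⟨_, hmon d⟩ : (reesSubring I ⊓ O : Subring _)) := by
    ext1
    rw [AddSubmonoidClass.coe_finsetSum]
    change q ^ n • (G : MvPolynomial ℕ R) = _
    conv_lhs => rw [(G : MvPolynomial ℕ R).as_sum, Finset.smul_sum]
    refine Finset.sum_congr rfl fun d _ ↦ ?_
    change _ = monomial d 1 * C (q ^ n • coeff d (G : MvPolynomial ℕ R))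
    rw [mul_comm, C_mul_monomial, mul_one, ← map_nsmul]
  have h1 : q ^ n • f G = 0 := by
    rw [← map_nsmul, hsum, map_sum]
    refine Finset.sum_eq_zero fun d _ ↦ ?_
    ext1
    rw [key d _ (hR₀ _ (hn d)) (hmon d), hfC _ (hn d)]
    simp
  have h2 : (q ^ n) • (f G : MvPolynomial ℕ R) = 0 := congrArg Subtype.val h1
  ext1
  rw [← Nat.cast_smul_eq_nsmul ℚ, smul_eq_zero] at h2
  simpa [hq] using h2

end Rees

section Good
open MvPolynomial

/-- A type `ι` is good if some countable family of ideals of `ℚ[ι]` is such that a linear map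
preserving all of them vanishes as soon as it kills `1`. -/
def Good (ι : Type u) : Prop :=
  ∃ I : ℕ → Ideal (MvPolynomial ι ℚ), ∀ φ : MvPolynomial ι ℚ →ₗ[ℚ] MvPolynomial ι ℚ,
    (∀ n, ∀ x ∈ I n, φ x ∈ I n) → φ 1 = 0 → φ = 0

lemma Good.of_countable {ι : Type u} {K : Type*} [Countable K]
    (I : K → Ideal (MvPolynomial ι ℚ))
    (h : ∀ φ : MvPolynomial ι ℚ →ₗ[ℚ] MvPolynomial ι ℚ,
      (∀ n, ∀ x ∈ I n, φ x ∈ I n) → φ 1 = 0 → φ = 0) : Good ι := by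
  rcases isEmpty_or_nonempty K with hK | hK
  · exact ⟨fun _ ↦ ⊤, fun φ _ h1 ↦ h φ (fun n ↦ isEmptyElim n) h1⟩
  · obtain ⟨g, hg⟩ := exists_surjective_nat K
    exact ⟨I ∘ g, fun φ h1 h2 ↦ h φ (fun n ↦ by obtain ⟨k, rfl⟩ := hg n; exact h1 k) h2⟩

lemma Good.of_equiv {ι ι' : Type*} (e : ι ≃ ι') (h : Good ι) : Good ι' := by
  obtain ⟨I, hI⟩ := h
  let E : MvPolynomial ι ℚ ≃ₐ[ℚ] MvPolynomial ι' ℚ := renameEquiv ℚ e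
  refine ⟨fun n ↦ (I n).comap E.symm.toRingEquiv.toRingHom, fun φ hφ h1 ↦ ?_⟩
  have key := hI (E.symm.toLinearMap ∘ₗ φ ∘ₗ E.toLinearMap) (fun n x hx ↦ by
    refine hφ n (E x) ?_
    change E.symm (E x) ∈ I n
    rwa [E.symm_apply_apply]) (by simp [h1])
  refine LinearMap.ext fun x ↦ ?_
  have := LinearMap.congr_fun key (E.symm x)
  simpa using this

lemma good_pempty : Good PEmpty.{u + 1} := by
  refine ⟨fun _ ↦ ⊥, fun φ _ h1 ↦ ?_⟩
  refine LinearMap.ext fun x ↦ ?_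
  rw [eq_C_of_isEmpty x, ← mul_one (C _), ← smul_eq_C_mul, map_smul, h1]
  simp

lemma Good.nonempty_witness {ι : Type u} (h : Good ι) (q : ℕ) (hq : q.Prime) :
    Nonempty (ERingWitness q (max (Cardinal.mk ι) Cardinal.aleph0)) := by
  have : Fact q.Prime := ⟨hq⟩
  obtain ⟨I, hI⟩ := h
  obtain ⟨O, hp, hN, h0, hT, hX⟩ := exists_subring_coeff ι q
  have hring : ∀ f : (reesSubring I ⊓ O : Subring _) →+ (reesSubring I ⊓ O : Subring _),
      ∃ r, ∀ x, f x = r * x := by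
    intro f
    refine ⟨f 1, fun x ↦ ?_⟩
    have := eq_zero_of_map_one_eq_zero I hI q hq.ne_zero O hN h0 hT
      (f - AddMonoidHom.mulLeft (f 1)) (by simp)
    have := DFunLike.congr_fun this x
    simpa [sub_eq_zero] using this
  have hCB : ∀ x, C x ∈ reesSubring I := fun x ↦
    reesSubring.monomial_mem I (m := 0) (by simp)
  refine ⟨⟨(reesSubring I ⊓ O : Subring _), ?_, hring, ?_, ?_, ?_, ?_⟩⟩
  · apply le_antisymm
    · refine (Cardinal.mk_subtype_le _).trans ?_
      refine cardinalMk_le_max_lift.trans ?_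
      simp only [Cardinal.mk_nat, Cardinal.lift_aleph0, Cardinal.lift_uzero]
      refine max_le (max_le (cardinalMk_le_max_lift.trans ?_) (le_max_right _ _)) (le_max_right _ _)
      simpa using le_total _ _
    · refine max_le ?_ ?_
      · refine Cardinal.mk_le_of_injective
          (f := fun i ↦ (⟨C (X i), hCB _, hX i⟩ : (reesSubring I ⊓ O : Subring _))) ?_
        intro i j hij
        exact X_injective (C_injective _ _ (congrArg Subtype.val hij))
      · rw [Cardinal.aleph0_le_mk_iff]
        have : CharZero (reesSubring I ⊓ O : Subring _) := ⟨fun a b hab ↦ by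
          have := congrArg Subtype.val hab
          simpa using this⟩
        exact Infinite.of_injective _ (Nat.cast_injective (R := (reesSubring I ⊓ O : Subring _)))
  · intro x n hn hx
    have h2 : n • (x : MvPolynomial ℕ (MvPolynomial ι ℚ)) = 0 := congrArg Subtype.val hx
    ext1
    rw [← Nat.cast_smul_eq_nsmul ℚ, smul_eq_zero] at h2
    simpa [hn] using h2
  · intro x hx
    ext1
    apply h0
    intro n
    obtain ⟨y, hy⟩ := hx n
    have h2 : q ^ n • (y : MvPolynomial ℕ (MvPolynomial ι ℚ)) = x := congrArg Subtype.val hy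
    rw [← h2, ← Nat.cast_smul_eq_nsmul ℚ, Nat.cast_pow,
      inv_smul_smul₀ (pow_ne_zero _ (by exact_mod_cast hq.ne_zero))]
    exact y.2.2
  · intro p hp' hpq x
    refine ⟨⟨(p : ℚ)⁻¹ • x, reesSubring.smul_mem I x.2.1 _, hp p hp' hpq _ x.2.2⟩, ?_⟩
    ext1
    change p • ((p : ℚ)⁻¹ • (x : MvPolynomial ℕ (MvPolynomial ι ℚ))) = x
    rw [← Nat.cast_smul_eq_nsmul ℚ, smul_inv_smul₀ (by exact_mod_cast hp'.ne_zero)]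
  · intro f hf
    obtain ⟨r, hr⟩ := hring f
    have hr0 : r ≠ 0 := by
      rintro rfl
      apply hf
      ext1 x
      simp [hr]
    intro x y hxy
    rw [hr, hr] at hxy
    exact mul_left_cancel₀ hr0 hxy

end Good

section Colouring

lemma exists_countable_closure {V : Type*} (F : V → Set V) (hF : ∀ v, (F v).Finite) (u : V) :
    ∃ s : Set V, u ∈ s ∧ s.Countable ∧ ∀ v ∈ s, F v ⊆ s := by
  let L : ℕ → Set V := fun n ↦ Nat.rec {u} (fun _ s ↦ ⋃ v ∈ s, F v) n
  have hL : ∀ n, (L n).Countable := by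
    intro n
    induction n with
    | zero => exact Set.countable_singleton u
    | succ n ih => exact ih.biUnion fun v _ ↦ (hF v).countable
  refine ⟨⋃ n, L n, Set.mem_iUnion.mpr ⟨0, rfl⟩, Set.countable_iUnion hL, fun v hv w hw ↦ ?_⟩
  obtain ⟨n, hn⟩ := Set.mem_iUnion.mp hv
  exact Set.mem_iUnion.mpr ⟨n + 1, Set.mem_biUnion hn hw⟩

/-- An orientation of a graph with finite out-degrees yields a proper colouring by integers. -/
lemma exists_nat_colouring {V : Type*} (F : V → Set V) (hF : ∀ v, (F v).Finite) :
    ∃ c : V → ℕ, ∀ v, ∀ w ∈ F v, w ≠ v → c w ≠ c v := by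
  choose cl hcl hcount hclosed using exists_countable_closure F hF
  let wo : LinearOrder V := WellOrderingRel.isWellOrder.linearOrder
  have wf : WellFounded (α := V) (· < ·) := WellOrderingRel.isWellOrder.toIsWellFounded.wf
  have hne : ∀ v, {u | v ∈ cl u}.Nonempty := fun v ↦ ⟨v, hcl v⟩
  let d : V → V := fun v ↦ wf.min _ (hne v)
  have hd : ∀ v, v ∈ cl (d v) := fun v ↦ wf.min_mem _ (hne v)
  have hdF : ∀ v, ∀ w ∈ F v, d w ≤ d v := fun v w hw ↦
    not_lt.mp (wf.not_lt_min _
      (show d v ∈ {u | w ∈ cl u} from hclosed _ v (hd v) hw))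
  have henc : ∀ u, ∃ e : V → ℕ, Set.InjOn e (cl u) := fun u ↦
    Set.countable_iff_exists_injOn.mp (hcount u)
  choose enc henc using henc
  have ex : ∀ (v : V) (ih : ∀ w, d w < d v → ℕ), ∃ k, ∀ w (h : d w < d v), w ∈ F v →
      ih w h ≠ Nat.pair (enc (d v) v) k := by
    classical
    intro v ih
    obtain ⟨b, hb⟩ := ((hF v).image fun w ↦ if h : d w < d v then ih w h else 0).bddAbove
    refine ⟨b + 1, fun w h hw heq ↦ ?_⟩
    have h1 := hb (Set.mem_image_of_mem _ hw)
    simp only [dif_pos h, heq] at h1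
    have := Nat.right_le_pair (enc (d v) v) (b + 1)
    omega
  choose K hK using ex
  have wfd : WellFounded fun w v ↦ d w < d v := InvImage.wf d wf
  let c : V → ℕ := wfd.fix fun v ih ↦ Nat.pair (enc (d v) v) (K v ih)
  have hc : ∀ v, c v = Nat.pair (enc (d v) v) (K v fun w _ ↦ c w) := fun v ↦ wfd.fix_eq _ v
  refine ⟨c, fun v w hw hne heq ↦ ?_⟩
  rcases (hdF v w hw).lt_or_eq with h | h
  · apply hK v (fun w _ ↦ c w) w h hw
    rw [← hc v]
    exact heq
  · rw [hc v, hc w, Nat.pair_eq_pair] at heq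
    have h1 := heq.1
    rw [h] at h1
    exact hne (henc (d v) (h ▸ hd w) (hd v) h1)

end Colouring

namespace BlackBox
open MvPolynomial

variable (ι : Type u)

/-- Variables: one for every finite sequence (node), and countably many for every branch. -/
abbrev Var : Type u := List ι ⊕ (ℕ × (ℕ → ι))

/-- The polynomial ring in which the construction takes place. -/
abbrev Poly : Type u := MvPolynomial (Var ι) ℚ

variable {ι}

/-- The initial segment of length `k` of the branch `η`, in reverse order. -/
def node (η : ℕ → ι) : ℕ → List ι
  | 0 => []
  | k + 1 => η k :: node η k

lemma length_node (η : ℕ → ι) (k : ℕ) : (node η k).length = k := by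
  induction k with
  | zero => rfl
  | succ k ih => simp [node, ih]

lemma node_inj {η ξ : ℕ → ι} {k : ℕ} (h : node η k = node ξ k) : ∀ j < k, η j = ξ j := by
  induction k with
  | zero => intro j hj; omega
  | succ k ih =>
    simp only [node, List.cons.injEq] at h
    intro j hj
    rcases Nat.lt_succ_iff_lt_or_eq.mp hj with h' | rfl
    · exact ih h.2 j h'
    · exact h.1

lemma eventually_node_ne {η ξ : ℕ → ι} (h : η ≠ ξ) : ∀ᶠ k in Filter.atTop, node η k ≠ node ξ k := by
  obtain ⟨j, hj⟩ := Function.ne_iff.mp h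
  filter_upwards [Filter.eventually_gt_atTop j] with k hk heq
  exact hj (node_inj heq j hk)

lemma eventually_node_notMem (p : Poly ι) (ξ : ℕ → ι) :
    ∀ᶠ k in Filter.atTop, (Sum.inl (node ξ k) : Var ι) ∉ p.vars := by
  filter_upwards [Filter.eventually_gt_atTop (p.vars.sup fun v ↦ Sum.elim List.length (fun _ ↦ 0) v)]
    with k hk hmem
  have := Finset.le_sup (f := fun v : Var ι ↦ Sum.elim List.length (fun _ ↦ 0) v) hmem
  simp only [Sum.elim_inl, length_node] at this
  omega

lemma eventually_pderiv (g : (ℕ → ι) →₀ Poly ι) (ξ : ℕ → ι) :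
    ∀ᶠ k in Filter.atTop, pderiv (Sum.inl (node ξ k))
      (Finsupp.linearCombination (Poly ι) (fun η ↦ (X (Sum.inl (node η k)) : Poly ι)) g) = g ξ := by
  classical
  induction g using Finsupp.induction_linear with
  | zero => simp
  | add f g hf hg =>
    filter_upwards [hf, hg] with k h1 h2
    rw [map_add, map_add, h1, h2, Finsupp.add_apply]
  | single η a =>
    have h1 := eventually_node_notMem a ξ
    by_cases h : η = ξ
    · subst h
      filter_upwards [h1] with k hk
      rw [Finsupp.linearCombination_single, smul_eq_mul, pderiv_mul,
        pderiv_eq_zero_of_notMem_vars hk]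
      simp
    · filter_upwards [h1, eventually_node_ne h] with k hk hk2
      rw [Finsupp.linearCombination_single, smul_eq_mul, pderiv_mul,
        pderiv_eq_zero_of_notMem_vars hk, pderiv_X_of_ne (by simpa using hk2)]
      simp [h]

/-- Kill the branch variables of index `i`. -/
noncomputable def kill (i : ℕ) : Poly ι →ₐ[ℚ] Poly ι :=
  aeval fun v ↦ Sum.elim (fun l ↦ X (Sum.inl l))
    (fun p ↦ if p.1 = i then 0 else X (Sum.inr p)) v

@[simp] lemma kill_inl (i : ℕ) (l : List ι) : kill i (X (Sum.inl l)) = X (Sum.inl l) := by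
  simp [kill]

lemma kill_inr (i j : ℕ) (η : ℕ → ι) :
    kill i (X (Sum.inr (j, η)) : Poly ι) = if j = i then 0 else X (Sum.inr (j, η)) := by
  simp [kill]

lemma exists_kill_eq (p r : Poly ι) : ∃ i, kill i p = p ∧ kill i r = r := by
  classical
  obtain ⟨i, hi⟩ := Infinite.exists_notMem_finset
    ((p.vars ∪ r.vars).image fun v ↦ Sum.elim (fun _ ↦ 0) Prod.fst v)
  have key : ∀ s : Poly ι, s.vars ⊆ p.vars ∪ r.vars → kill i s = s := by
    intro s hs
    have : kill i s = AlgHom.id ℚ (Poly ι) s := by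
      refine hom_congr_vars (f₁ := (kill i : Poly ι →ₐ[ℚ] Poly ι).toRingHom)
        (f₂ := (AlgHom.id ℚ (Poly ι)).toRingHom) ?_ ?_ rfl
      · ext; simp
      · intro v hv _
        change kill i (X v) = X v
        rcases v with l | ⟨j, η⟩
        · simp
        · rw [kill_inr, if_neg]
          rintro rfl
          exact hi (Finset.mem_image_of_mem _ (hs hv))
    exact this
  exact ⟨i, key _ Finset.subset_union_left, key _ Finset.subset_union_right⟩

variable (dec : ι → Poly ι × Poly ι) (col : (ℕ → ι) → ℕ)

/-- The sequence of polynomials attached to a branch. -/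
noncomputable def word (i : ℕ) (η : ℕ → ι) : ℕ → Poly ι
  | 0 => 1
  | 1 => kill i (dec (η 0)).2
  | k + 2 => X (Sum.inl (node η k))

/-- Substitute `T * word` for the branch variables of index `i` and colour `c`, and `0` for those of
the other colours. -/
noncomputable def subst (i k c : ℕ) : Poly ι →ₐ[ℚ] Polynomial (Poly ι) :=
  aeval fun v ↦ Sum.elim (fun l ↦ Polynomial.C (X (Sum.inl l)))
    (fun p ↦ if p.1 = i then (if col p.2 = c then Polynomial.X * Polynomial.C (word dec i p.2 k) else 0)
      else Polynomial.C (X (Sum.inr p))) v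

lemma subst_kill (i k c : ℕ) (p : Poly ι) :
    subst dec col i k c (kill i p) = Polynomial.C (kill i p) := by
  have : (subst dec col i k c).comp (kill i) =
      ((Algebra.ofId (Poly ι) (Polynomial (Poly ι))).restrictScalars ℚ).comp (kill i) := by
    ext v : 1
    rcases v with l | ⟨j, η⟩
    · simp [subst, Algebra.ofId_apply]
    · simp only [AlgHom.comp_apply, kill_inr]
      split_ifs with h
      · simp
      · simp [subst, h, Algebra.ofId_apply]
  exact DFunLike.congr_fun this p

lemma kill_word (i k : ℕ) (η : ℕ → ι) : ∃ p, word dec i η k = kill i p := by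
  match k with
  | 0 => exact ⟨1, by simp [word]⟩
  | 1 => exact ⟨_, rfl⟩
  | k + 2 => exact ⟨X (Sum.inl (node η k)), by simp [word]⟩

lemma coeff_zero_subst (i k c : ℕ) (p : Poly ι) :
    (subst dec col i k c p).coeff 0 = kill i p := by
  have : ((Polynomial.aeval (0 : Poly ι)).restrictScalars ℚ).comp (subst dec col i k c) =
      kill i := by
    ext v : 1
    rcases v with l | ⟨j, η⟩
    · simp [subst]
    · simp only [AlgHom.comp_apply, kill_inr, subst, aeval_X, Sum.elim_inr]
      split_ifs <;> simp
  rw [← this, Polynomial.coeff_zero_eq_aeval_zero]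
  rfl

lemma exists_coeff_one_subst (i c : ℕ) (p : Poly ι) :
    ∃ g ∈ Finsupp.supported (Poly ι) (Poly ι) {η | col η = c},
      ∀ k, (subst dec col i k c p).coeff 1 =
        Finsupp.linearCombination (Poly ι) (fun η ↦ word dec i η k) g := by
  induction p using MvPolynomial.induction_on with
  | C a =>
    refine ⟨0, Submodule.zero_mem _, fun k ↦ ?_⟩
    rw [map_zero, ← algebraMap_eq, AlgHom.commutes, IsScalarTower.algebraMap_apply ℚ (Poly ι),
      Polynomial.algebraMap_eq, Polynomial.coeff_C_of_ne_zero one_ne_zero]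
  | add p r hp hr =>
    obtain ⟨g, hg, hg'⟩ := hp
    obtain ⟨f, hf, hf'⟩ := hr
    exact ⟨g + f, Submodule.add_mem _ hg hf, fun k ↦ by
      rw [map_add, map_add, Polynomial.coeff_add, hg', hf']⟩
  | mul_X p v hp =>
    obtain ⟨g, hg, hg'⟩ := hp
    have hc : ∀ k, (subst dec col i k c (p * X v)).coeff 1 =
        kill i (X v) * (subst dec col i k c p).coeff 1
        + kill i p * (subst dec col i k c (X v)).coeff 1 := by
      intro k
      rw [map_mul, Polynomial.mul_coeff_one, coeff_zero_subst, coeff_zero_subst]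
      ring
    rcases v with l | ⟨j, η⟩
    · refine ⟨(X (Sum.inl l) : Poly ι) • g, Submodule.smul_mem _ _ hg, fun k ↦ ?_⟩
      rw [hc, hg', map_smul]
      simp [subst]
    · by_cases hj : j = i
      · by_cases hcol : col η = c
        · refine ⟨Finsupp.single η (kill i p), Finsupp.single_mem_supported _ _ hcol, fun k ↦ ?_⟩
          rw [hc, kill_inr, if_pos hj, Finsupp.linearCombination_single]
          simp [subst, hj, hcol]
        · refine ⟨0, Submodule.zero_mem _, fun k ↦ ?_⟩
          rw [hc, kill_inr, if_pos hj]
          simp [subst, hj, hcol]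
      · refine ⟨(X (Sum.inr (j, η)) : Poly ι) • g, Submodule.smul_mem _ _ hg, fun k ↦ ?_⟩
        rw [hc, hg', map_smul, kill_inr, if_neg hj]
        simp [subst, hj]

/-- The countable family of ideals. -/
noncomputable def ideal (t : ℕ × ℕ × ℕ × ℕ) : Ideal (Poly ι) :=
  RingHom.ker ((Polynomial.evalRingHom (t.2.2.2 : Poly ι)).comp
    (subst dec col t.1 t.2.1 t.2.2.1).toRingHom)

lemma mem_ideal (i k c s : ℕ) (p : Poly ι) :
    p ∈ ideal dec col (i, k, c, s) ↔ (subst dec col i k c p).eval (s : Poly ι) = 0 := Iff.rfl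

lemma coeff_one_subst_map (φ : Poly ι →ₗ[ℚ] Poly ι)
    (hφ : ∀ t, ∀ x ∈ ideal dec col t, φ x ∈ ideal dec col t) (i k : ℕ) (η : ℕ → ι) :
    (subst dec col i k (col η) (φ (X (Sum.inr (i, η))))).coeff 1 =
      kill i (φ (word dec i η k)) := by
  have h1 : subst dec col i k (col η) (φ (X (Sum.inr (i, η)))) =
      Polynomial.X * subst dec col i k (col η) (φ (word dec i η k)) := by
    apply Polynomial.eq_of_infinite_eval_eq
    refine (Set.infinite_range_of_injective (Nat.cast_injective (R := Poly ι))).mono ?_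
    rintro _ ⟨s, rfl⟩
    have h2 : X (Sum.inr (i, η)) - (s : ℚ) • word dec i η k ∈ ideal dec col (i, k, col η, s) := by
      obtain ⟨p, hp⟩ := kill_word dec i k η
      have hw : subst dec col i k (col η) (word dec i η k) = Polynomial.C (word dec i η k) := by
        rw [hp, subst_kill]
      rw [mem_ideal, map_sub, map_smul, hw, Nat.cast_smul_eq_nsmul]
      simp only [subst, aeval_X, Sum.elim_inr, if_true, Polynomial.eval_sub, Polynomial.eval_mul,
        Polynomial.eval_X, Polynomial.eval_C, nsmul_eq_mul, Polynomial.eval_natCast, sub_self]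
    have h3 := hφ _ _ h2
    rw [mem_ideal, map_sub, map_smul, map_sub, map_smul, Polynomial.eval_sub, sub_eq_zero] at h3
    change Polynomial.eval _ _ = Polynomial.eval _ _
    rw [h3, Polynomial.eval_mul, Polynomial.eval_X, Nat.cast_smul_eq_nsmul]
    simp
  rw [h1, Polynomial.coeff_X_mul, coeff_zero_subst]

/-- The branches which eventually occur in the polynomials coded by `η`. -/
def occ (η : ℕ → ι) : Set (ℕ → ι) :=
  {ξ | ∀ᶠ k in Filter.atTop, pderiv (Sum.inl (node ξ k)) (dec (η k)).1 ≠ 0}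

lemma eq_zero_of_map_one (hdec : Function.Surjective dec)
    (hcol : ∀ η, (occ dec η).Finite → ∀ ξ ∈ occ dec η, ξ ≠ η → col ξ ≠ col η)
    (φ : Poly ι →ₗ[ℚ] Poly ι)
    (hφ : ∀ t, ∀ x ∈ ideal dec col t, φ x ∈ ideal dec col t) (h1 : φ 1 = 0) : φ = 0 := by
  refine LinearMap.ext fun h ↦ ?_
  rw [LinearMap.zero_apply]
  obtain ⟨i, hi, hi'⟩ := exists_kill_eq h (φ h)
  choose d hd using hdec
  let L : ℕ → List ι := fun k ↦ Nat.rec [] (fun _ l ↦ d (kill i (φ (X (Sum.inl l))), h) :: l) k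
  let η : ℕ → ι := fun k ↦ d (kill i (φ (X (Sum.inl (L k)))), h)
  have hL : ∀ k, node η k = L k := by
    intro k
    induction k with
    | zero => rfl
    | succ k ih => rw [node, ih]
  have hη : ∀ k, dec (η k) = (kill i (φ (X (Sum.inl (node η k)))), h) := fun k ↦ by
    rw [hL]; exact hd _
  obtain ⟨g, hg, hgw⟩ := exists_coeff_one_subst dec col i (col η) (φ (X (Sum.inr (i, η))))
  replace hgw : ∀ k, kill i (φ (word dec i η k)) =
      Finsupp.linearCombination (Poly ι) (fun η ↦ word dec i η k) g := fun k ↦ by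
    rw [← hgw, coeff_one_subst_map dec col φ hφ]
  have hocc : occ dec η = g.support := by
    ext ξ
    have h2 : ∀ᶠ k in Filter.atTop, pderiv (Sum.inl (node ξ k)) (dec (η k)).1 = g ξ := by
      filter_upwards [eventually_pderiv g ξ] with k hk
      rw [hη, ← hk]
      exact congrArg _ (hgw (k + 2))
    simp only [occ, Set.mem_ofPred_eq, Finset.mem_coe, Finsupp.mem_support_iff]
    rw [Filter.eventually_congr (h2.mono fun k hk ↦ by rw [hk]), Filter.eventually_const]
  have hsupp : ∀ ξ, ξ ≠ η → g ξ = 0 := by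
    intro ξ hξ
    by_contra hne
    have hmem : ξ ∈ g.support := Finsupp.mem_support_iff.mpr hne
    refine hcol η (by rw [hocc]; exact g.support.finite_toSet) ξ (by rw [hocc]; exact hmem) hξ ?_
    exact hg hmem
  have hgs : g = Finsupp.single η (g η) := by
    ext1 ξ
    by_cases hξ : ξ = η
    · subst hξ; simp
    · rw [hsupp ξ hξ, Finsupp.single_eq_of_ne hξ]
  rw [hgs] at hgw
  simp only [Finsupp.linearCombination_single, smul_eq_mul] at hgw
  have h2 := hgw 0
  simp only [word, h1, map_zero, mul_one] at h2
  have h3 := hgw 1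
  simp only [word, hη, hi, hi', ← h2, zero_mul] at h3
  exact h3

end BlackBox

open Cardinal in
lemma good_of_power_aleph0 (ι : Type u) [Infinite ι] (h : #ι ^ ℵ₀ = #ι) : Good ι := by
  have hι : ℵ₀ ≤ #ι := aleph0_le_mk ι
  have hV : #(BlackBox.Var ι) = #ι := by
    simp only [mk_sum, lift_id, mk_list_eq_mk, mk_prod, mk_pi, prod_const, mk_nat, lift_aleph0,
      lift_uzero, h]
    rw [aleph0_mul_eq hι, add_eq_self hι]
  have hR : #(BlackBox.Poly ι × BlackBox.Poly ι) ≤ #ι := by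
    have : #(BlackBox.Poly ι) ≤ #ι := by
      refine MvPolynomial.cardinalMk_le_max_lift.trans ?_
      simp only [hV, lift_uzero, Cardinal.mkRat, lift_aleph0]
      simp [hι]
    simp only [mk_prod, lift_id]
    exact (mul_le_mul' this this).trans (mul_eq_self hι).le
  obtain ⟨e⟩ := hR
  let dec := Function.invFun e
  have hdec : Function.Surjective dec := Function.invFun_surjective e.injective
  obtain ⟨col, hcol⟩ := exists_nat_colouring
    (fun η : ℕ → ι ↦ {ξ | (BlackBox.occ dec η).Finite ∧ ξ ∈ BlackBox.occ dec η}) (fun η ↦ by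
      by_cases hf : (BlackBox.occ dec η).Finite
      · exact hf.subset fun ξ hξ ↦ hξ.2
      · simp [hf])
  have hgood : Good (BlackBox.Var ι) := Good.of_countable (BlackBox.ideal dec col)
    (BlackBox.eq_zero_of_map_one dec col hdec fun η hf ξ hξ hne ↦ hcol η ξ ⟨hf, hξ⟩ hne)
  obtain ⟨e'⟩ := Cardinal.eq.mp hV
  exact hgood.of_equiv e'

section Union
open MvPolynomial

lemma map_mul_of_preserves {ι : Type*} {σ R : Type*} [CommRing R] [Algebra ℚ R]
    (I : ℕ → Ideal (MvPolynomial ι ℚ))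
    (hI : ∀ φ : MvPolynomial ι ℚ →ₗ[ℚ] MvPolynomial ι ℚ,
      (∀ n, ∀ x ∈ I n, φ x ∈ I n) → φ 1 = 0 → φ = 0)
    (E : R ≃ₐ[ℚ] MvPolynomial σ (MvPolynomial ι ℚ)) (φ : R →ₗ[ℚ] R)
    (hφ : ∀ n, ∀ x ∈ ((I n).map C).comap E.toRingEquiv.toRingHom,
      φ x ∈ ((I n).map C).comap E.toRingEquiv.toRingHom)
    (a : MvPolynomial ι ℚ) (y : R) : φ (E.symm (C a) * y) = E.symm (C a) * φ y := by
  have hmem : ∀ n x, x ∈ ((I n).map C).comap E.toRingEquiv.toRingHom ↔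
      ∀ d, coeff d (E x) ∈ I n := fun n x ↦ mem_map_C_iff
  apply E.injective
  rw [map_mul E, E.apply_symm_apply]
  ext1 d
  rw [coeff_C_mul]
  let ψ : MvPolynomial ι ℚ →ₗ[ℚ] MvPolynomial ι ℚ :=
    ((lcoeff (MvPolynomial ι ℚ) d).restrictScalars ℚ) ∘ₗ E.toLinearMap ∘ₗ φ ∘ₗ
      (LinearMap.mulRight ℚ y) ∘ₗ E.symm.toLinearMap ∘ₗ
      (Algebra.linearMap (MvPolynomial ι ℚ) (MvPolynomial σ (MvPolynomial ι ℚ))).restrictScalars ℚ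
  have hψ : ∀ a, ψ a = coeff d (E (φ (E.symm (C a) * y))) := fun a ↦ rfl
  have h := hI (ψ - LinearMap.mulRight ℚ (ψ 1)) (fun n x hx ↦ by
    rw [LinearMap.sub_apply, LinearMap.mulRight_apply]
    refine Ideal.sub_mem _ ?_ (Ideal.mul_mem_right _ _ hx)
    rw [hψ]
    refine (hmem n _).mp (hφ n _ ((hmem n _).mpr fun d ↦ ?_)) d
    rw [map_mul, E.apply_symm_apply, coeff_C_mul]
    exact Ideal.mul_mem_right _ _ hx) (by simp)
  have h2 := LinearMap.congr_fun h a
  rw [LinearMap.sub_apply, LinearMap.mulRight_apply, LinearMap.zero_apply, sub_eq_zero,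
    hψ, hψ, C_1, map_one, one_mul] at h2
  exact h2

lemma exists_ideal_of_injective {ι V : Type*} (h : Good ι) (j : ι → V)
    (hj : Function.Injective j) :
    ∃ J : ℕ → Ideal (MvPolynomial V ℚ), ∀ φ : MvPolynomial V ℚ →ₗ[ℚ] MvPolynomial V ℚ,
      (∀ n, ∀ x ∈ J n, φ x ∈ J n) → ∀ i y, φ (X (j i) * y) = X (j i) * φ y := by
  classical
  obtain ⟨I, hI⟩ := h
  let e : V ≃ ((Set.range j)ᶜ : Set V) ⊕ ι := (Equiv.Set.sumCompl (Set.range j)).symm.trans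
    ((Equiv.sumComm _ _).trans (Equiv.sumCongr (Equiv.refl _) (Equiv.ofInjective j hj).symm))
  have he : ∀ i, e.symm (Sum.inr i) = j i := fun i ↦ by simp [e]
  let E := (renameEquiv ℚ e).trans (sumAlgEquiv ℚ ((Set.range j)ᶜ : Set V) ι)
  refine ⟨fun n ↦ ((I n).map C).comap E.toRingEquiv.toRingHom, fun φ hφ i y ↦ ?_⟩
  have h1 := map_mul_of_preserves I hI E φ hφ (X i) y
  have h2 : E.symm (C (X i)) = X (j i) := by
    rw [← he]
    simp [E]
  rwa [h2] at h1

lemma eq_zero_of_eventually_rename_eq_zero {V W : Type*} (g : ℕ → V → W)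
    (hg : ∀ v w, v ≠ w → ∀ᶠ m in Filter.atTop, g m v ≠ g m w) (p : MvPolynomial V ℚ)
    (hp : ∀ m, rename (g m) p = 0) : p = 0 := by
  have h1 : ∀ᶠ m in Filter.atTop, ∀ v ∈ p.vars, ∀ w ∈ p.vars, v ≠ w → g m v ≠ g m w := by
    rw [Filter.eventually_all_finset]
    intro v _
    rw [Filter.eventually_all_finset]
    intro w _
    by_cases h : v = w
    · simp [h]
    · filter_upwards [hg v w h] with m hm _ using hm
  obtain ⟨m, hm⟩ := h1.exists
  obtain ⟨r, hr⟩ := exists_rename_eq_of_vars_subset_range p (Subtype.val : p.vars → V)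
    Subtype.val_injective (by simp)
  have h2 := hp m
  rw [← hr, rename_rename] at h2
  have hinj : Function.Injective (g m ∘ (Subtype.val : p.vars → V)) := by
    intro v w hvw
    by_contra hne
    exact hm v v.2 w w.2 (fun h ↦ hne (Subtype.ext h)) hvw
  rw [← hr, (rename_eq_zero_iff_of_injective _ hinj).mp h2, map_zero]

lemma good_union (ι : ℕ → Type u) (hι : ∀ n, Good (ι n)) [Infinite (Σ n, ι n)] (Z : Type u)
    (f : Z → ℕ → Σ n, ι n) (hf : Function.Injective f) : Good ((Σ n, ι n) ⊕ Z) := by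
  choose J hJ using fun n ↦ exists_ideal_of_injective (hι n)
    (fun i ↦ (Sum.inl ⟨n, i⟩ : (Σ n, ι n) ⊕ Z))
    (fun i j h ↦ by simpa using h)
  obtain ⟨code⟩ : Nonempty (List (Σ n, ι n) ↪ Σ n, ι n) := by
    rw [← Cardinal.le_def, Cardinal.mk_list_eq_mk]
  let g' : ℕ → (Σ n, ι n) ⊕ Z → Σ n, ι n :=
    fun m ↦ Sum.elim id fun z ↦ code (BlackBox.node (f z) m)
  let g : ℕ → (Σ n, ι n) ⊕ Z → (Σ n, ι n) ⊕ Z := fun m v ↦ Sum.inl (g' m v)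
  have hfresh : ∀ z s, ∀ᶠ m in Filter.atTop, code (BlackBox.node (f z) m) ≠ s := by
    intro z s
    by_cases h : ∃ l, code l = s
    · obtain ⟨l, rfl⟩ := h
      filter_upwards [Filter.eventually_gt_atTop l.length] with m hm heq
      rw [← code.injective heq, BlackBox.length_node] at hm
      exact lt_irrefl _ hm
    · exact Filter.Eventually.of_forall fun m hm ↦ h ⟨_, hm⟩
  have hg : ∀ v w, v ≠ w → ∀ᶠ m in Filter.atTop, g m v ≠ g m w := by
    rintro (s | z) (t | y) hne
    · exact Filter.Eventually.of_forall fun m h ↦ hne (by simpa [g, g'] using h)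
    · filter_upwards [hfresh y s] with m hm h
      exact hm (by simpa [g, g'] using h.symm)
    · filter_upwards [hfresh z t] with m hm h
      exact hm (by simpa [g, g'] using h)
    · have hzy : f z ≠ f y := fun h ↦ hne (congrArg Sum.inr (hf h))
      filter_upwards [BlackBox.eventually_node_ne hzy] with m hm h
      exact hm (by simpa [g, g'] using h)
  refine Good.of_countable (K := (ℕ × ℕ) ⊕ ℕ) (Sum.elim (fun t ↦ J t.1 t.2)
    fun m ↦ RingHom.ker (rename (R := ℚ) (g m)).toRingHom) fun φ hφ h1 ↦ ?_
  have hlin : ∀ (a : MvPolynomial (Σ n, ι n) ℚ) y, φ (rename Sum.inl a * y) =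
      rename Sum.inl a * φ y := by
    intro a
    induction a using MvPolynomial.induction_on with
    | C a => intro y; rw [rename_C, ← smul_eq_C_mul, ← smul_eq_C_mul, map_smul]
    | add p q hp hq => intro y; rw [map_add, add_mul, map_add, hp, hq, add_mul]
    | mul_X p s hp =>
      intro y
      obtain ⟨n, i⟩ := s
      rw [map_mul (rename Sum.inl), mul_assoc, hp, rename_X, mul_assoc]
      congr 1
      exact hJ n φ (fun k ↦ hφ (Sum.inl (n, k))) i y
  refine LinearMap.ext fun x ↦ ?_
  refine eq_zero_of_eventually_rename_eq_zero g hg _ fun m ↦ ?_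
  have h2 : rename (g m) x = rename Sum.inl (rename (g' m) x) := by
    rw [rename_rename]; rfl
  have h3 := hφ (Sum.inr m) (x - rename (g m) x) (by
    change rename (g m) _ = 0
    rw [map_sub, rename_rename, sub_eq_zero]
    rfl)
  change rename (g m) _ = 0 at h3
  rw [map_sub, h2, ← mul_one (rename Sum.inl _), hlin, h1, mul_zero, sub_zero] at h3
  exact h3

end Union

section Cardinality
open Cardinal Set

lemma mk_Iic_toType_ord_lt {θ : Cardinal.{u}} (hθ : ℵ₀ ≤ θ) (t : θ.ord.ToType) :
    #(Iic t) < θ := by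
  simpa using mk_Iic_lt t (by simp) (by rwa [mk_ord_toType])

lemma exists_unbounded_sequence {θ : Cardinal.{u}} (hθ : ℵ₀ ≤ θ) (h : θ < θ ^ ℵ₀)
    (hpow : ∀ μ < θ, μ ^ ℵ₀ < θ) : ∃ f : ℕ → θ.ord.ToType, ∀ t, ∃ n, t ≤ f n := by
  by_contra! hb
  choose b hb using hb
  refine h.not_ge ?_
  have hinj : Function.Injective
      fun f : ℕ → θ.ord.ToType ↦ (⟨b f, fun n ↦ ⟨f n, (hb f n).le⟩⟩ : Σ t, ℕ → Iic t) := by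
    intro f g hfg
    obtain ⟨h1, h2⟩ := Sigma.mk.inj hfg
    have key : ∀ (s t : θ.ord.ToType) (u : ℕ → Iic s) (v : ℕ → Iic t), s = t → u ≍ v →
        ∀ n, (u n : θ.ord.ToType) = v n := by
      rintro s _ u v rfl huv n
      rw [eq_of_heq huv]
    exact funext (key _ _ _ _ h1 h2)
  have h1 := mk_le_of_injective hinj
  simp only [mk_sigma, mk_pi, prod_const, mk_nat, lift_aleph0, lift_uzero, mk_ord_toType] at h1
  refine h1.trans ((sum_le_mk_mul_iSup _).trans ?_)
  rw [mk_ord_toType]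
  exact (mul_le_mul_right (ciSup_le' fun t ↦ (hpow _ (mk_Iic_toType_ord_lt hθ t)).le) θ).trans
    (mul_eq_self hθ).le

lemma exists_good {κ : Cardinal.{u}} (hκ : continuum ≤ κ) : ∃ ι : Type u, Good ι ∧ #ι = κ := by
  have hκ0 : ℵ₀ ≤ κ := aleph0_le_continuum.trans hκ
  have hpp : ∀ μ : Cardinal.{u}, (μ ^ ℵ₀) ^ ℵ₀ = μ ^ ℵ₀ := fun μ ↦ by
    rw [← power_mul, aleph0_mul_aleph0]
  by_cases hκp : κ ^ ℵ₀ = κ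
  · have : Infinite κ.out := infinite_iff.mpr (by rwa [mk_out])
    exact ⟨κ.out, good_of_power_aleph0 _ (by rwa [mk_out]), mk_out κ⟩
  have hne : {μ : Cardinal.{u} | κ ≤ μ ^ ℵ₀}.Nonempty := ⟨κ, self_le_power κ one_le_aleph0⟩
  obtain ⟨θ, hθdef⟩ : ∃ θ, θ = sInf {μ : Cardinal.{u} | κ ≤ μ ^ ℵ₀} := ⟨_, rfl⟩
  have hθ : κ ≤ θ ^ ℵ₀ := hθdef ▸ csInf_mem hne
  have hθκ : θ ≤ κ := hθdef ▸ csInf_le' (self_le_power κ one_le_aleph0)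
  have hmin : ∀ μ < θ, μ ^ ℵ₀ < κ := fun μ hμ ↦
    not_le.mp (notMem_of_lt_csInf' (s := {μ : Cardinal.{u} | κ ≤ μ ^ ℵ₀}) (hμ.trans_eq hθdef))
  have hpow : ∀ μ < θ, μ ^ ℵ₀ < θ := fun μ hμ ↦ by
    by_contra! h
    have := hθ.trans (power_le_power_right h)
    rw [hpp] at this
    exact this.not_gt (hmin μ hμ)
  have hθ0 : ℵ₀ < θ := by
    by_contra! h
    have := hθ.trans (power_le_power_right h)
    rw [aleph0_power_aleph0] at this
    rw [← le_antisymm hκ this, continuum_power_aleph0] at hκp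
    exact hκp rfl
  have hlt : θ < θ ^ ℵ₀ := by
    refine lt_of_le_of_ne (self_le_power θ one_le_aleph0) fun h ↦ hκp ?_
    rw [← h] at hθ
    rw [le_antisymm hθ hθκ, ← h]
  obtain ⟨f, hf⟩ := exists_unbounded_sequence hθ0.le hlt hpow
  let ι : ℕ → Type u := fun n ↦ ((#(Iic (f n)) + ℵ₀) ^ (ℵ₀ : Cardinal.{u})).out
  have hιlt : ∀ n, #(ι n) < θ := fun n ↦ by
    rw [mk_out]
    exact hpow _ (add_lt_of_lt hθ0.le (mk_Iic_toType_ord_lt hθ0.le _) hθ0)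
  have hle : ∀ n, #(Iic (f n)) + ℵ₀ ≤ #(ι n) := fun n ↦ by
    rw [mk_out]
    exact self_le_power _ one_le_aleph0
  have hinf : ∀ n, Infinite (ι n) := fun n ↦ infinite_iff.mpr (le_add_self.trans (hle n))
  have hgood : ∀ n, Good (ι n) := fun n ↦ good_of_power_aleph0 _ (by rw [mk_out, hpp])
  have hsum : #(Σ n, ι n) = θ := by
    refine le_antisymm ?_ ?_
    · rw [mk_sigma]
      refine (sum_le_sum _ (fun _ ↦ θ) fun n ↦ (hιlt n).le).trans ?_
      rw [sum_const, mk_nat, lift_aleph0, lift_uzero, aleph0_mul_eq hθ0.le]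
    · rw [mk_sigma, ← mk_ord_toType θ, ← Cardinal.mk_univ, ← (iUnion_eq_univ_iff.mpr hf :
        (⋃ n, Iic (f n)) = Set.univ)]
      refine (le_of_eq (lift_uzero _).symm).trans ((mk_iUnion_le_sum_mk_lift).trans ?_)
      exact sum_le_sum _ _ fun n ↦ le_self_add.trans (hle n)
  have : Infinite (Σ n, ι n) := infinite_iff.mpr (hsum ▸ hθ0.le)
  obtain ⟨e⟩ : Nonempty (κ.out ↪ (ℕ → Σ n, ι n)) := by
    rw [← Cardinal.le_def, mk_out]
    simpa [hsum] using hθ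
  refine ⟨_, good_union ι hgood κ.out e e.injective, ?_⟩
  rw [mk_sum, lift_id, lift_id, hsum, mk_out, add_eq_right hκ0 hθκ]

end Cardinality

theorem stmt0 (q : ℕ) (hq : q.Prime) (κ : Cardinal.{u})
    (hκ : κ = Cardinal.aleph0 ∨ Cardinal.continuum ≤ κ) :
    Nonempty (ERingWitness q κ) := by
  obtain ⟨ι, hι, hcard⟩ : ∃ ι : Type u, Good ι ∧ max (Cardinal.mk ι) Cardinal.aleph0 = κ := by
    rcases hκ with rfl | hκ
    · exact ⟨PEmpty, good_pempty, by simp⟩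
    · obtain ⟨ι, hι, rfl⟩ := exists_good hκ
      exact ⟨ι, hι, max_eq_left (Cardinal.aleph0_le_continuum.trans hκ)⟩
  exact hcard ▸ hι.nonempty_witness q hq
end

section
/- Let S be a finite simple group of order 7920 in which every automorphism is inner (i.e., S is isomorphic to the Mathieu group M₁₁). Then for any cardinal number κ there exist a group L and an injective closed homomorphism η : S → L such that: the cardinality of L is at least κ; L is generated by η(S) together with an abelian subgroup E ⊆ L; and there exist an infinite cyclic subgroup Z ⊆ E and a surjective group homomorphism π : L → E/Z onto the abelian quotient E/Z whose composition with η is trivial (in particular L is not simple). -/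
universe u v

/-- A witness for the conclusion of the main theorem: a closed embedding `η : S → L`
with `L` of cardinality at least `κ`, `L` generated by an abelian subgroup `E`
(given here as the range of an injective homomorphism `j` from an abelian group)
together with `η S`, and an epimorphism `π : L → E ⧸ Z` onto the quotient of `E` by an
infinite cyclic subgroup `Z` such that `π ∘ η` is trivial. -/
structure ClosedEmbeddingWitness (S : Type v) [Group S] (κ : Cardinal.{u}) where
  /-- the large target group -/
  L : Type u
  [grpL : Group L]
  /-- the embedding -/
  η : S →* L
  inj : Function.Injective η
  /-- `η` is a closed homomorphism: `Hom(L,L) → Hom(S,L)` is bijective -/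
  closed : Function.Bijective fun f : L →* L => f.comp η
  /-- (1) the cardinality of `L` is at least `κ` -/
  large : κ ≤ Cardinal.mk L
  /-- (2) the abelian subgroup of `L`, given as an abelian group `E` with an
  injective homomorphism `j : E → L` -/
  E : Type u
  [grpE : CommGroup E]
  j : E →* L
  jinj : Function.Injective j
  /-- (2) `L` is generated by the abelian subgroup `j E` and the image of `S` -/
  gen : j.range ⊔ η.range = ⊤
  /-- (3) the generator of the infinite cyclic subgroup `Z = ⟨z⟩ ⊆ E` -/
  z : E
  zinf : ¬ IsOfFinOrder z
  /-- (3) the epimorphism onto `E ⧸ Z` -/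
  π : L →* E ⧸ Subgroup.zpowers z
  πsurj : Function.Surjective π
  /-- (3) the composition `π ∘ η` is trivial -/
  πtriv : ∀ s : S, π (η s) = 1

/-- The type of the letter that follows `n` letters of an alternating word starting in `i`. -/
def altType (i : Bool) (n : ℕ) : Bool := i ^^ n.bodd

section Amalgam

variable {G : Type*} [Group G] (F : Bool → Subgroup G) (C : Subgroup G)

/-- The products of reduced alternating words of length `n` starting with a letter of `F i`. -/
def RedWord : ℕ → Bool → Set G
  | 0, _ => C
  | n + 1, i => {g | ∃ x ∈ F i, x ∉ C ∧ ∃ y ∈ RedWord n (!i), g = x * y}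

/-- `G` is the amalgamated product of its subgroups `F true` and `F false` along `C`. -/
structure IsAmalgam : Prop where
  le : ∀ i, C ≤ F i
  gen : F true ⊔ F false = ⊤
  red : ∀ n i, ∀ g ∈ RedWord F C (n + 1) i, g ∉ C

variable {F C}

namespace IsAmalgam

theorem mul_left (h : IsAmalgam F C) {n i} {c g : G} (hc : c ∈ C) (hg : g ∈ RedWord F C n i) :
    c * g ∈ RedWord F C n i := by
  cases n with
  | zero => exact C.mul_mem hc hg
  | succ n =>
    obtain ⟨x, hx, hxC, y, hy, rfl⟩ := hg
    exact ⟨c * x, (F i).mul_mem (h.le i hc) hx, fun hh => hxC ((C.mul_mem_cancel_left hc).1 hh),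
      y, hy, by group⟩

theorem append (h : IsAmalgam F C) {n m i} {g g' : G} (hg : g ∈ RedWord F C n i)
    (hg' : g' ∈ RedWord F C m (altType i n)) : g * g' ∈ RedWord F C (n + m) i := by
  induction n generalizing i g with
  | zero => simpa using h.mul_left hg (by simpa [altType] using hg')
  | succ n ih =>
    obtain ⟨x, hx, hxC, y, hy, rfl⟩ := hg
    rw [show n + 1 + m = (n + m) + 1 by ring]
    exact ⟨x, hx, hxC, y * g', ih hy (by simpa [altType] using hg'), by group⟩

theorem letter {i} {x : G} (hx : x ∈ F i) (hxC : x ∉ C) : x ∈ RedWord F C 1 i :=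
  ⟨x, hx, hxC, 1, C.one_mem, by simp⟩

theorem mul_right (h : IsAmalgam F C) {n i} {c g : G} (hc : c ∈ C) (hg : g ∈ RedWord F C n i) :
    g * c ∈ RedWord F C n i := h.append (m := 0) hg hc

theorem inv (h : IsAmalgam F C) {n i} {g : G} (hg : g ∈ RedWord F C n i) :
    g⁻¹ ∈ RedWord F C n (altType i (n + 1)) := by
  induction n generalizing i g with
  | zero => exact C.inv_mem hg
  | succ n ih =>
    obtain ⟨x, hx, hxC, y, hy, rfl⟩ := hg
    have h1 := ih hy
    have h2 : x⁻¹ ∈ RedWord F C 1 i := letter ((F i).inv_mem hx) (by simpa using hxC)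
    rw [mul_inv_rev]
    have h3 := h.append h1 (m := 1) (g' := x⁻¹)
    have e1 : altType (altType (!i) (n + 1)) n = i := by
      unfold altType; cases i <;> cases hb : n.bodd <;> simp [hb]
    have e2 : altType (!i) (n + 1) = altType i (n + 1 + 1) := by
      unfold altType; cases i <;> cases hb : n.bodd <;> simp [hb]
    rw [e1] at h3
    rw [← e2]
    exact h3 h2

/-- Joining the inverse of a reduced word to a reduced word of the other type. -/
theorem inv_mul (h : IsAmalgam F C) {n m i} {g g' : G} (hg : g ∈ RedWord F C n i)
    (hg' : g' ∈ RedWord F C m (!i)) : g⁻¹ * g' ∈ RedWord F C (n + m) (altType i (n + 1)) := by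
  refine h.append (h.inv hg) ?_
  have : altType (altType i (n + 1)) n = !i := by
    unfold altType; cases i <;> cases hb : n.bodd <;> simp [hb]
  rwa [this]

theorem inv_mul_mul (h : IsAmalgam F C) {n m i} {g x g' : G} (hg : g ∈ RedWord F C n (!i))
    (hx : x ∈ F i) (hxC : x ∉ C) (hg' : g' ∈ RedWord F C m (!i)) :
    g⁻¹ * x * g' ∈ RedWord F C (n + m + 1) (altType (!i) (n + 1)) := by
  rw [mul_assoc, add_assoc]
  refine h.inv_mul hg ?_
  rw [Bool.not_not]
  exact ⟨x, hx, hxC, g', hg', rfl⟩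

theorem ne_one (h : IsAmalgam F C) {n i} {g : G} (hg : g ∈ RedWord F C (n + 1) i) : g ≠ 1 :=
  fun e => h.red n i g hg (e ▸ C.one_mem)

theorem unique_type (h : IsAmalgam F C) {n m i j} {g : G} (hg : g ∈ RedWord F C (n + 1) i)
    (hg' : g ∈ RedWord F C (m + 1) j) : i = j := by
  by_contra hij
  have hj : j = !i := by cases i <;> cases j <;> simp_all
  subst hj
  have := h.inv_mul hg hg'
  rw [show n + 1 + (m + 1) = (n + 1 + m) + 1 by ring] at this
  exact h.ne_one this (by simp)

theorem unique_first (h : IsAmalgam F C) {n m i} {x y x' y' : G} (hx : x ∈ F i)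
    (hx' : x' ∈ F i) (hy : y ∈ RedWord F C n (!i)) (hy' : y' ∈ RedWord F C m (!i))
    (e : x * y = x' * y') : x⁻¹ * x' ∈ C := by
  by_contra hC
  have := h.inv_mul_mul hy ((F i).mul_mem ((F i).inv_mem hx) hx') hC hy'
  refine h.ne_one this ?_
  have : y = x⁻¹ * x' * y' := by rw [mul_assoc, ← e]; group
  rw [this]; group

theorem unique_length (h : IsAmalgam F C) {n m i j} {g : G} (hg : g ∈ RedWord F C n i)
    (hg' : g ∈ RedWord F C m j) : n = m := by
  induction n generalizing m i j g with
  | zero =>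
    cases m with
    | zero => rfl
    | succ m => exact absurd hg (h.red m j g hg')
  | succ n ih =>
    cases m with
    | zero => exact absurd hg' (h.red n i g hg)
    | succ m =>
      obtain rfl := h.unique_type hg hg'
      obtain ⟨x, hx, hxC, y, hy, rfl⟩ := hg
      obtain ⟨x', hx', hxC', y', hy', e⟩ := hg'
      have hc := h.unique_first hx hx' hy hy' e
      have hy2 : y = x⁻¹ * x' * y' := by rw [mul_assoc, ← e]; group
      rw [ih hy (hy2 ▸ h.mul_left hc hy')]

theorem letter_mul (h : IsAmalgam F C) {n i j} {x g : G} (hx : x ∈ F i)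
    (hg : g ∈ RedWord F C n j) : ∃ m ≤ n + 1, ∃ k, x * g ∈ RedWord F C m k := by
  by_cases hxC : x ∈ C
  · exact ⟨n, by omega, j, h.mul_left hxC hg⟩
  cases n with
  | zero => exact ⟨1, by omega, i, h.mul_right hg (letter hx hxC)⟩
  | succ n =>
    by_cases hij : j = i
    · subst hij
      obtain ⟨x', hx', hxC', y', hy', rfl⟩ := hg
      rw [← mul_assoc]
      by_cases hc : x * x' ∈ C
      · exact ⟨n, by omega, _, h.mul_left hc hy'⟩
      · exact ⟨n + 1, by omega, j, _, (F j).mul_mem hx hx', hc, _, hy', rfl⟩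
    · have : j = !i := by cases i <;> cases j <;> simp_all
      subst this
      exact ⟨n + 2, by omega, i, x, hx, hxC, g, hg, rfl⟩

theorem exists_redWord (h : IsAmalgam F C) (g : G) : ∃ n i, g ∈ RedWord F C n i := by
  have hg : g ∈ Subgroup.closure ((F true : Set G) ∪ F false) := by
    rw [Subgroup.closure_union, Subgroup.closure_eq, Subgroup.closure_eq, h.gen]; trivial
  induction hg using Subgroup.closure_induction_left with
  | one => exact ⟨0, true, C.one_mem⟩
  | mul_left x hx y _ ih =>
    obtain ⟨n, i, hn⟩ := ih
    rcases hx with hx | hx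
    all_goals
      obtain ⟨m, -, k, hk⟩ := h.letter_mul hx hn
      exact ⟨m, k, hk⟩
  | inv_mul_cancel x hx y _ ih =>
    obtain ⟨n, i, hn⟩ := ih
    rcases hx with hx | hx
    all_goals
      obtain ⟨m, -, k, hk⟩ := h.letter_mul (inv_mem hx) hn
      exact ⟨m, k, hk⟩

/-- The syllable length. -/
noncomputable def len (h : IsAmalgam F C) (g : G) : ℕ := (h.exists_redWord g).choose

theorem len_spec (h : IsAmalgam F C) (g : G) : ∃ i, g ∈ RedWord F C (h.len g) i :=
  (h.exists_redWord g).choose_spec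

theorem len_eq (h : IsAmalgam F C) {n i} {g : G} (hg : g ∈ RedWord F C n i) : h.len g = n :=
  h.unique_length (h.len_spec g).choose_spec hg

theorem len_inv (h : IsAmalgam F C) (g : G) : h.len g⁻¹ = h.len g := by
  obtain ⟨i, hi⟩ := h.len_spec g
  exact h.len_eq (h.inv hi)

theorem len_mul_le (h : IsAmalgam F C) (g g' : G) : h.len (g * g') ≤ h.len g + h.len g' := by
  obtain ⟨i, hi⟩ := h.len_spec g
  generalize h.len g = n at hi
  induction n generalizing g i with
  | zero =>
    obtain ⟨j, hj⟩ := h.len_spec g'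
    rw [h.len_eq (h.mul_left hi hj)]; simp
  | succ n ih =>
    obtain ⟨x, hx, hxC, y, hy, rfl⟩ := hi
    have h1 := ih y _ hy
    obtain ⟨j, hj⟩ := h.len_spec (y * g')
    obtain ⟨m, hm, k, hk⟩ := h.letter_mul hx hj
    rw [mul_assoc, h.len_eq hk]
    omega

theorem len_pow_le (h : IsAmalgam F C) (g : G) (n : ℕ) : h.len (g ^ n) ≤ n * h.len g := by
  induction n with
  | zero =>
    simp [h.len_eq (n := 0) (i := true) (g := 1) C.one_mem]
  | succ n ih =>
    rw [pow_succ]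
    have := h.len_mul_le (g ^ n) g
    linarith [add_mul n 1 (h.len g)]

theorem len_le_one (h : IsAmalgam F C) {i} {g : G} (hg : g ∈ F i) : h.len g ≤ 1 := by
  by_cases hc : g ∈ C
  · rw [h.len_eq (n := 0) (i := i) hc]; simp
  · rw [h.len_eq (letter hg hc)]

theorem mem_of_redWord_one (h : IsAmalgam F C) {i} {g : G} (hg : g ∈ RedWord F C 1 i) :
    g ∈ F i := by
  obtain ⟨x, hx, hxC, y, hy, rfl⟩ := hg
  exact (F i).mul_mem hx (h.le i hy)

theorem exists_mem_of_len_le_one (h : IsAmalgam F C) {g : G} (hg : h.len g ≤ 1) :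
    ∃ i, g ∈ F i := by
  obtain ⟨i, hi⟩ := h.len_spec g
  rcases Nat.le_one_iff_eq_zero_or_eq_one.1 hg with h0 | h0 <;> rw [h0] at hi
  · exact ⟨i, h.le i hi⟩
  · exact ⟨i, h.mem_of_redWord_one hi⟩

/-- Multiplying on the right by an element of the factor of the last letter. -/
theorem len_mul_letter_le (h : IsAmalgam F C) {n i j} {x g : G} (hx : x ∈ F i) (hn : 1 ≤ n)
    (hg : g ∈ RedWord F C n j) (hj : altType j (n + 1) = i) : h.len (g * x) ≤ n := by
  have h1 := h.inv hg
  rw [hj] at h1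
  obtain ⟨m, rfl⟩ := Nat.exists_eq_add_of_le' hn
  obtain ⟨x', hx', hxC', y', hy', e⟩ := h1
  have h2 : (g * x)⁻¹ = (x⁻¹ * x') * y' := by rw [mul_inv_rev, e, mul_assoc]
  rw [← h.len_inv, h2]
  have h3 := h.len_mul_le (x⁻¹ * x') y'
  have h4 := h.len_le_one ((F i).mul_mem ((F i).inv_mem hx) hx')
  have h5 := h.len_eq hy'
  omega

/-- A finite group mapping to an amalgam is conjugate into a factor. -/
theorem exists_conj_of_bounded (h : IsAmalgam F C) {K : Type*} [Group K] (ψ : K →* G) (D : ℕ)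
    (hD : ∀ k, h.len (ψ k) ≤ D) : ∃ g i, ∀ k, g⁻¹ * ψ k * g ∈ F i := by
  induction D generalizing ψ with
  | zero =>
    refine ⟨1, true, fun k => ?_⟩
    obtain ⟨j, hj⟩ := h.len_spec (ψ k)
    rw [Nat.le_zero.1 (hD k)] at hj
    simpa using h.le true hj
  | succ D ih =>
    by_cases hall : ∀ k, h.len (ψ k) ≤ D
    · exact ih ψ hall
    push Not at hall
    obtain ⟨k₀, hk₀⟩ := hall
    have hk₁ : h.len (ψ k₀) = D + 1 := le_antisymm (hD k₀) hk₀
    rcases Nat.eq_zero_or_pos D with rfl | hDpos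
    · refine ⟨1, ?_⟩
      by_contra hne
      push Not at hne
      obtain ⟨a, ha⟩ := hne true
      obtain ⟨b, hb⟩ := hne false
      simp only [inv_one, one_mul, mul_one] at ha hb
      have key : ∀ k, ψ k ∈ F true ∨ ψ k ∈ F false := fun k => by
        obtain ⟨i, hi⟩ := h.exists_mem_of_len_le_one (hD k)
        cases i
        · exact Or.inr hi
        · exact Or.inl hi
      have ha' := (key a).resolve_left ha
      have hb' := (key b).resolve_right hb
      rcases key (a * b) with hab | hab <;> rw [map_mul] at hab
      · exact ha (((F true).mul_mem_cancel_right hb').1 hab)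
      · exact hb (((F false).mul_mem_cancel_left ha').1 hab)
    obtain ⟨i, hi⟩ := h.len_spec (ψ k₀)
    rw [hk₁] at hi
    have hi' := hi
    obtain ⟨x, hx, hxC, y, hy, hxy⟩ := hi
    have start : ∀ k n j, ψ k ∈ RedWord F C (n + 1) j → j = i := by
      intro k n j hk
      by_contra hne
      have hj : j = !i := by cases i <;> cases j <;> simp_all
      subst hj
      have h1 := h.len_eq (h.inv_mul hi' hk)
      have h2 := hD (k₀⁻¹ * k)
      rw [map_mul, map_inv] at h2
      omega
    have first : ∀ k n, ψ k ∈ RedWord F C (n + 2) i →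
        x⁻¹ * ψ k ∈ RedWord F C (n + 1) (!i) := by
      intro k n hk
      obtain ⟨x', hx', hxC', y', hy', e⟩ := hk
      have hc : x⁻¹ * x' ∈ C := by
        by_contra hc
        have h1 := h.len_eq (h.inv_mul_mul hy ((F i).mul_mem ((F i).inv_mem hx) hx') hc hy')
        have h2 := hD (k₀⁻¹ * k)
        rw [map_mul, map_inv, e, hxy, show (x * y)⁻¹ * (x' * y') = y⁻¹ * (x⁻¹ * x') * y' by group,
          h1] at h2
        omega
      rw [e, ← mul_assoc]
      exact h.mul_left hc hy'
    obtain ⟨g, j, hg⟩ := ih ((MulAut.conj x⁻¹).toMonoidHom.comp ψ) (fun k => by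
      simp only [MonoidHom.comp_apply, MulEquiv.coe_toMonoidHom, MulAut.conj_apply, inv_inv]
      obtain ⟨j, hj⟩ := h.len_spec (ψ k)
      rcases hn : h.len (ψ k) with _ | _ | n <;> rw [hn] at hj
      · have := h.len_le_one ((F i).mul_mem ((F i).mul_mem ((F i).inv_mem hx) (h.le i hj)) hx)
        omega
      · obtain rfl := start k 0 j hj
        have := h.len_le_one
          ((F j).mul_mem ((F j).mul_mem ((F j).inv_mem hx) (h.mem_of_redWord_one hj)) hx)
        omega
      · obtain rfl := start k _ j hj
        have h1 := first k n hj
        have h2 := h.inv hj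
        rw [← map_inv] at h2
        have h3 := start _ _ _ h2
        have h4 := h.len_mul_letter_le hx (by omega) h1
          (by
            rw [← h3]
            unfold altType
            cases j <;> cases hb : n.bodd <;> simp [hb, altType] at h3 ⊢)
        have := hD k
        omega)
    refine ⟨x * g, j, fun k => ?_⟩
    have := hg k
    simp only [MonoidHom.comp_apply, MulEquiv.coe_toMonoidHom, MulAut.conj_apply, inv_inv] at this
    convert this using 1
    group

theorem exists_conj_of_finite (h : IsAmalgam F C) {K : Type*} [Group K] [Finite K] (ψ : K →* G) :
    ∃ g i, ∀ k, g⁻¹ * ψ k * g ∈ F i := by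
  obtain ⟨D, hD⟩ := (Set.finite_range fun k => h.len (ψ k)).bddAbove
  exact h.exists_conj_of_bounded ψ D fun k => hD ⟨k, rfl⟩

theorem conj_mem_or_length_growth (h : IsAmalgam F C) (y : G) :
    (∃ g i, g⁻¹ * y * g ∈ F i) ∨ ∃ g, ∀ k : ℕ, 2 * k ≤ h.len (g⁻¹ * y ^ k * g) := by
  obtain ⟨n, hn⟩ : ∃ n, h.len y ≤ n := ⟨_, le_rfl⟩
  induction n generalizing y with
  | zero =>
    obtain ⟨i, hi⟩ := h.exists_mem_of_len_le_one (g := y) (by omega)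
    exact Or.inl ⟨1, i, by simpa using hi⟩
  | succ n ih =>
    by_cases h1 : h.len y ≤ 1
    · obtain ⟨i, hi⟩ := h.exists_mem_of_len_le_one h1
      exact Or.inl ⟨1, i, by simpa using hi⟩
    obtain ⟨i, hi⟩ := h.len_spec y
    obtain ⟨m, hm⟩ : ∃ m, h.len y = m + 2 := ⟨h.len y - 2, by omega⟩
    rw [hm] at hi
    by_cases hc : altType i (m + 2) = i
    · right
      refine ⟨1, fun k => ?_⟩
      have hk : y ^ k ∈ RedWord F C (k * (m + 2)) i := by
        induction k with
        | zero => rw [pow_zero, zero_mul]; exact C.one_mem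
        | succ k ihk =>
          rw [pow_succ', Nat.succ_mul, add_comm]
          exact h.append hi (by rwa [hc])
      simp only [inv_one, one_mul, mul_one]
      rw [h.len_eq hk]
      nlinarith
    · obtain ⟨x, hx, hxC, y', hy', rfl⟩ := hi
      have hlt : h.len (y' * x) ≤ m + 1 := by
        refine h.len_mul_letter_le hx (by omega) hy' ?_
        revert hc
        unfold altType; cases i <;> cases hb : m.bodd <;> simp [hb]
      rcases ih (y' * x) (by omega) with ⟨g, j, hg⟩ | ⟨g, hg⟩
      · refine Or.inl ⟨x * g, j, ?_⟩
        convert hg using 1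
        group
      · refine Or.inr ⟨x * g, fun k => ?_⟩
        have e : y' * x = x⁻¹ * (x * y') * x⁻¹⁻¹ := by group
        have := hg k
        rw [e, conj_pow] at this
        convert this using 2
        group

/-- An element with roots of arbitrarily high order is conjugate into a factor. -/
theorem exists_conj_of_divisible (h : IsAmalgam F C) (g : G)
    (hg : ∀ n : ℕ, ∃ j > n, ∃ y, y ^ j = g) : ∃ p i, p⁻¹ * g * p ∈ F i := by
  obtain ⟨j, hj, y, rfl⟩ := hg (h.len g)
  rcases h.conj_mem_or_length_growth y with ⟨p, i, hp⟩ | ⟨p, hp⟩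
  · refine ⟨p, i, ?_⟩
    have := (F i).pow_mem hp j
    rw [show p⁻¹ * y * p = p⁻¹ * y * p⁻¹⁻¹ by group, conj_pow] at this
    simpa using this
  · exfalso
    set r := 2 * h.len p + 1 with hr
    have h1 := hp (j * r)
    have h2 := h.len_mul_le (p⁻¹ * y ^ (j * r)) p
    have h3 := h.len_mul_le p⁻¹ (y ^ (j * r))
    have h4 := h.len_pow_le (y ^ j) r
    rw [← pow_mul] at h4
    rw [h.len_inv] at h3
    have h5 : r * h.len (y ^ j) + r ≤ j * r := by nlinarith
    have h6 : r * 1 ≤ j * r := by nlinarith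
    omega

/-- An element of a factor that is not conjugate into the amalgamated subgroup lies in no other
conjugate of a factor. -/
theorem mem_of_conj_mem (h : IsAmalgam F C) {i j} {x g : G} (hx : x ∈ F i)
    (hC : ∀ a ∈ F i, a⁻¹ * x * a ∉ C) (hg : g⁻¹ * x * g ∈ F j) : g ∈ F i := by
  obtain ⟨k, hk⟩ := h.len_spec g
  have hlen := h.len_le_one hg
  rcases hn : h.len g with _ | n <;> rw [hn] at hk
  · exact h.le i hk
  by_cases hki : k = i
  · subst hki
    obtain ⟨a, ha, haC, w, hw, rfl⟩ := hk
    have h1 := h.len_eq (h.inv_mul_mul hw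
      ((F k).mul_mem ((F k).mul_mem ((F k).inv_mem ha) hx) ha) (hC a ha) hw)
    rw [show (a * w)⁻¹ * x * (a * w) = w⁻¹ * (a⁻¹ * x * a) * w by group, h1] at hlen
    obtain rfl : n = 0 := by omega
    exact (F k).mul_mem ha (h.le k hw)
  · have : k = !i := by cases i <;> cases k <;> simp_all
    subst this
    have h1 := h.len_eq (h.inv_mul_mul hk hx (by simpa using hC 1 (F i).one_mem) hk)
    omega

/-- If the amalgamated subgroup is malnormal in the first factor and the second is abelian, then
centralizers of nontrivial elements of the second factor are contained in it. -/
theorem mem_of_commute (h : IsAmalgam F C) (hab : ∀ x ∈ F false, ∀ y ∈ F false, x * y = y * x)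
    (hmal : ∀ x ∈ C, x ≠ 1 → ∀ a ∈ F true, a⁻¹ * x * a ∈ C → a ∈ C)
    {x g : G} (hx : x ∈ F false) (hx1 : x ≠ 1) (hg : g * x = x * g) : g ∈ F false := by
  have hg' : g⁻¹ * x * g = x := by rw [mul_assoc, ← hg]; group
  by_cases hxC : x ∈ C
  · have key : ∀ n w, w ∈ RedWord F C n true → w⁻¹ * x * w = x → w ∈ C := by
      intro n w hw e
      cases n with
      | zero => exact hw
      | succ n =>
        obtain ⟨a, ha, haC, w', hw', rfl⟩ := hw
        have h0 : a⁻¹ * x * a ∉ C := fun hc => haC (hmal x hxC hx1 a ha hc)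
        have h1 := h.inv_mul_mul hw' ((F true).mul_mem ((F true).mul_mem ((F true).inv_mem ha)
          (h.le true hxC)) ha) h0 hw'
        rw [show w'⁻¹ * (a⁻¹ * x * a) * w' = (a * w')⁻¹ * x * (a * w') by group, e] at h1
        exact absurd hxC (h.red _ _ _ h1)
    obtain ⟨n, i, hi⟩ := h.exists_redWord g
    cases i with
    | true => exact h.le _ (key n g hi hg')
    | false =>
      cases n with
      | zero => exact h.le _ hi
      | succ n =>
        obtain ⟨a, ha, haC, w, hw, rfl⟩ := hi
        refine (F false).mul_mem ha (h.le _ (key n w hw ?_))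
        have e : a⁻¹ * x * a = x := by rw [mul_assoc, hab x hx a ha]; group
        calc w⁻¹ * x * w = w⁻¹ * (a⁻¹ * x * a) * w := by rw [e]
          _ = (a * w)⁻¹ * x * (a * w) := by group
          _ = x := hg'
  · refine h.mem_of_conj_mem (j := false) hx (fun a ha => ?_) (by rwa [hg'])
    rwa [mul_assoc, hab x hx a ha, inv_mul_cancel_left]

end IsAmalgam

end Amalgam

section Pushout

open Monoid

variable {G : Bool → Type*} {C : Type*} [∀ i, Group (G i)] [Group C] {φ : ∀ i, C →* G i}

theorem RedWord.exists_word {n : ℕ} {i : Bool} {g : PushoutI φ}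
    (hg : g ∈ RedWord (fun i => (PushoutI.of (φ := φ) i).range) (PushoutI.base φ).range n i) :
    ∃ w : CoprodI.Word G, PushoutI.Reduced φ w ∧
      (∃ c, g = PushoutI.ofCoprodI w.prod * PushoutI.base φ c) ∧ w.toList.length = n ∧
      ∀ j, w.fstIdx = some j → j = i := by
  induction n generalizing i g with
  | zero =>
    obtain ⟨c, rfl⟩ := hg
    exact ⟨.empty, by simp [PushoutI.Reduced, CoprodI.Word.empty], ⟨c, by simp⟩, rfl,
      by simp [CoprodI.Word.fstIdx, CoprodI.Word.empty]⟩
  | succ n ih =>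
    obtain ⟨_, ⟨x, rfl⟩, hx, y, hy, rfl⟩ := hg
    obtain ⟨w, hw, ⟨c, rfl⟩, hn, hf⟩ := ih hy
    have hx1 : x ≠ 1 := fun h => hx (by rw [h, map_one]; exact one_mem _)
    have hwi : w.fstIdx ≠ some i := fun h => absurd (hf i h) (by cases i <;> simp)
    refine ⟨.cons x w hwi hx1, ?_, ⟨c, ?_⟩, by simp [CoprodI.Word.cons, hn], ?_⟩
    · intro l hl
      rcases List.mem_cons.1 hl with rfl | hl
      · rintro ⟨c, hc⟩
        exact hx ⟨c, by rw [← PushoutI.of_apply_eq_base φ i c]; exact congrArg _ hc⟩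
      · exact hw l hl
    · rw [CoprodI.Word.prod_cons, map_mul, PushoutI.ofCoprodI_of, mul_assoc]
    · simp [CoprodI.Word.fstIdx, CoprodI.Word.cons]

theorem IsAmalgam.pushoutI (hφ : ∀ i, Function.Injective (φ i)) :
    IsAmalgam (fun i => (PushoutI.of (φ := φ) i).range) (PushoutI.base φ).range where
  le i := by
    rintro _ ⟨c, rfl⟩
    exact ⟨φ i c, PushoutI.of_apply_eq_base φ i c⟩
  gen := by
    rw [eq_top_iff]
    intro x _
    induction x using PushoutI.induction_on with
    | of i g =>
      cases i
      · exact Subgroup.mem_sup_right ⟨g, rfl⟩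
      · exact Subgroup.mem_sup_left ⟨g, rfl⟩
    | base c => exact Subgroup.mem_sup_left ⟨φ true c, PushoutI.of_apply_eq_base φ true c⟩
    | mul x y hx hy => exact mul_mem (hx trivial) (hy trivial)
  red n i g hg hgC := by
    obtain ⟨w, hw, ⟨c, rfl⟩, hn, -⟩ := RedWord.exists_word hg
    rw [Subgroup.mul_mem_cancel_right _ (MonoidHom.mem_range.2 ⟨c, rfl⟩)] at hgC
    rw [hw.eq_empty_of_mem_range hφ hgC] at hn
    simp [CoprodI.Word.empty] at hn

end Pushout

/-- The amalgamated product of two groups exists and has its universal property. -/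
theorem exists_amalgam {A B C : Type u} [Group A] [Group B] [Group C] (φ : C →* A) (ψ : C →* B)
    (hφ : Function.Injective φ) (hψ : Function.Injective ψ) :
    ∃ (G : Type u) (_ : Group G) (i : A →* G) (j : B →* G),
      Function.Injective i ∧ Function.Injective j ∧ i.comp φ = j.comp ψ ∧
      IsAmalgam (fun b => cond b i.range j.range) (i.comp φ).range ∧
      ∀ (K : Type u) [Group K] (f : A →* K) (g : B →* K), f.comp φ = g.comp ψ →
        ∃ h : G →* K, h.comp i = f ∧ h.comp j = g := by
  let Fam : Bool → Type u := fun b => cond b A B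
  let _ : ∀ b, Group (Fam b) := fun b => by cases b <;> (dsimp [Fam]; infer_instance)
  let χ : ∀ b, C →* Fam b := fun b => match b with
    | true => φ
    | false => ψ
  have hχ : ∀ b, Function.Injective (χ b) := by
    intro b; cases b
    · exact hψ
    · exact hφ
  have hi : (Monoid.PushoutI.of (φ := χ) true).comp φ = Monoid.PushoutI.base χ :=
    Monoid.PushoutI.of_comp_eq_base (φ := χ) true
  have hj : (Monoid.PushoutI.of (φ := χ) false).comp ψ = Monoid.PushoutI.base χ :=
    Monoid.PushoutI.of_comp_eq_base (φ := χ) false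
  refine ⟨Monoid.PushoutI χ, inferInstance, Monoid.PushoutI.of (φ := χ) true,
    Monoid.PushoutI.of (φ := χ) false, Monoid.PushoutI.of_injective hχ true,
    Monoid.PushoutI.of_injective hχ false, hi.trans hj.symm, ?_, ?_⟩
  · have := IsAmalgam.pushoutI hχ
    convert this using 1
    · funext b; cases b <;> rfl
    · rw [hi]
  · intro K _ f g hfg
    let fam : ∀ b, Fam b →* K := fun b => match b with
      | true => f
      | false => g
    have hf : ∀ b, (fam b).comp (χ b) = f.comp φ := by
      intro b; cases b
      · exact hfg.symm
      · rfl
    refine ⟨Monoid.PushoutI.lift fam (f.comp φ) hf, ?_, ?_⟩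
    · ext x; exact Monoid.PushoutI.lift_of (φ := χ) fam _ hf (i := true) x
    · ext x; exact Monoid.PushoutI.lift_of (φ := χ) fam _ hf (i := false) x

section Branches

variable {Λ : Type*}

theorem exists_limit_branch {K : ℕ → ℕ} (hK : StrictMono K) {T : ℕ → ℕ → Λ}
    (hT : ∀ n, ∀ i < K n, T (n + 1) i = T n i) : ∃ t : ℕ → Λ, ∀ n, ∀ i < K n, t i = T n i := by
  have h : ∀ n m, n ≤ m → ∀ i < K n, T m i = T n i := by
    intro n m hnm
    induction m, hnm using Nat.le_induction with
    | base => exact fun _ _ => rfl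
    | succ m hm ih =>
      intro i hi
      rw [hT m i (hi.trans_le (hK.monotone hm)), ih i hi]
  refine ⟨fun i => T (i + 1) i, fun n i hi => ?_⟩
  have h1 : i < K (i + 1) := hK.le_apply
  rcases le_total n (i + 1) with hn | hn
  · exact h _ _ hn i hi
  · exact (h _ _ hn i h1).symm

/-- There is a property of sequences which alternates along shifts of sequences with a strictly
increasing tail. -/
theorem exists_alternating_property [LinearOrder Λ] : ∃ χ : Set (ℕ → Λ),
    ∀ (t u : ℕ → Λ) (i : ℕ), (∀ j ≥ i, t j < t (j + 1)) → (∀ j ≥ i, u j = t (j + 1)) →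
      (u ∈ χ ↔ t ∉ χ) := by
  let R : Setoid (ℕ → Λ) :=
    { r := fun t u => ∃ a b, ∀ j, t (j + a) = u (j + b)
      iseqv :=
        { refl := fun t => ⟨0, 0, fun _ => rfl⟩
          symm := fun ⟨a, b, h⟩ => ⟨b, a, fun j => (h j).symm⟩
          trans := fun {t u w} ⟨a, b, h⟩ ⟨c, d, h'⟩ => ⟨a + c, b + d, fun j => by
            rw [show j + (a + c) = (j + c) + a by ring, h, show j + c + b = (j + b) + c by ring, h']
            congr 1; ring⟩ } }
  let rep : (ℕ → Λ) → (ℕ → Λ) := fun t => (Quotient.mk R t).out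
  have hrep : ∀ t, ∃ a b, ∀ j, t (j + a) = rep t (j + b) :=
    fun t => R.symm (Quotient.exact (Quotient.out_eq (Quotient.mk R t)))
  refine ⟨{t | ∃ a b, Even (a + b) ∧ ∀ j, t (j + a) = rep t (j + b)}, ?_⟩
  intro t u i ht hu
  have hru : rep u = rep t := by
    have : Quotient.mk R u = Quotient.mk R t :=
      Quotient.sound ⟨i, i + 1, fun j => by rw [hu _ (by omega)]; rfl⟩
    simp only [rep, this]
  have hmono : StrictMono fun j => t (j + i) := strictMono_nat_of_lt_succ fun j => by
    have := ht (j + i) (by omega)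
    rwa [show j + i + 1 = j + 1 + i by ring] at this
  simp only [Set.mem_ofPred_eq, hru]
  generalize hrdef : rep t = r
  obtain ⟨a₀, b₀, h₀⟩ := hrep t
  rw [hrdef] at h₀
  constructor
  · rintro ⟨a', b', he', h'⟩ ⟨a, b, he, h⟩
    have hinj : ∀ m n, r (m + i + b₀) = r (n + i + b₀) → m = n := by
      intro m n hmn
      rw [← h₀, ← h₀] at hmn
      have := hmono.injective (a₁ := m + a₀) (a₂ := n + a₀)
        (by simpa [show ∀ m, m + a₀ + i = m + i + a₀ by intro m; ring] using hmn)
      omega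
    have e1 := h' (a + i + b₀ + i)
    have e2 := h (a' + i + b₀ + 1 + i)
    rw [hu _ (by omega), show a + i + b₀ + i + a' + 1 = a' + i + b₀ + 1 + i + a by ring, e2] at e1
    rw [show a' + i + b₀ + 1 + i + b = (a' + i + 1 + b) + i + b₀ by ring,
      show a + i + b₀ + i + b' = (a + i + b') + i + b₀ by ring] at e1
    have := hinj _ _ e1
    obtain ⟨x, hx⟩ := he
    obtain ⟨y, hy⟩ := he'
    omega
  · intro hn
    have hodd : ¬ Even (a₀ + b₀) := fun he => hn ⟨a₀, b₀, he, h₀⟩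
    rw [Nat.not_even_iff_odd] at hodd
    obtain ⟨x, hx⟩ := hodd
    refine ⟨a₀ + i, b₀ + i + 1, ⟨x + i + 1, by omega⟩, fun j => ?_⟩
    rw [hu _ (by omega), show j + (a₀ + i) + 1 = (j + i + 1) + a₀ by ring, h₀]
    congr 1
    ring

/-- A continuous label-preserving map on a cone of branches is the identity. -/
theorem eq_self_of_preserves_labels [LinearOrder Λ] [WellFoundedLT Λ] {χ : Set (ℕ → Λ)}
    (hχ : ∀ (t u : ℕ → Λ) (i : ℕ), (∀ j ≥ i, t j < t (j + 1)) → (∀ j ≥ i, u j = t (j + 1)) →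
      (u ∈ χ ↔ t ∉ χ))
    (k : ℕ) (s : ℕ → Λ) (h : (ℕ → Λ) → (ℕ → Λ))
    (hcont : ∀ t t', (∀ i < k, t i = s i) → ∀ l ≥ k, (∀ i < l, t' i = t i) →
      ∀ i < l, h t' i = h t i)
    (hlt : ∀ t, (∀ i < k, t i = s i) → ∀ i j, t i < t j → h t i < h t j)
    (hlab : ∀ t, (∀ i < k, t i = s i) → (h t ∈ χ ↔ t ∈ χ))
    (t : ℕ → Λ) (ht : ∀ i < k, t i = s i) : h t = t := by
  have hA : ∀ v : Λ, ∀ t, (∀ i < k, t i = s i) → ∀ i ≥ k, t i = v → t i ≤ h t i := by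
    intro v
    induction v using WellFoundedLT.induction with
    | ind v ih =>
      intro t ht i hi hv
      by_contra hlt'
      push Not at hlt'
      let t' := Function.update t (i + 1) (h t i)
      have ht' : ∀ j < i + 1, t' j = t j := fun j hj => Function.update_of_ne (by omega) _ _
      have hk' : ∀ j < k, t' j = s j := fun j hj => by rw [ht' j (by omega), ht j hj]
      have h1 : t' (i + 1) = h t i := Function.update_self _ _ _
      have h2 := hcont t t' ht (i + 1) (by omega) ht' i (by omega)
      have h3 := hlt t' hk' (i + 1) i (by rw [h1, ht' i (by omega)]; exact hlt')
      have h4 := ih _ (by rw [← hv]; exact hlt') t' hk' (i + 1) (by omega) h1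
      rw [h2] at h3
      rw [h1] at h4
      exact absurd h3 (not_lt.2 h4)
  have hB : ∀ t, (∀ i < k, t i = s i) → ∀ i ≥ k, h t i ≤ t i := by
    intro t ht i hi
    by_contra hlt'
    push Not at hlt'
    let T : ℕ → ℕ → Λ := fun n => Nat.rec t
      (fun n x => Function.update x (i + n + 1) (h x (i + n))) n
    obtain ⟨t', ht'⟩ := exists_limit_branch (K := fun n => i + n + 1) (T := T)
      (fun a b hab => by dsimp only; omega)
      (fun n j hj => Function.update_of_ne (by omega) _ _)
    have hT0 : ∀ j < i + 1, t' j = t j := fun j hj => ht' 0 j hj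
    have htk : ∀ j < k, t' j = s j := fun j hj => by rw [hT0 j (by omega), ht j hj]
    have hshift : ∀ j ≥ i, h t' j = t' (j + 1) := by
      intro j hj
      obtain ⟨n, rfl⟩ := Nat.exists_eq_add_of_le hj
      have h1 := ht' (n + 1) (i + n + 1) (by omega)
      have h2 : T (n + 1) (i + n + 1) = h (T n) (i + n) := Function.update_self _ _ _
      rw [h1, h2]
      have h3 := hcont t' (T n) htk (i + n + 1) (by omega) (fun j hj => (ht' n j hj).symm)
      exact (h3 (i + n) (by omega)).symm
    have hinc : ∀ j ≥ i, t' j < t' (j + 1) := by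
      intro j hj
      induction j, hj using Nat.le_induction with
      | base =>
        rw [← hshift i le_rfl, hcont t t' ht (i + 1) (by omega) hT0 i (by omega),
          hT0 i (by omega)]
        exact hlt'
      | succ j hj ih =>
        have := hlt t' htk _ _ ih
        rwa [hshift j hj, hshift (j + 1) (by omega)] at this
    have h1 := hχ t' (h t') i hinc hshift
    have h2 := hlab t' htk
    tauto
  have hAB : ∀ t, (∀ i < k, t i = s i) → ∀ i ≥ k, h t i = t i := fun t ht i hi =>
    le_antisymm (hB t ht i hi) (hA _ t ht i hi rfl)
  funext i
  rcases le_or_gt k i with hi | hi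
  · exact hAB t ht i hi
  let t' := Function.update t k (h t i)
  have ht' : ∀ j < k, t' j = t j := fun j hj => Function.update_of_ne (by omega) _ _
  have hk' : ∀ j < k, t' j = s j := fun j hj => by rw [ht' j hj, ht j hj]
  have h1 : t' k = h t i := Function.update_self _ _ _
  have h2 : h t' i = h t i := hcont t t' ht k le_rfl ht' i hi
  have h3 : h t' k = h t' i := by rw [hAB t' hk' k le_rfl, h1, h2]
  rw [← h1, ← ht' i hi]
  rcases lt_trichotomy (t' k) (t' i) with h4 | h4 | h4
  · exact absurd h3 (hlt t' hk' _ _ h4).ne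
  · exact h4
  · exact absurd h3 (hlt t' hk' _ _ h4).ne'

end Branches

section Branches

variable {Λ : Type*}

/-- Truncation of a sequence, filling up with `d`. -/
def truncSeq (d : Λ) (k : ℕ) (s : ℕ → Λ) : ℕ → Λ := fun i => if i < k then s i else d

theorem truncSeq_eq_iff {d : Λ} {k : ℕ} {s t : ℕ → Λ} :
    truncSeq d k s = truncSeq d k t ↔ ∀ i < k, s i = t i := by
  constructor
  · intro h i hi
    have := congrFun h i
    simpa [truncSeq, hi] using this
  · intro h
    funext i
    by_cases hi : i < k
    · simp [truncSeq, hi, h i hi]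
    · simp [truncSeq, hi]

theorem truncSeq_truncSeq {d : Λ} {k l : ℕ} (h : k ≤ l) (s : ℕ → Λ) :
    truncSeq d k (truncSeq d l s) = truncSeq d k s :=
  truncSeq_eq_iff.2 fun i hi => by simp [truncSeq, hi.trans_le h]

theorem exists_injOn_truncSeq (d : Λ) (A : Finset (ℕ → Λ)) :
    ∃ k, ∀ l ≥ k, Set.InjOn (truncSeq d l) A := by
  classical
  have h : ∀ x : (ℕ → Λ) × (ℕ → Λ), ∃ i, x.1 ≠ x.2 → x.1 i ≠ x.2 i := fun x => by
    by_cases hx : x.1 = x.2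
    · exact ⟨0, fun hh => absurd hx hh⟩
    · obtain ⟨i, hi⟩ := Function.ne_iff.1 hx
      exact ⟨i, fun _ => hi⟩
  choose f hf using h
  obtain ⟨k, hk⟩ := ((A ×ˢ A).image f).bddAbove
  refine ⟨k + 1, fun l hl x hx y hy hxy => ?_⟩
  by_contra hne
  refine hf (x, y) hne (truncSeq_eq_iff.1 hxy _ ?_)
  have := hk (Finset.mem_coe.2 (Finset.mem_image_of_mem f
    (show (x, y) ∈ A ×ˢ A from Finset.mem_product.2 ⟨Finset.mem_coe.1 hx, Finset.mem_coe.1 hy⟩)))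
  omega

theorem eq_of_mapDomain_truncSeq {d : Λ} {v w : (ℕ → Λ) →₀ ℚ}
    (h : ∀ k, v.mapDomain (truncSeq d k) = w.mapDomain (truncSeq d k)) : v = w := by
  classical
  obtain ⟨k, hk⟩ := exists_injOn_truncSeq d (v.support ∪ w.support)
  exact Finsupp.mapDomain_injOn _ (hk k le_rfl) (by simp) (by simp) (h k)

variable {d : Λ} {F : (ℕ → Λ) → ((ℕ → Λ) →₀ ℚ)}

/-- On some cone inside any cone, the truncated supports have constant size. -/
theorem exists_cone_card_eq
    (hT : ∀ k s t, (∀ i < k, s i = t i) →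
      (F s).mapDomain (truncSeq d k) = (F t).mapDomain (truncSeq d k)) (k₀ : ℕ) (s₀ : ℕ → Λ) :
    ∃ k ≥ k₀, ∃ s : ℕ → Λ, (∀ i < k₀, s i = s₀ i) ∧ ∀ l ≥ k, ∀ t, (∀ i < k, t i = s i) →
      ((F t).mapDomain (truncSeq d l)).support.card =
        ((F s).mapDomain (truncSeq d k)).support.card := by
  classical
  have hmono : ∀ k l t, k ≤ l → ((F t).mapDomain (truncSeq d k)).support.card ≤
      ((F t).mapDomain (truncSeq d l)).support.card := by
    intro k l t hkl
    have : (F t).mapDomain (truncSeq d k) =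
        ((F t).mapDomain (truncSeq d l)).mapDomain (truncSeq d k) := by
      rw [← Finsupp.mapDomain_comp]
      congr 1
      funext x
      exact (truncSeq_truncSeq hkl x).symm
    rw [this]
    exact (Finset.card_le_card Finsupp.mapDomain_support).trans Finset.card_image_le
  by_contra hcon
  push Not at hcon
  have hstep : ∀ x : {x : ℕ × (ℕ → Λ) // k₀ ≤ x.1 ∧ ∀ i < k₀, x.2 i = s₀ i},
      ∃ y : {x : ℕ × (ℕ → Λ) // k₀ ≤ x.1 ∧ ∀ i < k₀, x.2 i = s₀ i},
        x.1.1 < y.1.1 ∧ (∀ i < x.1.1, y.1.2 i = x.1.2 i) ∧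
        ((F x.1.2).mapDomain (truncSeq d x.1.1)).support.card <
          ((F y.1.2).mapDomain (truncSeq d y.1.1)).support.card := by
    rintro ⟨⟨k, s⟩, hk, hs⟩
    obtain ⟨l, hl, t, ht, hne⟩ := hcon k hk s hs
    have h1 : ((F s).mapDomain (truncSeq d k)).support.card <
        ((F t).mapDomain (truncSeq d l)).support.card := by
      refine lt_of_le_of_ne ?_ hne.symm
      rw [← hT k t s ht]
      exact hmono k l t hl
    refine ⟨⟨⟨l, t⟩, hk.trans hl, fun i hi =>
      (ht i (hi.trans_le hk)).trans (hs i hi)⟩, lt_of_le_of_ne hl ?_, ht, h1⟩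
    rintro rfl
    rw [hT k t s ht] at h1
    exact lt_irrefl _ h1
  choose next hnext using hstep
  let seq : ℕ → {x : ℕ × (ℕ → Λ) // k₀ ≤ x.1 ∧ ∀ i < k₀, x.2 i = s₀ i} := fun n =>
    Nat.rec ⟨(k₀, s₀), le_rfl, fun _ _ => rfl⟩ (fun _ x => next x) n
  obtain ⟨t, ht⟩ := exists_limit_branch (K := fun n => (seq n).1.1) (T := fun n => (seq n).1.2)
    (strictMono_nat_of_lt_succ fun n => (hnext (seq n)).1) (fun n => (hnext (seq n)).2.1)
  have hge : ∀ n, n ≤ ((F t).mapDomain (truncSeq d (seq n).1.1)).support.card := by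
    intro n
    rw [hT _ _ _ (ht n)]
    induction n with
    | zero => exact Nat.zero_le _
    | succ n ih => exact Nat.succ_le_of_lt (ih.trans_lt (hnext (seq n)).2.2)
  have h1 := hge ((F t).support.card + 1)
  have h2 := (Finset.card_le_card (Finsupp.mapDomain_support
    (f := truncSeq d (seq ((F t).support.card + 1)).1.1) (s := F t))).trans Finset.card_image_le
  omega

/-- A family of finitely supported functions on branches which is continuous and preserves
the order of the entries and an alternating property is a multiple of the identity. -/
theorem exists_eq_single [LinearOrder Λ] [WellFoundedLT Λ] {χ : Set (ℕ → Λ)}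
    (hχ : ∀ (t u : ℕ → Λ) (i : ℕ), (∀ j ≥ i, t j < t (j + 1)) → (∀ j ≥ i, u j = t (j + 1)) →
      (u ∈ χ ↔ t ∉ χ))
    (hT : ∀ k s t, (∀ i < k, s i = t i) →
      (F s).mapDomain (truncSeq d k) = (F t).mapDomain (truncSeq d k))
    (hlt : ∀ s i j, s i < s j → ∀ x ∈ (F s).support, x i < x j)
    (hlab : ∀ s ∈ χ, ∀ x ∈ (F s).support, x ∈ χ)
    (hlab' : ∀ s ∉ χ, ∀ x ∈ (F s).support, x ∉ χ) :
    ∃ c, ∀ s, F s = Finsupp.single s c := by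
  classical
  have hcone : ∀ (k₀ : ℕ) (s₀ : ℕ → Λ), ∃ k ≥ k₀, ∃ s : ℕ → Λ, (∀ i < k₀, s i = s₀ i) ∧
      ∀ x ∈ (F s).support, x = s := by
    intro k₀ s₀
    obtain ⟨k, hk, s, hs, hcard⟩ := exists_cone_card_eq hT k₀ s₀
    refine ⟨k, hk, s, hs, ?_⟩
    have hinj : ∀ t, (∀ i < k, t i = s i) → Set.InjOn (truncSeq d k) (F t).support := by
      intro t ht
      obtain ⟨l, hl⟩ := exists_injOn_truncSeq d (F t).support
      have h1 := hcard (max k l) (le_max_left _ _) t ht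
      rw [Finsupp.mapDomain_support_of_injOn _ (hl _ (le_max_right _ _)),
        Finset.card_image_of_injOn (hl _ (le_max_right _ _)), ← hT k t s ht] at h1
      have h2 := Finset.card_le_card (Finsupp.mapDomain_support (f := truncSeq d k) (s := F t))
      exact Finset.card_image_iff.1 (le_antisymm Finset.card_image_le (h1.trans_le h2))
    have hinj' : ∀ t, (∀ i < k, t i = s i) → ∀ l ≥ k,
        Set.InjOn (truncSeq d l) (F t).support := fun t ht l hl x hx y hy hxy =>
      hinj t ht hx hy (by rw [← truncSeq_truncSeq hl x, ← truncSeq_truncSeq hl y, hxy])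
    have himg : ∀ t t', (∀ i < k, t i = s i) → ∀ l ≥ k, (∀ i < l, t' i = t i) →
        (F t').support.image (truncSeq d l) = (F t).support.image (truncSeq d l) := by
      intro t t' ht l hl h
      have ht' : ∀ i < k, t' i = s i := fun i hi => by rw [h i (by omega), ht i hi]
      rw [← Finsupp.mapDomain_support_of_injOn _ (hinj' t ht l hl),
        ← Finsupp.mapDomain_support_of_injOn _ (hinj' t' ht' l hl), hT l t' t h]
    intro x hx
    have hex : ∀ t, ∃ y, (∀ i < k, t i = s i) →
        y ∈ (F t).support ∧ truncSeq d k y = truncSeq d k x := by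
      intro t
      by_cases ht : ∀ i < k, t i = s i
      · have := himg s t (fun _ _ => rfl) k le_rfl ht
        have hx' := Finset.mem_image_of_mem (truncSeq d k) hx
        rw [← this, Finset.mem_image] at hx'
        obtain ⟨y, hy⟩ := hx'
        exact ⟨y, fun _ => hy⟩
      · exact ⟨t, fun h => absurd h ht⟩
    choose h hh using hex
    have hs0 : ∀ i < k, s i = s i := fun _ _ => rfl
    have hhs : h s = s := by
      refine eq_self_of_preserves_labels hχ k s h ?_ ?_ ?_ s hs0
      · intro t t' ht l hl htt'
        have ht' : ∀ i < k, t' i = s i := fun i hi => by rw [htt' i (by omega), ht i hi]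
        obtain ⟨h1, h2⟩ := hh t ht
        obtain ⟨h3, h4⟩ := hh t' ht'
        have h5 := Finset.mem_image_of_mem (truncSeq d l) h3
        rw [himg t t' ht l hl htt', Finset.mem_image] at h5
        obtain ⟨y, hy, hye⟩ := h5
        have : y = h t := hinj t ht hy h1 (by
          rw [h2, ← h4, ← truncSeq_truncSeq hl y, hye, truncSeq_truncSeq hl])
        rw [this] at hye
        exact fun i hi => (truncSeq_eq_iff.1 hye i hi).symm
      · exact fun t ht i j hij => hlt t i j hij _ (hh t ht).1
      · exact fun t ht => ⟨fun hc => by_contra fun hn => hlab' t hn _ (hh t ht).1 hc,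
          fun hc => hlab t hc _ (hh t ht).1⟩
    rw [← hhs]
    exact hinj s hs0 hx (hh s hs0).1 (hh s hs0).2.symm
  have hsingle : ∀ s, (∀ x ∈ (F s).support, x = s) → F s = Finsupp.single s (F s s) := by
    intro s hs
    ext x
    by_cases hx : x = s
    · subst hx; simp
    · rw [Finsupp.single_eq_of_ne hx]
      by_contra hne
      exact hx (hs x (Finsupp.mem_support_iff.2 hne))
  let c := (F fun _ => d).mapDomain (truncSeq d 0) (fun _ => d)
  have hconst : ∀ s, (∀ x ∈ (F s).support, x = s) → F s = Finsupp.single s c := by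
    intro s hs
    have h1 := hT 0 s (fun _ => d) (by simp)
    rw [hsingle s hs, Finsupp.mapDomain_single] at h1
    have h2 : truncSeq d 0 s = fun _ => d := by funext i; simp [truncSeq]
    have h3 : F s s = c := by
      change _ = (F fun _ => d).mapDomain (truncSeq d 0) (fun _ => d)
      rw [← h1, h2, Finsupp.single_eq_same]
    rw [hsingle s hs, h3]
  refine ⟨c, fun s => eq_of_mapDomain_truncSeq (d := d) fun k => ?_⟩
  obtain ⟨l, hl, t, ht, hsupp⟩ := hcone k s
  rw [← hT k t s ht, hconst t hsupp, Finsupp.mapDomain_single, Finsupp.mapDomain_single,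
    truncSeq_eq_iff.2 ht]

end Branches

section RigidGroup

variable {X J : Type*}

theorem Rat.eq_zero_of_forall_eq_pow_mul {p : ℕ} (hp : p.Prime) {r : ℚ}
    (h : ∀ k : ℕ, ∃ q : ℚ, ¬ p ∣ q.den ∧ r = (p : ℚ) ^ k * q) : r = 0 := by
  obtain ⟨q, hq, hr⟩ := h r.num.natAbs
  have h1 : r.num * q.den = (p : ℤ) ^ r.num.natAbs * q.num * r.den := by
    have h2 : (r.num : ℚ) = r * r.den := (Rat.mul_den_eq_num r).symm
    have h3 : (q.num : ℚ) = q * q.den := (Rat.mul_den_eq_num q).symm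
    have : (r.num : ℚ) * q.den = (p : ℚ) ^ r.num.natAbs * q.num * r.den := by
      rw [h2, h3]
      nth_rewrite 1 [hr]
      ring
    exact_mod_cast this
  have h4 : p ^ r.num.natAbs ∣ r.num.natAbs * q.den := by
    have := congrArg Int.natAbs h1
    simp only [Int.natAbs_mul, Int.natAbs_pow, Int.natAbs_natCast] at this
    rw [this, mul_assoc]
    exact dvd_mul_right _ _
  have h5 := (Nat.Coprime.pow_left r.num.natAbs
    ((Nat.Prime.coprime_iff_not_dvd hp).2 hq)).dvd_of_dvd_mul_right h4
  by_contra hne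
  have h6 := Nat.le_of_dvd (Int.natAbs_pos.2 (Rat.num_ne_zero.2 hne)) h5
  exact absurd (Nat.lt_pow_self hp.one_lt) (not_lt.2 h6)

/-- The vectors whose images under all `Q j` have `p j`-integral coordinates. -/
def integralSubgroup (p : J → ℕ) (hp : ∀ j, (p j).Prime) (Q : J → (X →₀ ℚ) →+ (X →₀ ℚ)) :
    AddSubgroup (X →₀ ℚ) where
  carrier := {a | ∀ j y, ¬ p j ∣ (Q j a y).den}
  zero_mem' j y := by simpa using (hp j).ne_one
  add_mem' {a b} ha hb j y h := by
    rw [map_add, Finsupp.add_apply] at h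
    rcases (hp j).dvd_mul.1 (h.trans (Rat.add_den_dvd _ _)) with h | h
    exacts [ha j y h, hb j y h]
  neg_mem' {a} ha j y := by simpa using ha j y

variable {p : J → ℕ} {hp : ∀ j, (p j).Prime} {Q : J → (X →₀ ℚ) →+ (X →₀ ℚ)}

theorem inv_smul_mem_integralSubgroup {a : X →₀ ℚ} (ha : a ∈ integralSubgroup p hp Q) {m : ℕ}
    (hm : ∀ j, p j ∣ m → Q j a = 0) : (m : ℚ)⁻¹ • a ∈ integralSubgroup p hp Q := by
  intro j y h
  rw [map_rat_smul, Finsupp.smul_apply, smul_eq_mul] at h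
  by_cases hj : Q j a = 0
  · rw [hj] at h
    simp [(hp j).ne_one] at h
  rcases (hp j).dvd_mul.1 (h.trans (Rat.mul_den_dvd _ _)) with h | h
  · rw [Rat.inv_natCast_den] at h
    split_ifs at h with h0
    · exact (hp j).ne_one (Nat.dvd_one.1 h)
    · exact hj (hm j h)
  · exact ha j y h

theorem apply_eq_zero_of_integralSubgroup (hpi : Function.Injective p)
    (f : integralSubgroup p hp Q →+ integralSubgroup p hp Q) (a : integralSubgroup p hp Q) (j : J)
    (ha : Q j a = 0) : Q j (f a) = 0 := by
  ext y
  refine Rat.eq_zero_of_forall_eq_pow_mul (hp j) fun k => ?_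
  have hb : ((p j ^ k : ℕ) : ℚ)⁻¹ • (a : X →₀ ℚ) ∈ integralSubgroup p hp Q := by
    refine inv_smul_mem_integralSubgroup a.2 fun i hi => ?_
    have := hpi ((Nat.prime_dvd_prime_iff_eq (hp i) (hp j)).1 ((hp i).dvd_of_dvd_pow hi))
    rw [this, ha]
  have h0 : ((p j ^ k : ℕ) : ℚ) ≠ 0 := by exact_mod_cast pow_ne_zero _ (hp j).ne_zero
  have hab : a = (p j ^ k) • (⟨_, hb⟩ : integralSubgroup p hp Q) := by
    apply Subtype.ext
    rw [AddSubgroup.coe_nsmul, ← Nat.cast_smul_eq_nsmul ℚ, smul_smul, mul_inv_cancel₀ h0, one_smul]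
  refine ⟨Q j (f ⟨_, hb⟩) y, (f ⟨_, hb⟩).2 j y, ?_⟩
  conv_lhs => rw [hab]
  rw [map_nsmul, AddSubgroup.coe_nsmul, map_nsmul, Finsupp.smul_apply, nsmul_eq_mul]
  push_cast
  rfl

theorem exists_nsmul_mem_integralSubgroup {f : integralSubgroup p hp Q →+ integralSubgroup p hp Q}
    (hs : ∀ x, Finsupp.single x 1 ∈ integralSubgroup p hp Q)
    (hf : ∀ x, f ⟨_, hs x⟩ = 0) (v : X →₀ ℚ) :
    ∃ n : ℕ, n ≠ 0 ∧ ∃ h : n • v ∈ integralSubgroup p hp Q, f ⟨_, h⟩ = 0 := by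
  induction v using Finsupp.induction_linear with
  | zero => exact ⟨1, one_ne_zero, by simp, by
    have : (⟨1 • 0, by simp⟩ : integralSubgroup p hp Q) = 0 := Subtype.ext (smul_zero _)
    rw [this, map_zero]⟩
  | add v w hv hw =>
    obtain ⟨n, hn, h1, h2⟩ := hv
    obtain ⟨m, hm, h3, h4⟩ := hw
    have : (n * m) • (v + w) = m • (n • v) + n • (m • w) := by
      rw [smul_add, smul_smul, smul_smul, mul_comm m n]
    refine ⟨n * m, mul_ne_zero hn hm, ?_⟩
    simp only [this]
    refine ⟨add_mem (nsmul_mem h1 m) (nsmul_mem h3 n), ?_⟩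
    have : (⟨m • (n • v) + n • (m • w), add_mem (nsmul_mem h1 m) (nsmul_mem h3 n)⟩ :
      integralSubgroup p hp Q) = m • ⟨n • v, h1⟩ + n • ⟨m • w, h3⟩ := rfl
    rw [this, map_add, map_nsmul, map_nsmul, h2, h4]
    simp
  | single x r =>
    have : r.den • Finsupp.single x r = r.num • Finsupp.single x (1 : ℚ) := by
      rw [Finsupp.smul_single, Finsupp.smul_single, nsmul_eq_mul, mul_comm, Rat.mul_den_eq_num]
      simp
    refine ⟨r.den, r.den_nz, ?_⟩
    simp only [this]
    refine ⟨zsmul_mem (hs x) _, ?_⟩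
    have : (⟨r.num • Finsupp.single x 1, zsmul_mem (hs x) _⟩ : integralSubgroup p hp Q) =
      r.num • ⟨_, hs x⟩ := rfl
    rw [this, map_zsmul, hf, smul_zero]

end RigidGroup

/-- There are arbitrarily large torsion-free abelian groups, divisible by a given integer,
with an element that is killed only by the zero endomorphism. -/
theorem exists_rigid_addCommGroup (κ : Cardinal.{u}) (N : ℕ) (hN : N ≠ 0) :
    ∃ (E : Type u) (_ : AddCommGroup E) (z : E), κ ≤ Cardinal.mk E ∧ z ≠ 0 ∧
      (∀ n : ℕ, n ≠ 0 → ∀ x : E, n • x = 0 → x = 0) ∧ (∀ x : E, ∃ y, N • y = x) ∧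
      ∀ f : E →+ E, f z = 0 → f = 0 := by
  classical
  obtain ⟨Λ, d, hΛ⟩ : ∃ (Λ : Type u) (_ : Λ), κ ≤ Cardinal.mk Λ :=
    ⟨Option κ.out, none, by
      conv_lhs => rw [← Cardinal.mk_out κ]
      exact Cardinal.mk_le_of_injective (Option.some_injective _)⟩
  obtain ⟨_, _⟩ := exists_wellFoundedLT Λ
  obtain ⟨χ, hχ⟩ := exists_alternating_property (Λ := Λ)
  let J := ℕ ⊕ (ℕ × ℕ) ⊕ Bool
  let p : J → ℕ := fun j => Nat.nth Nat.Prime (Encodable.encode j + (N + 1))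
  have hp : ∀ j, (p j).Prime := fun j => Nat.prime_nth_prime _
  have hpi : Function.Injective p := fun i j hij => by
    have := Nat.nth_injective Nat.infinite_setOfPred_prime hij
    exact Encodable.encode_injective (by omega)
  have hpN : ∀ j, ¬ p j ∣ N := fun j h => by
    have h1 := Nat.le_of_dvd (Nat.pos_of_ne_zero hN) h
    have h2 := (Nat.nth_strictMono Nat.infinite_setOfPred_prime).le_apply
      (x := Encodable.encode j + (N + 1))
    exact absurd (h2.trans h1) (by omega)
  let Q : J → ((ℕ → Λ) →₀ ℚ) →+ ((ℕ → Λ) →₀ ℚ) := Sum.elim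
    (fun k => Finsupp.mapDomain.addMonoidHom (truncSeq d k)) (Sum.elim
    (fun ij => Finsupp.filterAddHom fun x => ¬ x ij.1 < x ij.2)
    (fun b => Finsupp.filterAddHom fun x => (x ∈ χ ↔ b = true)))
  have hs : ∀ x, Finsupp.single x 1 ∈ integralSubgroup p hp Q := by
    intro x j y h
    have : Q j (Finsupp.single x 1) y = 0 ∨ Q j (Finsupp.single x 1) y = 1 := by
      rcases j with k | ij | b
      · change Finsupp.mapDomain _ _ _ = 0 ∨ Finsupp.mapDomain _ _ _ = _
        rw [Finsupp.mapDomain_single, Finsupp.single_apply]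
        split_ifs <;> simp
      · change Finsupp.filter _ _ _ = 0 ∨ Finsupp.filter _ _ _ = _
        rw [Finsupp.filter_apply, Finsupp.single_apply]
        split_ifs <;> simp
      · change Finsupp.filter _ _ _ = 0 ∨ Finsupp.filter _ _ _ = _
        rw [Finsupp.filter_apply, Finsupp.single_apply]
        split_ifs <;> simp
    rcases this with h1 | h1 <;> rw [h1] at h <;> exact (hp j).ne_one (Nat.dvd_one.1 h)
  have htf : ∀ n : ℕ, n ≠ 0 → ∀ x : integralSubgroup p hp Q, n • x = 0 → x = 0 := by
    intro n hn x hx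
    have := congrArg Subtype.val hx
    rw [AddSubgroup.coe_nsmul] at this
    exact Subtype.ext ((smul_eq_zero.1 this).resolve_left hn)
  refine ⟨integralSubgroup p hp Q, inferInstance, ⟨_, hs fun _ => d⟩, ?_, ?_, htf, ?_, ?_⟩
  · refine hΛ.trans (Cardinal.mk_le_of_injective (f := fun l => ⟨_, hs fun _ => l⟩) ?_)
    intro l m hlm
    have := Finsupp.single_left_injective (one_ne_zero (α := ℚ)) (congrArg Subtype.val hlm)
    exact congrFun this 0
  · intro h
    simpa using congrArg Subtype.val h
  · intro x
    have h0 : (N : ℚ) ≠ 0 := by exact_mod_cast hN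
    refine ⟨⟨(N : ℚ)⁻¹ • (x : (ℕ → Λ) →₀ ℚ),
      inv_smul_mem_integralSubgroup x.2 fun j hj => absurd hj (hpN j)⟩, Subtype.ext ?_⟩
    rw [AddSubgroup.coe_nsmul, ← Nat.cast_smul_eq_nsmul ℚ, smul_smul, mul_inv_cancel₀ h0, one_smul]
  · intro f hf
    have hker := apply_eq_zero_of_integralSubgroup hpi f
    obtain ⟨c, hc⟩ := exists_eq_single (d := d) (F := fun s => (f ⟨_, hs s⟩ : (ℕ → Λ) →₀ ℚ)) hχ
      (fun k s t hst => by
        have h1 := hker (⟨_, hs s⟩ - ⟨_, hs t⟩) (Sum.inl k) (by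
          rw [AddSubgroup.coe_sub, map_sub, sub_eq_zero]
          change Finsupp.mapDomain _ _ = Finsupp.mapDomain _ _
          rw [Finsupp.mapDomain_single, Finsupp.mapDomain_single, truncSeq_eq_iff.2 hst])
        rwa [map_sub, AddSubgroup.coe_sub, map_sub, sub_eq_zero] at h1)
      (fun s i j hij x hx => by
        have h1 := hker ⟨_, hs s⟩ (Sum.inr (Sum.inl (i, j))) (by
          change Finsupp.filter _ _ = 0
          rw [Finsupp.filter_single_of_neg (fun x : ℕ → Λ => ¬ x (i, j).1 < x (i, j).2)
            (not_not.2 hij)])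
        by_contra hn
        have h2 := DFunLike.congr_fun h1 x
        change Finsupp.filter _ _ _ = 0 at h2
        rw [Finsupp.filter_apply_pos (fun x : ℕ → Λ => ¬ x (i, j).1 < x (i, j).2) _ hn] at h2
        exact Finsupp.mem_support_iff.1 hx h2)
      (fun s hsχ x hx => by
        have h1 := hker ⟨_, hs s⟩ (Sum.inr (Sum.inr false)) (by
          change Finsupp.filter _ _ = 0
          rw [Finsupp.filter_single_of_neg _ (by simp [hsχ])])
        by_contra hn
        have h2 := DFunLike.congr_fun h1 x
        change Finsupp.filter _ _ _ = 0 at h2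
        rw [Finsupp.filter_apply_pos _ _ (by simp [hn])] at h2
        exact Finsupp.mem_support_iff.1 hx h2)
      (fun s hsχ x hx hn => by
        have h1 := hker ⟨_, hs s⟩ (Sum.inr (Sum.inr true)) (by
          change Finsupp.filter _ _ = 0
          rw [Finsupp.filter_single_of_neg _ (by simp [hsχ])])
        have h2 := DFunLike.congr_fun h1 x
        change Finsupp.filter _ _ _ = 0 at h2
        rw [Finsupp.filter_apply_pos _ _ (by simp [hn])] at h2
        exact Finsupp.mem_support_iff.1 hx h2)
    have hc0 : c = 0 := by
      have h1 := hc fun _ => d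
      rw [hf] at h1
      simpa using h1.symm
    subst hc0
    have hfs : ∀ s, f ⟨_, hs s⟩ = 0 := fun s => Subtype.ext (by simpa using hc s)
    ext1 x
    obtain ⟨n, hn, h1, h2⟩ := exists_nsmul_mem_integralSubgroup hs hfs x
    refine htf n hn _ ?_
    rw [← map_nsmul]
    exact h2

section SimpleGroupOfOrder7920

open Subgroup

variable {S : Type*} [Group S] [Finite S]

instance fact_prime_eleven : Fact (Nat.Prime 11) := ⟨by norm_num⟩

theorem card_sylow_of_card (hcard : Nat.card S = 7920) (P : Sylow 11 S) : Nat.card P = 11 := by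
  have h := P.card_eq_multiplicity
  have h1 : (7920 : ℕ).factorization 11 = 1 := by
    rw [Nat.factorization_def _ (by norm_num), show 7920 = 11 * 720 by norm_num,
      padicValNat.mul (by norm_num) (by norm_num), padicValNat.self (by norm_num),
      padicValNat.eq_zero_of_not_dvd (by norm_num)]
  rw [hcard, h1, pow_one] at h
  exact h

theorem card_sylow_cases [IsSimpleGroup S] (hcard : Nat.card S = 7920) :
    Nat.card (Sylow 11 S) = 12 ∨ Nat.card (Sylow 11 S) = 45 ∨ Nat.card (Sylow 11 S) = 144 := by
  obtain ⟨P⟩ := (inferInstance : Nonempty (Sylow 11 S))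
  have hP := card_sylow_of_card hcard P
  have h1 := card_sylow_modEq_one 11 S
  have h2 := P.card_dvd_index
  have h3 := (P : Subgroup S).card_mul_index
  rw [hcard, show Nat.card (P : Subgroup S) = 11 from hP] at h3
  have h4 : (P : Subgroup S).index = 720 := by omega
  rw [h4] at h2
  have h5 : Nat.card (Sylow 11 S) ≠ 1 := by
    intro h
    have := Finite.card_le_one_iff_subsingleton.1 h.le
    rcases P.normal_of_subsingleton.eq_bot_or_eq_top with h | h <;>
      rw [h] at h4 <;> simp [hcard] at h4
  have h6 := Nat.le_of_dvd (by norm_num) h2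
  generalize Nat.card (Sylow 11 S) = n at *
  have h7 : n ∈ Nat.divisors 720 := Nat.mem_divisors.2 ⟨h2, by norm_num⟩
  have h8 : ∀ n ∈ Nat.divisors 720, n % 11 = 1 → n ≠ 1 → n = 12 ∨ n = 45 ∨ n = 144 := by
    decide +kernel
  exact h8 n h7 h1 h5

theorem card_normalizer_eq (hcard : Nat.card S = 7920) (P : Sylow 11 S) :
    ∃ k, k ∣ 10 ∧ Nat.card (normalizer (P : Set S)) = Nat.card (centralizer (P : Set S)) * k := by
  have hP := card_sylow_of_card hcard P
  have hcyc : IsCyclic (P : Subgroup S) := isCyclic_of_prime_card (p := 11) hP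
  let f := (P : Subgroup S).normalizerMonoidHom
  refine ⟨Nat.card f.range, ?_, ?_⟩
  · have h := f.range.card_subgroup_dvd_card
    rw [IsCyclic.card_mulAut, show Nat.card (P : Subgroup S) = 11 from hP,
      Nat.totient_prime (by norm_num)] at h
    exact h
  · have h := f.ker.card_mul_index
    rw [Subgroup.index_ker, (P : Subgroup S).normalizerMonoidHom_ker] at h
    rw [← Nat.card_congr (subgroupOfEquivOfLe
      (centralizer_le_normalizer (P : Set S))).toEquiv]
    exact h.symm

open Classical in
theorem card_centralizer_sylow_dvd [IsSimpleGroup S] (hcard : Nat.card S = 7920) (P : Sylow 11 S)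
    {m : ℕ} (hm : Nat.card (Sylow 11 S) = 11 * (m + 1) + 1) :
    Nat.card (centralizer (P : Set S)) ∣ 11 ^ (m + 1) * (m + 1).factorial ∧
      (0 < m → 2 * Nat.card (centralizer (P : Set S)) ∣ 11 ^ (m + 1) * (m + 1).factorial) := by
  have hP := card_sylow_of_card hcard P
  let _ : Fintype (Sylow 11 S) := Fintype.ofFinite _
  let ρ : S →* Equiv.Perm (Sylow 11 S) := MulAction.toPermHom S (Sylow 11 S)
  have hρ : Function.Injective ρ := by
    rw [← MonoidHom.ker_eq_bot_iff]
    refine (MonoidHom.normal_ker ρ).eq_bot_or_eq_top.resolve_right fun h => ?_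
    have hall : ∀ Q : Sylow 11 S, Q = P := by
      intro Q
      obtain ⟨g, hg⟩ := MulAction.exists_smul_eq S P Q
      have hg1 : ρ g = 1 := (h ▸ mem_top g : g ∈ ρ.ker)
      have : ρ g P = P := by rw [hg1]; rfl
      rw [← hg]; exact this
    have : Subsingleton (Sylow 11 S) := ⟨fun a b => (hall a).trans (hall b).symm⟩
    have := Finite.card_le_one_iff_subsingleton.2 this
    omega
  have hsign : ∀ g, Equiv.Perm.sign (ρ g) = 1 := by
    rcases (MonoidHom.normal_ker (Equiv.Perm.sign.comp ρ)).eq_bot_or_eq_top with h | h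
    · have h1 := Nat.card_le_card_of_injective _ ((MonoidHom.ker_eq_bot_iff _).1 h)
      rw [hcard, Nat.card_eq_fintype_card, Fintype.card_units_int] at h1
      omega
    · intro g
      exact (h ▸ mem_top g : g ∈ (Equiv.Perm.sign.comp ρ).ker)
  have hcyc : IsCyclic (P : Subgroup S) := isCyclic_of_prime_card (p := 11) hP
  obtain ⟨⟨p, hpP⟩, hp⟩ := hcyc.exists_generator
  have hgen : ∀ x ∈ P, ∃ k : ℤ, p ^ k = x := fun x hx => by
    obtain ⟨k, hk⟩ := hp ⟨x, hx⟩
    exact ⟨k, congrArg Subtype.val hk⟩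
  have hord : orderOf (ρ p) = 11 := by
    rw [orderOf_injective ρ hρ, ← Subgroup.orderOf_mk p hpP]
    exact (orderOf_eq_card_of_forall_mem_zpowers hp).trans hP
  obtain ⟨r, hr⟩ := Equiv.Perm.cycleType_prime_order (σ := ρ p) (by rw [hord]; norm_num)
  rw [hord] at hr
  have hfix : Fintype.card (Function.fixedPoints (ρ p)) = 1 := by
    rw [Fintype.card_eq_one_iff]
    have key : ∀ Q : Sylow 11 S, p • Q = Q ↔ Q = P := by
      intro Q
      rw [Sylow.smul_eq_iff_mem_normalizer]
      constructor
      · intro h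
        have hle : (P : Subgroup S) ≤ normalizer (Q : Set S) := by
          intro x hx
          obtain ⟨k, rfl⟩ := hgen x hx
          exact zpow_mem h k
        have h1 := P.2.inf_normalizer_sylow Q
        have h2 : (P : Subgroup S) ≤ Q := by
          rw [inf_eq_left.2 hle] at h1
          exact inf_eq_left.1 h1.symm
        exact Sylow.ext (P.3 Q.2 h2)
      · rintro rfl
        exact le_normalizer hpP
    exact ⟨⟨P, (key P).2 rfl⟩, fun Q => Subtype.ext ((key Q).1 Q.2)⟩
  rw [Equiv.Perm.card_fixedPoints, hr, ← Nat.card_eq_fintype_card, hm] at hfix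
  simp only [Multiset.sum_replicate, smul_eq_mul] at hfix
  obtain rfl : r = m := by omega
  have hZ := Equiv.Perm.nat_card_centralizer (ρ p)
  rw [hr, ← Nat.card_eq_fintype_card, hm] at hZ
  simp only [Multiset.sum_replicate, Multiset.prod_replicate, smul_eq_mul,
    Multiset.toFinset_replicate, Nat.succ_ne_zero, if_false, Finset.prod_singleton,
    Multiset.count_replicate_self, show 11 * (r + 1) + 1 - (r + 1) * 11 = 1 by omega,
    Nat.factorial_one, one_mul] at hZ
  have hle : (centralizer (P : Set S)).map ρ ≤ centralizer {ρ p} ⊓ alternatingGroup _ := by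
    rintro _ ⟨x, hx, rfl⟩
    refine ⟨?_, hsign x⟩
    change ρ x ∈ centralizer {ρ p}
    rw [mem_centralizer_singleton_iff, ← map_mul, ← map_mul,
      (mem_centralizer_iff.1 hx p hpP)]
  have hmapcard : Nat.card ((centralizer (P : Set S)).map ρ) = Nat.card (centralizer (P : Set S)) :=
    Nat.card_congr (equivMapOfInjective _ ρ hρ).toEquiv.symm
  refine ⟨?_, fun hr0 => ?_⟩
  · rw [← hZ, ← hmapcard]
    exact card_dvd_of_le (hle.trans inf_le_left)
  · have hnot : ¬ centralizer {ρ p} ≤ alternatingGroup (Sylow 11 S) := by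
      intro h
      have := Equiv.Perm.count_le_one_of_centralizer_le_alternating h 11
      rw [hr, Multiset.count_replicate_self] at this
      omega
    let f := Equiv.Perm.sign.comp (centralizer {ρ p}).subtype
    have hf1 := f.ker.card_mul_index
    rw [Subgroup.index_ker] at hf1
    have hrange : Nat.card f.range = 2 := by
      have h1 := f.range.card_subgroup_dvd_card
      rw [Nat.card_eq_fintype_card (α := ℤˣ), Fintype.card_units_int] at h1
      refine ((Nat.dvd_prime Nat.prime_two).1 h1).resolve_left fun h => hnot ?_
      intro x hx
      have : f ⟨x, hx⟩ ∈ f.range := ⟨_, rfl⟩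
      rw [Subgroup.card_eq_one.1 h] at this
      exact this
    have hker : Nat.card (centralizer (P : Set S)) ∣ Nat.card f.ker := by
      rw [← hmapcard, ← Nat.card_congr (subgroupOfEquivOfLe (hle.trans inf_le_left)).toEquiv]
      refine card_dvd_of_le fun x hx => ?_
      exact (hle hx).2
    rw [← hZ, ← hf1, hrange, mul_comm]
    exact Nat.mul_dvd_mul_right hker 2

theorem card_sylow_eq [IsSimpleGroup S] (hcard : Nat.card S = 7920) :
    Nat.card (Sylow 11 S) = 144 := by
  obtain ⟨P⟩ := (inferInstance : Nonempty (Sylow 11 S))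
  obtain ⟨k, hk, hN⟩ := card_normalizer_eq hcard P
  have h1 := (normalizer (P : Set S)).card_mul_index
  rw [← P.card_eq_index_normalizer, hcard] at h1
  have hk' : k ∈ Nat.divisors 10 := Nat.mem_divisors.2 ⟨hk, by norm_num⟩
  rw [show Nat.divisors 10 = {1, 2, 5, 10} by decide +kernel] at hk'
  simp only [Finset.mem_insert, Finset.mem_singleton] at hk'
  rcases card_sylow_cases hcard with h | h | h
  · have h2 := (card_centralizer_sylow_dvd hcard P (m := 0) h).1
    rw [h] at h1
    have h3 := Nat.le_of_dvd (by norm_num) h2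
    simp at h3
    rcases hk' with rfl | rfl | rfl | rfl <;> omega
  · have h2 := (card_centralizer_sylow_dvd hcard P (m := 3) h).2 (by norm_num)
    rw [h] at h1
    rcases hk' with rfl | rfl | rfl | rfl
    · rw [show Nat.card (centralizer (P : Set S)) = 176 by omega] at h2
      norm_num [Nat.factorial] at h2
    · rw [show Nat.card (centralizer (P : Set S)) = 88 by omega] at h2
      norm_num [Nat.factorial] at h2
    · omega
    · omega
  · exact h

end SimpleGroupOfOrder7920

section SimpleGroupOfOrder7920

open Subgroup

variable {S : Type*} [Group S] [Finite S]

theorem card_normalizer_sylow [IsSimpleGroup S] (hcard : Nat.card S = 7920) (P : Sylow 11 S) :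
    Nat.card (normalizer (P : Set S)) = 55 := by
  have h1 := (normalizer (P : Set S)).card_mul_index
  rw [← P.card_eq_index_normalizer, hcard, card_sylow_eq hcard] at h1
  omega

theorem centralizer_sylow_eq [IsSimpleGroup S] (hcard : Nat.card S = 7920) (P : Sylow 11 S) :
    centralizer (P : Set S) = P := by
  have hP := card_sylow_of_card hcard P
  have hN := card_normalizer_sylow hcard P
  obtain ⟨k, hk, hZ⟩ := card_normalizer_eq hcard P
  have hcyc : IsCyclic (P : Subgroup S) := isCyclic_of_prime_card (p := 11) hP
  have hle : (P : Subgroup S) ≤ centralizer (P : Set S) :=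
    le_centralizer_iff_isMulCommutative.2 inferInstance
  have hnot : ¬ normalizer (P : Set S) ≤ centralizer (P : Set S) := by
    intro h
    have hcompl := MonoidHom.ker_transferSylow_isComplement' P h
    have hmul := hcompl.card_mul_card
    rw [show Nat.card (P : Subgroup S) = 11 from hP, hcard] at hmul
    rcases (MonoidHom.normal_ker (MonoidHom.transferSylow P h)).eq_bot_or_eq_top with h1 | h1 <;>
      rw [h1] at hmul <;> simp [hcard] at hmul
  have hk' : k ∈ Nat.divisors 10 := Nat.mem_divisors.2 ⟨hk, by norm_num⟩
  rw [show Nat.divisors 10 = {1, 2, 5, 10} by decide +kernel] at hk'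
  simp only [Finset.mem_insert, Finset.mem_singleton] at hk'
  rw [hN] at hZ
  have hZ11 : Nat.card (centralizer (P : Set S)) = 11 := by
    rcases hk' with rfl | rfl | rfl | rfl
    · refine absurd (eq_of_le_of_card_ge (centralizer_le_normalizer (P : Set S)) ?_).ge hnot
      omega
    all_goals omega
  exact (eq_of_le_of_card_ge hle (by rw [hZ11]; exact hP.ge)).symm

/-- A simple group of order 7920 has a subgroup of order 55 (the normalizer of a Sylow
11-subgroup) and an element, generating another Sylow 11-subgroup, in general position. -/
theorem exists_subgroup_card_55 [IsSimpleGroup S] (hcard : Nat.card S = 7920) :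
    ∃ (C : Subgroup S) (s : S), Nat.card C = 55 ∧
      (∀ a, (∀ c ∈ C, a⁻¹ * c * a ∈ C) → a ∈ C) ∧
      (∀ x, (∀ c ∈ C, x * c = c * x) → x = 1) ∧ s ∉ C ∧ s ^ 2 ∉ C ∧
      (∀ c ∈ C, c ^ 2 = 1 → c = 1) ∧
      ∀ c ∈ C, (∀ i : ℕ, (s ^ i)⁻¹ * c * s ^ i ∈ C) → c = 1 := by
  obtain ⟨P⟩ := (inferInstance : Nonempty (Sylow 11 S))
  obtain ⟨Q, hQP⟩ : ∃ Q : Sylow 11 S, Q ≠ P := by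
    by_contra h
    push Not at h
    have : Subsingleton (Sylow 11 S) := ⟨fun a b => (h a).trans (h b).symm⟩
    have h1 := Finite.card_le_one_iff_subsingleton.2 this
    rw [card_sylow_eq hcard] at h1
    omega
  have hP := card_sylow_of_card hcard P
  have hQ := card_sylow_of_card hcard Q
  have hcyc : IsCyclic (Q : Subgroup S) := isCyclic_of_prime_card (p := 11) hQ
  obtain ⟨⟨s, hsQ⟩, hs⟩ := hcyc.exists_generator
  have hzp : zpowers s = Q := by
    ext x
    constructor
    · rintro ⟨k, rfl⟩
      exact zpow_mem hsQ k
    · intro hx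
      obtain ⟨k, hk⟩ := hs ⟨x, hx⟩
      exact ⟨k, congrArg Subtype.val hk⟩
  have hord : orderOf s = 11 := by
    rw [← Nat.card_zpowers, hzp]; exact hQ
  have hs11 : s ^ 11 = 1 := hord ▸ pow_orderOf_eq_one s
  set C := normalizer (P : Set S) with hC
  have hC55 : Nat.card C = 55 := card_normalizer_sylow hcard P
  have hCpow : ∀ c ∈ C, c ^ 55 = 1 := fun c hc => by
    have := pow_card_eq_one' (x := (⟨c, hc⟩ : C))
    rw [hC55] at this
    exact congrArg Subtype.val this
  have hsC : s ∉ C := by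
    intro h
    have h1 := Q.2.inf_normalizer_sylow P
    have h2 : (Q : Subgroup S) ≤ P := by
      rw [inf_eq_left.2 (by rw [← hzp]; exact zpowers_le.2 h)] at h1
      exact inf_eq_left.1 h1.symm
    exact hQP (Sylow.ext (Q.3 P.2 h2)).symm
  have htwo : ∀ c ∈ C, c ^ 2 = 1 → c = 1 := by
    intro c hc h2
    have h55 := hCpow c hc
    rw [show 55 = 2 * 27 + 1 by norm_num, pow_succ, pow_mul, h2, one_pow, one_mul] at h55
    exact h55
  have hPC : (P : Subgroup S) ≤ C := le_normalizer
  refine ⟨C, s, hC55, ?_, ?_, hsC, ?_, htwo, ?_⟩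
  · intro a ha
    have hmap : C.map (MulAut.conj a⁻¹).toMonoidHom = C := by
      refine eq_of_le_of_card_ge ?_ ?_
      · rintro _ ⟨c, hc, rfl⟩
        simpa using ha c hc
      · exact (Nat.card_congr (C.equivMapOfInjective _
          (MulAut.conj a⁻¹).injective).toEquiv).le
    rw [hC, ← P.normalizer_normalizer, ← hC, ← inv_mem_iff, mem_normalizer_iff]
    intro h
    have e : ∀ h, (MulAut.conj a⁻¹).toMonoidHom h = a⁻¹ * h * a⁻¹⁻¹ := fun h => rfl
    constructor
    · intro hh
      rw [← e, ← hmap]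
      exact mem_map_of_mem _ hh
    · intro hh
      rw [← hmap, ← e] at hh
      exact (mem_map_iff_mem (MulAut.conj a⁻¹).injective).1 hh
  · intro x hx
    have hxP : x ∈ P := by
      change x ∈ (P : Subgroup S)
      rw [← centralizer_sylow_eq hcard P, mem_centralizer_iff]
      exact fun c hc => (hx c (hPC hc)).symm
    by_contra hx1
    have hxz : zpowers x = P := by
      refine eq_of_le_of_card_ge (zpowers_le.2 hxP) ?_
      rw [Nat.card_zpowers, show Nat.card (P : Subgroup S) = 11 from hP]
      refine (orderOf_eq_prime ?_ hx1).ge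
      have := pow_card_eq_one' (x := (⟨x, hxP⟩ : (P : Subgroup S)))
      rw [show Nat.card (P : Subgroup S) = 11 from hP] at this
      exact congrArg Subtype.val this
    have hle : C ≤ P := by
      intro c hc
      rw [← centralizer_sylow_eq hcard P, mem_centralizer_iff]
      change ∀ h ∈ (P : Subgroup S), h * c = c * h
      rw [← hxz]
      rintro _ ⟨k, rfl⟩
      exact ((show Commute x c from hx c hc).zpow_left k).eq
    have := card_le_of_le hle
    rw [hC55, show Nat.card (P : Subgroup S) = 11 from hP] at this
    omega
  · intro h
    refine hsC ?_
    have : s = (s ^ 2) ^ 6 := by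
      rw [← pow_mul, show 2 * 6 = 11 + 1 by norm_num, pow_succ, hs11, one_mul]
    rw [this]
    exact pow_mem h 6
  · let T : Subgroup S :=
      { carrier := {x | ∀ i : ℕ, (s ^ i)⁻¹ * x * s ^ i ∈ C}
        one_mem' := fun i => by simp
        mul_mem' := fun {a b} ha hb i => by
          have := C.mul_mem (ha i) (hb i)
          rwa [show (s ^ i)⁻¹ * a * s ^ i * ((s ^ i)⁻¹ * b * s ^ i) =
            (s ^ i)⁻¹ * (a * b) * s ^ i by group] at this
        inv_mem' := fun {a} ha i => by
          have := C.inv_mem (ha i)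
          rwa [show ((s ^ i)⁻¹ * a * s ^ i)⁻¹ = (s ^ i)⁻¹ * a⁻¹ * s ^ i by group] at this }
    have hTC : T ≤ C := fun x hx => by simpa using hx 0
    have hsT : s ∈ normalizer (T : Set S) := by
      rw [mem_normalizer_iff]
      intro h
      constructor
      · intro hh i
        have h1 := hh (i + 10)
        have e : s ^ (i + 10) = s⁻¹ * s ^ i := by
          rw [eq_inv_mul_iff_mul_eq, ← pow_succ', show i + 10 + 1 = 11 + i by ring, pow_add, hs11,
            one_mul]
        rw [e] at h1
        convert h1 using 1
        group
      · intro hh i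
        have h1 := hh (i + 1)
        rw [pow_succ'] at h1
        convert h1 using 1
        group
    have hT55 : Nat.card T ∣ 55 := hC55 ▸ card_dvd_of_le hTC
    have hT11 : ¬ 11 ∣ Nat.card T := by
      intro hdvd
      obtain ⟨⟨x, hxT⟩, hx⟩ := exists_prime_orderOf_dvd_card' 11 hdvd
      rw [Subgroup.orderOf_mk] at hx
      have hmemP : ∀ y ∈ C, orderOf y = 11 → y ∈ P := by
        intro y hy hy11
        have hp : IsPGroup 11 (zpowers y) := IsPGroup.of_card (n := 1) (by
          rw [Nat.card_zpowers, hy11, pow_one])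
        have h1 := hp.inf_normalizer_sylow P
        rw [inf_eq_left.2 (zpowers_le.2 hy)] at h1
        exact zpowers_le.1 (inf_eq_left.1 h1.symm)
      have hxP := hmemP x (hTC hxT) hx
      have hxz : zpowers x = P := by
        refine eq_of_le_of_card_ge (zpowers_le.2 hxP) ?_
        rw [Nat.card_zpowers, show Nat.card (P : Subgroup S) = 11 from hP, hx]
      have hle : (P : Subgroup S) ≤ T := hxz ▸ zpowers_le.2 hxT
      refine hsC ?_
      have hconj : ∀ i : ℕ, ∀ y ∈ P, (s ^ i)⁻¹ * y * s ^ i ∈ P := by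
        intro i y hy
        by_cases hy1 : y = 1
        · rw [hy1]; simp
        refine hmemP _ (hle hy i) ?_
        have e : (s ^ i)⁻¹ * y * s ^ i = MulAut.conj (s ^ i)⁻¹ y := by
          rw [MulAut.conj_apply, inv_inv]
        rw [e, MulEquiv.orderOf_eq]
        refine orderOf_eq_prime ?_ hy1
        have := pow_card_eq_one' (x := (⟨y, hy⟩ : (P : Subgroup S)))
        rw [show Nat.card (P : Subgroup S) = 11 from hP] at this
        exact congrArg Subtype.val this
      rw [hC]
      refine mem_normalizer_iff.2 fun y => ⟨fun hy => ?_, fun hy => ?_⟩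
      · have := hconj 10 y hy
        have e : s ^ 10 = s⁻¹ := by
          rw [eq_inv_iff_mul_eq_one, ← pow_succ, hs11]
        rwa [e, inv_inv] at this
      · have := hconj 1 _ hy
        rw [pow_one, show s⁻¹ * (s * y * s⁻¹) * s = y by group] at this
        exact this
    have hT5 : Nat.card T ∣ 5 := by
      refine (Nat.Coprime.dvd_mul_left ?_).1 (show Nat.card T ∣ 11 * 5 from hT55)
      exact ((Nat.Prime.coprime_iff_not_dvd (by norm_num)).2 hT11).symm
    have hTcyc : IsCyclic T := by
      rcases (Nat.dvd_prime (by norm_num)).1 hT5 with h | h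
      · have := Finite.card_le_one_iff_subsingleton.1 h.le
        infer_instance
      · have : Fact (Nat.Prime 5) := ⟨by norm_num⟩
        exact isCyclic_of_prime_card (p := 5) h
    have hscent : s ∈ centralizer (T : Set S) := by
      let f := T.normalizerMonoidHom
      have h1 : f ⟨s, hsT⟩ = 1 := by
        have h11 : (f ⟨s, hsT⟩) ^ 11 = 1 := by
          rw [← map_pow]
          have : (⟨s, hsT⟩ : normalizer (T : Set S)) ^ 11 = 1 := Subtype.ext hs11
          rw [this, map_one]
        have h4 : (f ⟨s, hsT⟩) ^ 4 = 1 := by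
          have hc : Nat.card (MulAut T) ∣ 4 := by
            rw [IsCyclic.card_mulAut]
            rcases (Nat.dvd_prime (by norm_num)).1 hT5 with h | h <;> rw [h]
            · simp
            · rw [Nat.totient_prime (by norm_num)]
          exact orderOf_dvd_iff_pow_eq_one.1 ((_root_.orderOf_dvd_natCard _).trans hc)
        have h12 : (f ⟨s, hsT⟩) ^ 12 = 1 := by
          rw [show 12 = 4 * 3 by norm_num, pow_mul, h4, one_pow]
        rw [pow_succ, h11, one_mul] at h12
        exact h12
      have h2 : (⟨s, hsT⟩ : normalizer (T : Set S)) ∈ f.ker := h1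
      rw [show f.ker = _ from T.normalizerMonoidHom_ker] at h2
      exact h2
    intro c hc hcT
    have hcs : c * s = s * c := mem_centralizer_iff.1 hscent c hcT
    have hcQ : c ∈ Q := by
      change c ∈ (Q : Subgroup S)
      rw [← centralizer_sylow_eq hcard Q, mem_centralizer_iff]
      change ∀ h ∈ (Q : Subgroup S), h * c = c * h
      rw [← hzp]
      rintro _ ⟨k, rfl⟩
      exact ((show Commute s c from hcs.symm).zpow_left k).eq
    have h11 : c ^ 11 = 1 := by
      have := pow_card_eq_one' (x := (⟨c, hcQ⟩ : (Q : Subgroup S)))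
      rw [show Nat.card (Q : Subgroup S) = 11 from hQ] at this
      exact congrArg Subtype.val this
    have h5 : c ^ 5 = 1 := by
      have : orderOf c ∣ 5 := (T.orderOf_dvd_natCard hcT).trans hT5
      exact orderOf_dvd_iff_pow_eq_one.1 this
    rw [show 11 = 5 * 2 + 1 by norm_num, pow_succ, pow_mul, h5, one_pow, one_mul] at h11
    exact h11

end SimpleGroupOfOrder7920

section Malnormal

variable {G : Type*} [Group G]

/-- An amalgamated product of `F true` and `C × ⟨b⟩` along `C`, together with an element `s` of
`F true` that moves `C` sufficiently far. -/
structure IsInvolutionAmalgam (F : Bool → Subgroup G) (C : Subgroup G) (s b : G) : Prop extends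
    IsAmalgam F C where
  s_mem : s ∈ F true
  s_notMem : s ∉ C
  s_sq_notMem : s ^ 2 ∉ C
  b_mem : b ∈ F false
  b_notMem : b ∉ C
  b_mul_b : b * b = 1
  b_comm : ∀ c ∈ C, b * c = c * b
  mem_or_mem : ∀ x ∈ F false, x ∈ C ∨ b * x ∈ C
  eq_one_of_sq : ∀ c ∈ C, c ^ 2 = 1 → c = 1
  core : ∀ c ∈ C, (∀ i : ℕ, (s ^ i)⁻¹ * c * s ^ i ∈ C) → c = 1

namespace IsInvolutionAmalgam

variable {F : Bool → Subgroup G} {C : Subgroup G} {s b : G}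

theorem altType_two_mul (i : Bool) (n : ℕ) : altType i (2 * n) = i := by
  simp [altType]

theorem altType_two_mul_add_one (i : Bool) (n : ℕ) : altType i (2 * n + 1) = !i := by
  simp [altType]

theorem b_inv (h : IsInvolutionAmalgam F C s b) : b⁻¹ = b := inv_eq_of_mul_eq_one_left h.b_mul_b

theorem mul_redWord (h : IsInvolutionAmalgam F C s b) {n : ℕ} {g : G}
    (hg : g ∈ RedWord F C n true) : s * (b * g) ∈ RedWord F C (n + 2) true :=
  ⟨s, h.s_mem, h.s_notMem, _, ⟨b, h.b_mem, h.b_notMem, _, hg, rfl⟩, rfl⟩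

theorem pow_redWord (h : IsInvolutionAmalgam F C s b) (n : ℕ) :
    (s * b) ^ n ∈ RedWord F C (2 * n) true := by
  induction n with
  | zero =>
    rw [pow_zero]
    exact C.one_mem
  | succ n ih =>
    rw [pow_succ', mul_assoc]
    exact h.mul_redWord ih

theorem inv_pow_redWord (h : IsInvolutionAmalgam F C s b) (n : ℕ) :
    ((s * b) ^ n)⁻¹ ∈ RedWord F C (2 * n) false := by
  have := h.inv (h.pow_redWord n)
  rwa [altType_two_mul_add_one] at this

theorem conj_pow_redWord (h : IsInvolutionAmalgam F C s b) (n : ℕ) :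
    b * (s * b) ^ n * b ∈ RedWord F C (2 * n) false := by
  induction n with
  | zero =>
    rw [pow_zero, mul_one, h.b_mul_b]
    exact C.one_mem
  | succ n ih =>
    rw [show b * (s * b) ^ (n + 1) * b = b * (s * (b * (s * b) ^ n * b)) by
      rw [pow_succ']; group]
    exact ⟨b, h.b_mem, h.b_notMem, _, ⟨s, h.s_mem, h.s_notMem, _, ih, rfl⟩, rfl⟩

theorem zpow_redWord (h : IsInvolutionAmalgam F C s b) (k : ℤ) :
    ∃ i, (s * b) ^ k ∈ RedWord F C (2 * k.natAbs) i := by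
  obtain ⟨n, rfl | rfl⟩ := k.eq_nat_or_neg
  · exact ⟨true, by simpa using h.pow_redWord n⟩
  · exact ⟨false, by simpa using h.inv_pow_redWord n⟩

theorem pow_ne_one (h : IsInvolutionAmalgam F C s b) {n : ℕ} (hn : n ≠ 0) : (s * b) ^ n ≠ 1 := by
  obtain ⟨m, rfl⟩ := Nat.exists_eq_add_one_of_ne_zero hn
  exact h.ne_one (n := 2 * m + 1) (h.pow_redWord (m + 1))

theorem mul_pow_eq (h : IsInvolutionAmalgam F C s b) (n : ℕ) {c d : G} (hc : c ∈ C) (hd : d ∈ C)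
    (e : c * (s * b) ^ n = (s * b) ^ n * d) :
    (∀ i ≤ n, (s ^ i)⁻¹ * c * s ^ i ∈ C) ∧ (s ^ n)⁻¹ * c * s ^ n = d := by
  induction n generalizing c with
  | zero =>
    have : c = d := by simpa using e
    subst this
    exact ⟨fun i hi => by simpa [Nat.le_zero.1 hi] using hc, by simp⟩
  | succ n ih =>
    have h1 : s⁻¹ * c * s ∈ C := by
      have := h.unique_first (i := true) (n := 2 * n + 1) (m := 2 * n + 1)
        (x := s) (x' := c * s) (y := b * ((s * b) ^ n * d)) (y' := b * (s * b) ^ n)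
        h.s_mem ((F true).mul_mem (h.le _ hc) h.s_mem)
        ⟨b, h.b_mem, h.b_notMem, _, h.mul_right hd (h.pow_redWord n), rfl⟩
        ⟨b, h.b_mem, h.b_notMem, _, h.pow_redWord n, rfl⟩ (by
          rw [pow_succ'] at e
          simpa [mul_assoc] using e.symm)
      rwa [← mul_assoc] at this
    have h2 : (s⁻¹ * c * s) * (s * b) ^ n = (s * b) ^ n * d := by
      have h3 : (s * b)⁻¹ * (c * (s * b)) = s⁻¹ * c * s := by
        have := h.b_comm _ h1
        rw [mul_inv_rev, show b⁻¹ * s⁻¹ * (c * (s * b)) = b⁻¹ * ((s⁻¹ * c * s) * b) by group,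
          ← this]
        group
      rw [← h3]
      rw [mul_assoc, mul_assoc c, ← pow_succ', e, pow_succ', mul_assoc, inv_mul_cancel_left]
    obtain ⟨h3, h4⟩ := ih h1 h2
    have h5 : ∀ i, (s ^ (i + 1))⁻¹ * c * s ^ (i + 1) = (s ^ i)⁻¹ * (s⁻¹ * c * s) * s ^ i := by
      intro i
      rw [pow_succ']
      group
    refine ⟨fun i hi => ?_, by rw [h5, h4]⟩
    cases i with
    | zero => simpa using hc
    | succ i =>
      rw [h5]
      exact h3 i (by omega)

theorem eq_one_of_comm (h : IsInvolutionAmalgam F C s b) {n : ℕ} (hn : n ≠ 0) {c : G} (hc : c ∈ C)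
    (e : c * (s * b) ^ n = (s * b) ^ n * c) : c = 1 := by
  obtain ⟨h1, h2⟩ := h.mul_pow_eq n hc hc e
  refine h.core c hc fun i => ?_
  induction i using Nat.strong_induction_on with
  | _ i ih =>
    rcases le_or_gt i n with hi | hi
    · exact h1 i hi
    · obtain ⟨j, rfl⟩ := Nat.exists_eq_add_of_lt hi
      have := ih (j + 1) (by omega)
      rw [show (s ^ (n + j + 1))⁻¹ * c * s ^ (n + j + 1) =
        (s ^ (j + 1))⁻¹ * ((s ^ n)⁻¹ * c * s ^ n) * s ^ (j + 1) by
          rw [add_assoc, pow_add]; group, h2]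
      exact this

theorem eq_one_of_conj_mem (h : IsInvolutionAmalgam F C s b) {n : ℕ} (hn : n ≠ 0) {k : ℤ} {c : G}
    (hc : c ∈ C) (e : c⁻¹ * (s * b) ^ n * c = (s * b) ^ k) : c = 1 := by
  have h1 := h.mul_left (C.inv_mem hc) (h.mul_right hc (h.pow_redWord n))
  rw [← mul_assoc, e] at h1
  obtain ⟨m, rfl⟩ := Nat.exists_eq_add_one_of_ne_zero hn
  obtain ⟨l, rfl | rfl⟩ := k.eq_nat_or_neg
  · rw [zpow_natCast] at h1 e
    have := h.unique_length h1 (h.pow_redWord l)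
    obtain rfl : l = m + 1 := by omega
    refine h.eq_one_of_comm hn hc ?_
    nth_rewrite 1 [← e]
    group
  · rw [zpow_neg, zpow_natCast] at h1
    have h2 := h.inv_pow_redWord l
    have := h.unique_length h1 h2
    obtain rfl : l = m + 1 := by omega
    exact absurd (h.unique_type (n := 2 * m + 1) (m := 2 * m + 1) h1 h2) (by simp)

theorem conj_b_mul_ne (h : IsInvolutionAmalgam F C s b) {n : ℕ} (hn : n ≠ 0) {k : ℤ} {c : G}
    (hc : c ∈ C) : (b * c)⁻¹ * (s * b) ^ n * (b * c) ≠ (s * b) ^ k := by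
  intro e
  have h1 := h.mul_left (C.inv_mem hc) (h.mul_right hc (h.conj_pow_redWord n))
  rw [show c⁻¹ * (b * (s * b) ^ n * b * c) = (b * c)⁻¹ * (s * b) ^ n * (b * c) by
    rw [mul_inv_rev, h.b_inv]; group, e] at h1
  obtain ⟨m, rfl⟩ := Nat.exists_eq_add_one_of_ne_zero hn
  obtain ⟨l, rfl | rfl⟩ := k.eq_nat_or_neg
  · rw [zpow_natCast] at h1
    have h2 := h.pow_redWord l
    have := h.unique_length h1 h2
    obtain rfl : l = m + 1 := by omega
    exact absurd (h.unique_type (n := 2 * m + 1) (m := 2 * m + 1) h1 h2) (by simp)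
  rw [zpow_neg, zpow_natCast] at h1 e
  have := h.unique_length h1 (h.inv_pow_redWord l)
  obtain rfl : l = m + 1 := by omega
  have hsq : (b * c) * (b * c) = c ^ 2 := by
    rw [mul_assoc, ← mul_assoc c b c, ← h.b_comm c hc, mul_assoc, ← mul_assoc b b, h.b_mul_b,
      one_mul, sq]
  have h2 : c ^ 2 = 1 := by
    refine h.eq_one_of_conj_mem hn (k := (m + 1 : ℕ)) (C.pow_mem hc 2) ?_
    rw [← hsq, zpow_natCast]
    calc _ = (b * c)⁻¹ * ((b * c)⁻¹ * (s * b) ^ (m + 1) * (b * c)) * (b * c) := by group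
      _ = (b * c)⁻¹ * ((s * b) ^ (m + 1))⁻¹ * (b * c) := by rw [e]
      _ = ((b * c)⁻¹ * (s * b) ^ (m + 1) * (b * c))⁻¹ := by group
      _ = _ := by rw [e, inv_inv]
  obtain rfl := h.eq_one_of_sq c hc h2
  rw [mul_one] at e
  have h3 : s * (b * (s * b) ^ m * b) = s⁻¹ * ((s * b) ^ m)⁻¹ := by
    calc _ = (s * b) ^ (m + 1) * b := by rw [pow_succ']; group
      _ = b * (b⁻¹ * (s * b) ^ (m + 1) * b) := by group
      _ = b * ((s * b) ^ m * (s * b))⁻¹ := by rw [e, pow_succ]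
      _ = _ := by group
  have h4 := h.unique_first (i := true) h.s_mem ((F true).inv_mem h.s_mem) (h.conj_pow_redWord m)
    (h.inv_pow_redWord m) h3
  rw [← mul_inv_rev, ← sq] at h4
  exact h.s_sq_notMem (inv_mem_iff.1 h4)

/-- The subgroup generated by `s * b` is malnormal. -/
theorem malnormal (h : IsInvolutionAmalgam F C s b) {n : ℕ} (hn : n ≠ 0) {k : ℤ} {g : G}
    (e : g⁻¹ * (s * b) ^ n * g = (s * b) ^ k) : g ∈ Subgroup.zpowers (s * b) := by
  let i := Function.argmin (fun i : ℤ => h.len ((s * b) ^ i * g))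
  have hi : ∀ j : ℤ, h.len ((s * b) ^ i * g) ≤ h.len ((s * b) ^ j * g) := fun j =>
    Function.argmin_le (fun i : ℤ => h.len ((s * b) ^ i * g)) j
  have hmin : ∀ j : ℤ, h.len ((s * b) ^ i * g) ≤ h.len ((s * b) ^ j * ((s * b) ^ i * g)) := by
    intro j
    rw [← mul_assoc, ← zpow_add]
    exact hi _
  rw [← Subgroup.mul_mem_cancel_left _ (Subgroup.zpow_mem_zpowers (s * b) i)]
  replace e : ((s * b) ^ i * g)⁻¹ * (s * b) ^ n * ((s * b) ^ i * g) = (s * b) ^ k := by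
    rw [← e]; group
  generalize (s * b) ^ i * g = g at hmin e ⊢
  clear hi
  have term : ∀ g : G, g ∈ F false → g⁻¹ * (s * b) ^ n * g = (s * b) ^ k →
      g ∈ Subgroup.zpowers (s * b) := by
    intro g hg e
    rcases h.mem_or_mem g hg with hg | hg
    · rw [h.eq_one_of_conj_mem hn hg e]
      exact Subgroup.one_mem _
    · refine absurd ?_ (h.conj_b_mul_ne (k := k) hn hg)
      rw [← mul_assoc b b g, h.b_mul_b, one_mul, e]
  obtain ⟨j, hj⟩ := h.len_spec g
  rcases hm : h.len g with _ | m <;> rw [hm] at hj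
  · exact term g (h.le _ hj) e
  cases j with
  | true =>
    obtain ⟨x, hx, hxC, w, hw, rfl⟩ := hj
    by_cases hxs : x⁻¹ * s ∈ C
    · have hxs' : s⁻¹ * x ∈ C := by simpa using C.inv_mem hxs
      cases m with
      | zero =>
        have hmem : (s * b)⁻¹ * (x * w) ∈ F false := by
          rw [show (s * b)⁻¹ * (x * w) = b⁻¹ * ((s⁻¹ * x) * w) by group]
          exact (F false).mul_mem ((F false).inv_mem h.b_mem) (h.le _ (C.mul_mem hxs' hw))
        have := term _ hmem (by
          rw [← e, mul_inv_rev, inv_inv, mul_assoc (_⁻¹) (s * b), ← pow_succ', pow_succ]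
          simp only [mul_assoc, mul_inv_cancel_left])
        rwa [Subgroup.mul_mem_cancel_left _
          (Subgroup.inv_mem _ (Subgroup.mem_zpowers _))] at this
      | succ m =>
        obtain ⟨y, hy, hyC, w', hw', rfl⟩ := hw
        have hby : b * y ∈ C := (h.mem_or_mem y hy).resolve_left hyC
        have hred : (s * b) ^ (-1 : ℤ) * (x * (y * w')) ∈ RedWord F C m true := by
          rw [zpow_neg_one, mul_inv_rev, h.b_inv,
            show b * s⁻¹ * (x * (y * w')) = b * (s⁻¹ * x) * y * w' by group, h.b_comm _ hxs',
            mul_assoc _ b y]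
          exact h.mul_left (C.mul_mem hxs' hby) (by simpa using hw')
        have := hmin (-1)
        rw [h.len_eq hred] at this
        omega
    · have h1 : (x⁻¹ * s) * (b * (s * b) ^ (n - 1) * (x * w)) ∈
          RedWord F C (2 * (n - 1) + (m + 1) + 1 + 1) true := by
        refine ⟨_, (F true).mul_mem ((F true).inv_mem hx) h.s_mem, hxs, _, ?_, rfl⟩
        rw [mul_assoc]
        refine ⟨b, h.b_mem, h.b_notMem, _, ?_, rfl⟩
        refine h.append (h.pow_redWord _) ?_
        rw [altType_two_mul]
        exact ⟨x, hx, hxC, w, hw, rfl⟩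
      have h2 := h.inv_mul hw (i := false) h1
      rw [show w⁻¹ * ((x⁻¹ * s) * (b * (s * b) ^ (n - 1) * (x * w))) =
        (x * w)⁻¹ * ((s * b) * (s * b) ^ (n - 1)) * (x * w) by
          simp only [mul_assoc, mul_inv_rev], ← pow_succ',
        Nat.sub_add_cancel (Nat.pos_of_ne_zero hn), e] at h2
      obtain ⟨j, hj⟩ := h.zpow_redWord k
      have := h.unique_length h2 hj
      omega
  | false =>
    obtain ⟨x, hx, hxC, w, hw, rfl⟩ := hj
    have hbx : b * x ∈ C := (h.mem_or_mem x hx).resolve_left hxC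
    cases m with
    | zero => exact term _ ((F false).mul_mem hx (h.le _ hw)) e
    | succ m =>
      obtain ⟨y, hy, hyC, w', hw', rfl⟩ := hw
      have hle := hmin 1
      rw [hm, show (s * b) ^ (1 : ℤ) * (x * (y * w')) = (s * (b * x) * y) * w' by group] at hle
      obtain ⟨l, hl, j, hlj⟩ := h.letter_mul ((F true).mul_mem ((F true).mul_mem h.s_mem
        (h.le _ hbx)) hy) hw'
      rw [h.len_eq hlj] at hle
      omega

end IsInvolutionAmalgam

end Malnormal

section Tower

variable {H L E : Type*} [Group H] [Group L] [CommGroup E]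

/-- The amalgamated product `L` of an involution amalgam `H` and a rigid abelian group `E`
along the cyclic subgroup generated by `s * b`. -/
structure IsRigidTower (F : Bool → Subgroup H) (C : Subgroup H) (s b : H) (ι : H →* L)
    (j : E →* L) (z : E) (N : ℕ) : Prop extends IsInvolutionAmalgam F C s b where
  ι_inj : Function.Injective ι
  j_inj : Function.Injective j
  map_z : j z = ι (s * b)
  amalgam : IsAmalgam (fun i => cond i ι.range j.range) (Subgroup.zpowers (ι (s * b)))
  two_le : 2 ≤ N
  pow_eq_one : ∀ i, ∀ x ∈ F i, x ^ N = 1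
  torsionFree : ∀ n : ℕ, n ≠ 0 → ∀ x : E, x ^ n = 1 → x = 1
  root : ∀ x : E, ∃ y, y ^ N = x
  rigid : ∀ f : E →* E, f z = 1 → f = 1
  mem_of_conj : ∀ a ∈ F true, (∀ c ∈ C, a⁻¹ * c * a ∈ C) → a ∈ C
  eq_one_of_centralizes : ∀ x ∈ F true, (∀ c ∈ C, x * c = c * x) → x = 1
  exists_ne_one : ∃ c ∈ C, c ≠ 1

namespace IsRigidTower

variable {F : Bool → Subgroup H} {C : Subgroup H} {s b : H} {ι : H →* L} {j : E →* L} {z : E}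
  {N : ℕ}

theorem N_ne_zero (h : IsRigidTower F C s b ι j z N) : N ≠ 0 := by
  have := h.two_le
  omega

theorem exists_pow_pow_eq (h : IsRigidTower F C s b ι j z N) (n : ℕ) (x : E) :
    ∃ y, y ^ N ^ n = x := by
  induction n generalizing x with
  | zero => exact ⟨x, by simp⟩
  | succ n ih =>
    obtain ⟨y, rfl⟩ := h.root x
    obtain ⟨w, rfl⟩ := ih y
    exact ⟨w, by rw [pow_succ, pow_mul]⟩

theorem zpow_eq_one (h : IsRigidTower F C s b ι j z N) {k : ℤ} {n : ℕ} (hn : n ≠ 0)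
    (hk : ((s * b) ^ k) ^ n = 1) : (s * b) ^ k = 1 := by
  have h1 : ∀ m : ℕ, ((s * b) ^ m) ^ n = 1 → (s * b) ^ m = 1 := by
    intro m hm
    rw [← pow_mul] at hm
    by_contra hne
    refine h.pow_ne_one (mul_ne_zero ?_ hn) hm
    rintro rfl
    exact hne (pow_zero _)
  obtain ⟨m, rfl | rfl⟩ := k.eq_nat_or_neg
  · simpa using h1 m (by simpa using hk)
  · simpa using h1 m (by simpa using hk)

theorem mem_zpowers (h : IsRigidTower F C s b ι j z N) {x a : H}
    (hx : x ∈ Subgroup.zpowers (s * b)) (hx1 : x ≠ 1)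
    (ha : a⁻¹ * x * a ∈ Subgroup.zpowers (s * b)) : a ∈ Subgroup.zpowers (s * b) := by
  obtain ⟨k, rfl⟩ := hx
  obtain ⟨l, hl⟩ := ha
  obtain ⟨n, rfl | rfl⟩ := k.eq_nat_or_neg
  · refine h.malnormal (n := n) (k := l) ?_ (by simpa using hl.symm)
    rintro rfl
    simp at hx1
  · refine h.malnormal (n := n) (k := -l) ?_ ?_
    · rintro rfl
      simp at hx1
    · change (s * b) ^ l = a⁻¹ * (s * b) ^ (-(n : ℤ)) * a at hl
      rw [zpow_neg, hl, zpow_neg, zpow_natCast]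
      group

theorem mem_range_of_commute (h : IsRigidTower F C s b ι j z N) {e : E} (he : e ≠ 1) {g : L}
    (hg : g * j e = j e * g) : g ∈ j.range := by
  refine h.amalgam.mem_of_commute ?_ ?_ (x := j e) ⟨e, rfl⟩ ?_ hg
  · rintro _ ⟨x, rfl⟩ _ ⟨y, rfl⟩
    rw [← map_mul, mul_comm, map_mul]
  · intro x hx hx1 a ha hax
    rw [← MonoidHom.map_zpowers] at hx hax ⊢
    obtain ⟨x, hx, rfl⟩ := hx
    obtain ⟨a, rfl⟩ := ha
    obtain ⟨y, hy, e⟩ := hax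
    rw [← map_inv, ← map_mul, ← map_mul] at e
    have := h.ι_inj e
    subst this
    exact ⟨a, h.mem_zpowers hx (fun h1 => hx1 (by rw [h1, map_one])) hy, rfl⟩
  · rwa [Ne, map_eq_one_iff j h.j_inj]

theorem mem_range_of_conj_mem (h : IsRigidTower F C s b ι j z N) {y : H}
    (hy : ∀ a : H, a⁻¹ * y * a ∉ Subgroup.zpowers (s * b)) {g : L}
    (hg : g⁻¹ * ι y * g ∈ ι.range) : g ∈ ι.range := by
  refine h.amalgam.mem_of_conj_mem (i := true) (j := true) (x := ι y) ⟨y, rfl⟩ ?_ hg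
  rintro _ ⟨a, rfl⟩ hax
  rw [← MonoidHom.map_zpowers] at hax
  obtain ⟨x, hx, e⟩ := hax
  rw [← map_inv, ← map_mul, ← map_mul] at e
  rw [h.ι_inj e] at hx
  exact hy a hx

theorem mem_range_of_commute_torsion (h : IsRigidTower F C s b ι j z N) {y : H} (hy : y ≠ 1)
    {n : ℕ} (hn : n ≠ 0) (hyn : y ^ n = 1) {g : L} (hg : g * ι y = ι y * g) : g ∈ ι.range := by
  refine h.mem_range_of_conj_mem (y := y) ?_ ⟨y, by rw [mul_assoc, ← hg]; group⟩
  rintro a ⟨k, hk⟩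
  change (s * b) ^ k = _ at hk
  have h1 := h.zpow_eq_one hn (k := k) (by
    have := conj_pow (i := n) (a := a⁻¹) (b := y)
    rw [inv_inv] at this
    rw [hk, this, hyn, mul_one, inv_mul_cancel])
  rw [h1] at hk
  refine hy ?_
  calc y = a * (a⁻¹ * y * a) * a⁻¹ := by group
    _ = 1 := by rw [← hk]; group

/-- Every homomorphic image of the abelian factor is conjugate into it. -/
theorem exists_conj_mem_range (h : IsRigidTower F C s b ι j z N) (φ : E →* L) :
    ∃ g, ∀ e, g⁻¹ * φ e * g ∈ j.range := by
  by_cases hφ : ∀ e, φ e = 1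
  · exact ⟨1, fun e => ⟨1, by simp [hφ]⟩⟩
  push Not at hφ
  obtain ⟨e₀, he₀⟩ := hφ
  obtain ⟨e₁, rfl⟩ := h.root e₀
  have hlt : ∀ n, n < N ^ n := fun n => Nat.lt_pow_self h.two_le
  have key : ∀ p, p⁻¹ * φ e₁ * p ∈ j.range → ∃ g, ∀ e, g⁻¹ * φ e * g ∈ j.range := by
    rintro p ⟨e', he'⟩
    refine ⟨p, fun e => h.mem_range_of_commute (e := e') ?_ ?_⟩
    · rintro rfl
      rw [map_one] at he'
      have : φ e₁ = 1 := by
        calc φ e₁ = p * (p⁻¹ * φ e₁ * p) * p⁻¹ := by group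
          _ = 1 := by rw [← he']; group
      exact he₀ (by rw [map_pow, this, one_pow])
    · rw [he']
      calc _ = p⁻¹ * (φ e * φ e₁) * p := by group
        _ = p⁻¹ * (φ e₁ * φ e) * p := by rw [← map_mul, mul_comm, map_mul]
        _ = _ := by group
  obtain ⟨p, i, hp⟩ := h.amalgam.exists_conj_of_divisible (φ e₁) fun n => by
    obtain ⟨y, hy⟩ := h.exists_pow_pow_eq n e₁
    exact ⟨N ^ n, hlt n, φ y, by rw [← map_pow, hy]⟩
  cases i with
  | false => exact key p hp
  | true =>
    obtain ⟨y, hy⟩ := hp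
    by_cases hyz : ∃ a, a⁻¹ * y * a ∈ Subgroup.zpowers (s * b)
    · obtain ⟨a, k, hk⟩ := hyz
      refine key (p * ι a) ⟨z ^ k, ?_⟩
      change (s * b) ^ k = _ at hk
      rw [map_zpow, h.map_z, ← map_zpow, hk, map_mul, map_mul, hy, map_inv]
      group
    push Not at hyz
    obtain ⟨q, i, hq⟩ := h.exists_conj_of_divisible y fun n => by
      obtain ⟨x, hx⟩ := h.exists_pow_pow_eq n e₁
      obtain ⟨w, hw⟩ := h.mem_range_of_conj_mem (g := p⁻¹ * φ x * p) hyz ⟨y, by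
        rw [hy]
        have : φ e₁ = (φ x)⁻¹ * φ e₁ * φ x := by
          rw [mul_assoc, ← map_mul, mul_comm, map_mul, inv_mul_cancel_left]
        nth_rewrite 1 [this]
        group⟩
      refine ⟨N ^ n, hlt n, w, h.ι_inj ?_⟩
      have := conj_pow (i := N ^ n) (a := p⁻¹) (b := φ x)
      rw [inv_inv] at this
      rw [map_pow, hw, this, ← map_pow, hx, hy]
    refine absurd ?_ he₀
    have h1 := h.pow_eq_one i _ hq
    have h2 := conj_pow (i := N) (a := q⁻¹) (b := y)
    have h3 := conj_pow (i := N) (a := p⁻¹) (b := φ e₁)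
    rw [inv_inv] at h2 h3
    rw [h2] at h1
    have h4 : y ^ N = 1 := by
      calc y ^ N = q * (q⁻¹ * y ^ N * q) * q⁻¹ := by group
        _ = 1 := by rw [h1]; group
    rw [← hy, ← map_pow, h4, map_one, ← map_pow] at h3
    calc φ (e₁ ^ N) = p * (p⁻¹ * φ (e₁ ^ N) * p) * p⁻¹ := by group
      _ = 1 := by rw [← h3]; group

theorem eq_one_of_conj_mem_range (h : IsRigidTower F C s b ι j z N) {x g : L} {n : ℕ}
    (hn : n ≠ 0) (hx : x ^ n = 1) (hg : g⁻¹ * x * g ∈ j.range) : x = 1 := by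
  obtain ⟨e, he⟩ := hg
  have h1 := conj_pow (i := n) (a := g⁻¹) (b := x)
  rw [inv_inv, hx, mul_one, inv_mul_cancel, ← he, ← map_pow, map_eq_one_iff j h.j_inj] at h1
  rw [h.torsionFree n hn e h1, map_one] at he
  calc x = g * (g⁻¹ * x * g) * g⁻¹ := by group
    _ = 1 := by rw [← he]; group

theorem eq_one_or_eq_b (h : IsRigidTower F C s b ι j z N) {t : H}
    (ht : ∀ c ∈ C, t * c = c * t) : t = 1 ∨ t = b := by
  have key : ∀ n t, (∀ c ∈ C, t * c = c * t) → t ∈ RedWord F C n true → t = 1 := by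
    intro n t ht hn
    cases n with
    | zero => exact h.eq_one_of_centralizes t (h.le _ hn) ht
    | succ n =>
      obtain ⟨x, hx, hxC, w, hw, rfl⟩ := hn
      refine absurd (h.mem_of_conj x hx fun c hc => ?_) hxC
      rw [mul_assoc]
      refine h.unique_first hx ((F true).mul_mem (h.le _ hc) hx) (h.mul_right hc hw) hw ?_
      rw [← mul_assoc, ht c hc, mul_assoc]
  obtain ⟨n, i, hi⟩ := h.exists_redWord t
  cases i with
  | true => exact Or.inl (key n t ht hi)
  | false =>
    cases n with
    | zero => exact Or.inl (key 0 t ht hi)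
    | succ n =>
      right
      obtain ⟨x, hx, hxC, w, hw, rfl⟩ := hi
      have hbx := (h.mem_or_mem x hx).resolve_left hxC
      have := key n (b * (x * w)) (fun c hc => by
        rw [mul_assoc, ht c hc, ← mul_assoc, h.b_comm c hc, mul_assoc]) (by
        rw [← mul_assoc]
        exact h.mul_left hbx hw)
      rw [← h.b_inv]
      exact eq_inv_of_mul_eq_one_right this

variable {S : Type*} [Group S] {η : S →* H}

theorem closure_eq_top (h : IsRigidTower F C s b ι j z N) (hη : η.range = F true) :
    j.range ⊔ (ι.comp η).range = ⊤ := by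
  have h1 : (F true).map ι = (ι.comp η).range := by rw [← hη, MonoidHom.range_comp]
  have hle : (F true).map ι ≤ j.range ⊔ (ι.comp η).range := by rw [h1]; exact le_sup_right
  have hb : ι b ∈ j.range ⊔ (ι.comp η).range := by
    have : ι b = (ι s)⁻¹ * j z := by rw [h.map_z, map_mul, inv_mul_cancel_left]
    rw [this]
    exact mul_mem (inv_mem (hle ⟨s, h.s_mem, rfl⟩)) (Subgroup.mem_sup_left ⟨z, rfl⟩)
  have hfalse : (F false).map ι ≤ j.range ⊔ (ι.comp η).range := by
    rintro _ ⟨x, hx, rfl⟩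
    rcases h.mem_or_mem x hx with hx | hx
    · exact hle ⟨x, h.le _ hx, rfl⟩
    · rw [show x = b⁻¹ * (b * x) by group, map_mul, map_inv]
      exact mul_mem (inv_mem hb) (hle ⟨_, h.le _ hx, rfl⟩)
  rw [eq_top_iff, ← h.amalgam.gen]
  refine sup_le ?_ le_sup_left
  change ι.range ≤ _
  rw [MonoidHom.range_eq_map, ← h.gen, Subgroup.map_sup]
  exact sup_le hle hfalse

theorem hom_ext (h : IsRigidTower F C s b ι j z N) (hη : η.range = F true) {f f' : L →* L}
    (hj : ∀ e, f (j e) = f' (j e)) (hS : ∀ x, f (ι (η x)) = f' (ι (η x))) : f = f' := by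
  have : f.eqLocus f' = ⊤ := by
    rw [eq_top_iff, ← h.closure_eq_top hη]
    refine sup_le ?_ ?_
    · rintro _ ⟨e, rfl⟩
      exact hj e
    · rintro _ ⟨x, rfl⟩
      exact hS x
  ext x
  exact (this ▸ Subgroup.mem_top x : x ∈ f.eqLocus f')

theorem exists_factor (h : IsRigidTower F C s b ι j z N) {φ : E →* L}
    (hφ : ∀ e, φ e ∈ j.range) : ∃ f : E →* E, ∀ e, j (f e) = φ e := by
  refine ⟨(MonoidHom.ofInjective h.j_inj).symm.toMonoidHom.comp (φ.codRestrict j.range hφ),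
    fun e => ?_⟩
  have := (MonoidHom.ofInjective h.j_inj).apply_symm_apply (φ.codRestrict j.range hφ e)
  exact congrArg Subtype.val this

theorem eq_one_of_comp_eq_one (h : IsRigidTower F C s b ι j z N) (hη : η.range = F true)
    {f : L →* L} (hf : ∀ x, f (ι (η x)) = 1) : f = 1 := by
  obtain ⟨g, hg⟩ := h.exists_conj_mem_range (f.comp j)
  have hs : f (ι s) = 1 := by
    obtain ⟨x, hx⟩ : s ∈ η.range := hη ▸ h.s_mem
    rw [← hx, hf]
  have hz : f (j z) = 1 := by
    refine h.eq_one_of_conj_mem_range two_ne_zero ?_ (hg z)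
    rw [h.map_z, map_mul, map_mul, hs, one_mul, ← map_pow, ← map_pow, sq, h.b_mul_b, map_one,
      map_one]
  obtain ⟨φ, hφ⟩ := h.exists_factor
    (φ := (MulAut.conj g⁻¹).toMonoidHom.comp (f.comp j)) fun e => by simpa using hg e
  have h1 : φ = 1 := h.rigid φ (h.j_inj (by rw [hφ]; simp [hz]))
  refine h.hom_ext hη (fun e => ?_) hf
  have := hφ e
  rw [h1] at this
  have h2 : g⁻¹ * f (j e) * g = 1 := by simpa using this.symm
  calc f (j e) = g * (g⁻¹ * f (j e) * g) * g⁻¹ := by group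
    _ = 1 := by rw [h2]; group

theorem eq_id_of_comp_eq (h : IsRigidTower F C s b ι j z N) (hη : η.range = F true)
    {f : L →* L} (hf : ∀ x, f (ι (η x)) = ι (η x)) : f = MonoidHom.id L := by
  have hF : ∀ x ∈ F true, f (ι x) = ι x := by
    intro x hx
    obtain ⟨y, rfl⟩ : x ∈ η.range := hη ▸ hx
    exact hf y
  have hcomm : ∀ c ∈ C, f (ι b) * ι c = ι c * f (ι b) := by
    intro c hc
    rw [← hF c (h.le _ hc), ← map_mul, ← map_mul, h.b_comm c hc, map_mul, map_mul]
  obtain ⟨c, hc, hc1⟩ := h.exists_ne_one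
  obtain ⟨t, ht⟩ := h.mem_range_of_commute_torsion hc1 h.N_ne_zero
    (h.pow_eq_one true c (h.le _ hc)) (hcomm c hc)
  have hz : f (j z) = ι (s * t) := by
    rw [h.map_z, map_mul, map_mul, map_mul, ht, hF s h.s_mem]
  rcases h.eq_one_or_eq_b (t := t) fun c hc => h.ι_inj (by
    rw [map_mul, map_mul, ht, hcomm c hc]) with rfl | rfl
  · obtain ⟨g, hg⟩ := h.exists_conj_mem_range (f.comp j)
    rw [mul_one] at hz
    have := h.eq_one_of_conj_mem_range h.N_ne_zero (x := f (j z)) (by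
      rw [hz, ← map_pow, h.pow_eq_one true s h.s_mem, map_one]) (hg z)
    rw [hz, map_eq_one_iff ι h.ι_inj] at this
    exact absurd (this ▸ C.one_mem) h.s_notMem
  rw [← h.map_z] at hz
  have hz1 : z ≠ 1 := by
    intro hz1
    have := h.map_z
    rw [hz1, map_one, eq_comm, map_eq_one_iff ι h.ι_inj] at this
    exact h.pow_ne_one one_ne_zero (by rwa [pow_one])
  obtain ⟨φ, hφ⟩ := h.exists_factor (φ := f.comp j) fun e => by
    refine h.mem_range_of_commute hz1 ?_
    change f (j e) * j z = j z * f (j e)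
    rw [← hz, ← map_mul, ← map_mul, ← map_mul, ← map_mul, mul_comm]
  have h1 : φ * (MonoidHom.id E)⁻¹ = 1 := h.rigid _ (by
    have : φ z = z := h.j_inj (by rw [hφ]; exact hz)
    simp [this])
  refine h.hom_ext hη (fun e => ?_) hf
  have h2 : φ e = e := by simpa [mul_inv_eq_one] using DFunLike.congr_fun h1 e
  have h3 := hφ e
  rw [h2] at h3
  exact h3.symm

theorem exists_conj_mem_factor_of_finite (h : IsRigidTower F C s b ι j z N) {K : Type*}
    [Group K] [Finite K] (ψ : K →* L) : ∃ g i, ∀ k, ∃ x ∈ F i, g⁻¹ * ψ k * g = ι x := by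
  have h1 : ∃ g, ∀ k, g⁻¹ * ψ k * g ∈ ι.range := by
    obtain ⟨g, i, hg⟩ := h.amalgam.exists_conj_of_finite ψ
    cases i with
    | true => exact ⟨g, hg⟩
    | false =>
      refine ⟨1, fun k => ⟨1, ?_⟩⟩
      have := h.eq_one_of_conj_mem_range (x := ψ k) (n := Nat.card K) Nat.card_pos.ne'
        (by rw [← map_pow, pow_card_eq_one', map_one]) (hg k)
      simp [this]
  obtain ⟨g, hg⟩ := h1
  let ψ' : K →* ι.range := ((MulAut.conj g⁻¹).toMonoidHom.comp ψ).codRestrict ι.range fun k => by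
    simpa using hg k
  let ρ : K →* H := (MonoidHom.ofInjective h.ι_inj).symm.toMonoidHom.comp ψ'
  have hρ : ∀ k, ι (ρ k) = g⁻¹ * ψ k * g := by
    intro k
    have := congrArg Subtype.val ((MonoidHom.ofInjective h.ι_inj).apply_symm_apply (ψ' k))
    refine Eq.trans this ?_
    simp [ψ']
  obtain ⟨q, i, hq⟩ := h.exists_conj_of_finite ρ
  refine ⟨g * ι q, i, fun k => ⟨_, hq k, ?_⟩⟩
  rw [map_mul, map_mul, hρ, map_inv]
  group

theorem eq_one_or_exists_conj (h : IsRigidTower F C s b ι j z N) (hη : η.range = F true)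
    (hinj : Function.Injective η) [Finite S] [IsSimpleGroup S]
    (hInner : ∀ f : S ≃* S, ∃ s : S, ∀ x, f x = s * x * s⁻¹)
    (hcard : Nat.card (F false) < Nat.card S) [Finite (F false)] (ψ : S →* L) :
    ψ = 1 ∨ ∃ l, ∀ x, ψ x = l * ι (η x) * l⁻¹ := by
  rcases (inferInstance : ψ.ker.Normal).eq_bot_or_eq_top with hker | hker
  swap
  · left
    ext x
    exact (hker ▸ Subgroup.mem_top x : x ∈ ψ.ker)
  right
  have hψ : Function.Injective ψ := (MonoidHom.ker_eq_bot_iff ψ).1 hker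
  obtain ⟨g, i, hg⟩ := h.exists_conj_mem_factor_of_finite ψ
  choose ρ hρ hρψ using hg
  have hρinj : Function.Injective ρ := by
    intro x y hxy
    have := hρψ x
    rw [hxy, ← hρψ y] at this
    exact hψ (by simpa using this)
  cases i with
  | false =>
    have := Nat.card_le_card_of_injective (fun x => (⟨ρ x, hρ x⟩ : F false)) fun x y hxy =>
      hρinj (congrArg Subtype.val hxy)
    omega
  | true =>
    have : ∀ x, ∃ y, η y = ρ x := fun x => (hη ▸ hρ x : ρ x ∈ η.range)
    choose σ hσ using this
    have hmul : ∀ x y, σ (x * y) = σ x * σ y := by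
      intro x y
      apply hinj
      apply h.ι_inj
      rw [map_mul, map_mul, hσ, hσ, hσ, ← hρψ, ← hρψ, ← hρψ, map_mul]
      group
    let σ' : S →* S := MonoidHom.mk' σ hmul
    have hbij : Function.Bijective σ' := by
      refine Finite.injective_iff_bijective.1 fun x y hxy => hρinj ?_
      rw [← hσ x, ← hσ y]
      exact congrArg η hxy
    obtain ⟨a, ha⟩ := hInner (MulEquiv.ofBijective σ' hbij)
    refine ⟨g * ι (η a), fun x => ?_⟩
    have h1 : σ x = a * x * a⁻¹ := ha x
    have h2 := hρψ x
    rw [← hσ, h1] at h2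
    calc ψ x = g * (g⁻¹ * ψ x * g) * g⁻¹ := by group
      _ = _ := by
        rw [h2]
        simp only [map_mul, map_inv, mul_inv_rev, mul_assoc]

theorem bijective_comp (h : IsRigidTower F C s b ι j z N) (hη : η.range = F true)
    (hinj : Function.Injective η) [Finite S] [IsSimpleGroup S]
    (hInner : ∀ f : S ≃* S, ∃ s : S, ∀ x, f x = s * x * s⁻¹)
    (hcard : Nat.card (F false) < Nat.card S) [Finite (F false)] :
    Function.Bijective fun f : L →* L => f.comp (ι.comp η) := by
  constructor
  · intro f f' e
    have e' : ∀ x, f (ι (η x)) = f' (ι (η x)) := fun x => DFunLike.congr_fun e x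
    rcases h.eq_one_or_exists_conj hη hinj hInner hcard (f.comp (ι.comp η)) with h1 | ⟨l, hl⟩
    · have h2 : ∀ x, f (ι (η x)) = 1 := fun x => DFunLike.congr_fun h1 x
      have h3 : f' = 1 := h.eq_one_of_comp_eq_one hη fun x => by rw [← e', h2]
      rw [h.eq_one_of_comp_eq_one hη h2, h3]
    · have hl' : ∀ x, f (ι (η x)) = l * ι (η x) * l⁻¹ := hl
      have key : ∀ f : L →* L, (∀ x, f (ι (η x)) = l * ι (η x) * l⁻¹) →
          f = (MulAut.conj l).toMonoidHom := by
        intro f hf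
        have := h.eq_id_of_comp_eq hη (f := (MulAut.conj l⁻¹).toMonoidHom.comp f) fun x => by
          simp only [MonoidHom.comp_apply, hf]
          simp [mul_assoc]
        ext x
        have h1 := DFunLike.congr_fun this x
        simp only [MonoidHom.comp_apply, MonoidHom.id_apply] at h1
        nth_rewrite 2 [← h1]
        simp [mul_assoc]
      rw [key f hl', key f' fun x => by rw [← e', hl']]
  · intro ψ
    rcases h.eq_one_or_exists_conj hη hinj hInner hcard ψ with rfl | ⟨l, hl⟩
    · exact ⟨1, rfl⟩
    · refine ⟨(MulAut.conj l).toMonoidHom, ?_⟩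
      ext x
      rw [hl]
      rfl

end IsRigidTower

end Tower

section Construction

theorem exists_hom_intUnits {Q : Type*} [Group Q] {q : Q} (hq : q * q = 1) :
    ∃ f : ℤˣ →* Q, f (-1) = q := by
  refine ⟨MonoidHom.mk' (fun u => if u = 1 then 1 else q) fun u v => ?_, ?_⟩
  · rcases Int.units_eq_one_or u with rfl | rfl <;> rcases Int.units_eq_one_or v with rfl | rfl <;>
      simp [hq]
  · simp

theorem nonempty_witness (S : Type u) [Group S] [Finite S] [IsSimpleGroup S]
    (hcard : Nat.card S = 7920) (hInner : ∀ f : S ≃* S, ∃ s : S, ∀ x, f x = s * x * s⁻¹)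
    (κ : Cardinal.{u}) : Nonempty (ClosedEmbeddingWitness.{u, u} S κ) := by
  obtain ⟨C, s, hC, hnorm, hcent, hsC, hs2, hsq, hcore⟩ := exists_subgroup_card_55 hcard
  obtain ⟨E₀, _, z₀, hκ, hz₀, htf, hdiv, hrigid⟩ :=
    exists_rigid_addCommGroup κ 7920 (by norm_num)
  obtain ⟨H, _, η, β, hη, hβ, hηβ, hH, hHuniv⟩ := exists_amalgam (C := C) C.subtype
    (MonoidHom.inl C ℤˣ) C.subtype_injective fun x y hxy => congrArg Prod.fst hxy
  have hC' : ∀ x : C, η x = β (x, 1) := fun x => DFunLike.congr_fun hηβ x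
  have hmem : ∀ x, η x ∈ (η.comp C.subtype).range ↔ x ∈ C := by
    intro x
    constructor
    · rintro ⟨y, hy⟩
      rw [← hη hy]
      exact y.2
    · exact fun hx => ⟨⟨x, hx⟩, rfl⟩
  have hcardB : Nat.card β.range = 110 := by
    rw [← Nat.card_congr (MonoidHom.ofInjective hβ).toEquiv, Nat.card_prod, hC]
    simp
  have hinv : IsInvolutionAmalgam (fun i => cond i η.range β.range) (η.comp C.subtype).range
      (η s) (β (1, -1)) := by
    refine { hH with
      s_mem := ⟨s, rfl⟩
      s_notMem := by rwa [hmem]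
      s_sq_notMem := by rwa [← map_pow, hmem]
      b_mem := ⟨_, rfl⟩
      b_notMem := ?_
      b_mul_b := by rw [← map_mul]; exact (congrArg β (by simp)).trans (map_one β)
      b_comm := ?_
      mem_or_mem := ?_
      eq_one_of_sq := ?_
      core := ?_ }
    · rintro ⟨y, hy⟩
      have : η y = β (1, -1) := hy
      rw [hC'] at this
      have h2 : (1 : ℤˣ) = -1 := congrArg Prod.snd (hβ this)
      exact absurd h2 (by decide)
    · rintro _ ⟨y, rfl⟩
      change _ * η y = η y * _
      rw [hC', ← map_mul, ← map_mul]
      simp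
    · rintro _ ⟨⟨y, u⟩, rfl⟩
      rcases Int.units_eq_one_or u with rfl | rfl
      · exact Or.inl ⟨y, hC' y⟩
      · refine Or.inr ⟨y, ?_⟩
        rw [← map_mul]
        simpa using hC' y
    · rintro _ ⟨y, rfl⟩ hy
      have h1 : η ((y : S) ^ 2) = 1 := by simpa using hy
      have := hsq y y.2 ((map_eq_one_iff η hη).1 h1)
      change η y = 1
      rw [this, map_one]
    · rintro _ ⟨y, rfl⟩ hy
      have := hcore y y.2 fun i => by
        have := hy i
        rw [← hmem]
        simpa using this
      change η y = 1
      rw [this, map_one]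
  let z : Multiplicative E₀ := Multiplicative.ofAdd z₀
  have hz : ∀ n : ℕ, n ≠ 0 → z ^ n ≠ 1 := fun n hn h => hz₀ (htf n hn z₀ h)
  have hzinj : ∀ k : ℤ, z ^ k = 1 → k = 0 := by
    intro k hk
    obtain ⟨n, rfl | rfl⟩ := k.eq_nat_or_neg <;> by_contra hne
    · exact hz n (by simpa using hne) (by simpa using hk)
    · exact hz n (by simpa using hne) (by simpa using hk)
  let ζ := η s * β (1, -1)
  have hζinj : ∀ k : ℤ, ζ ^ k = 1 → k = 0 := by
    intro k hk
    obtain ⟨n, rfl | rfl⟩ := k.eq_nat_or_neg <;> by_contra hne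
    · exact hinv.pow_ne_one (n := n) (by simpa using hne) (by simpa using hk)
    · exact hinv.pow_ne_one (n := n) (by simpa using hne) (by simpa using hk)
  let φ : ULift.{u} (Multiplicative ℤ) →* H :=
    (zpowersHom H ζ).comp MulEquiv.ulift.toMonoidHom
  let ψ : ULift.{u} (Multiplicative ℤ) →* Multiplicative E₀ :=
    (zpowersHom (Multiplicative E₀) z).comp MulEquiv.ulift.toMonoidHom
  obtain ⟨L, _, ι, j, hι, hj, hιj, hL, hLuniv⟩ := exists_amalgam φ ψ
    ((injective_iff_map_eq_one φ).2 fun x hx => ULift.ext _ _ (hζinj _ hx))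
    ((injective_iff_map_eq_one ψ).2 fun x hx => ULift.ext _ _ (hzinj _ hx))
  have hjz : j z = ι ζ := by
    have : ι (ζ ^ (1 : ℤ)) = j (z ^ (1 : ℤ)) :=
      DFunLike.congr_fun hιj (ULift.up (Multiplicative.ofAdd 1))
    simpa using this.symm
  have hrange : (ι.comp φ).range = Subgroup.zpowers (ι ζ) := by
    ext x
    constructor
    · rintro ⟨k, rfl⟩
      exact ⟨Multiplicative.toAdd k.down, (map_zpow ι ζ _).symm⟩
    · rintro ⟨k, rfl⟩
      exact ⟨ULift.up (Multiplicative.ofAdd k), map_zpow ι ζ k⟩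
  rw [hrange] at hL
  have htower : IsRigidTower (fun i => cond i η.range β.range) (η.comp C.subtype).range
      (η s) (β (1, -1)) ι j z 7920 := by
    refine { hinv with
      ι_inj := hι
      j_inj := hj
      map_z := hjz
      amalgam := hL
      two_le := by norm_num
      pow_eq_one := ?_
      torsionFree := htf
      root := hdiv
      rigid := ?_
      mem_of_conj := ?_
      eq_one_of_centralizes := ?_
      exists_ne_one := ?_ }
    · rintro (_ | _) x hx
      · obtain ⟨⟨y, u⟩, rfl⟩ := hx
        have h1 : y ^ 7920 = 1 := by
          rw [show 7920 = Nat.card C * 144 by rw [hC], pow_mul, pow_card_eq_one', one_pow]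
        have h2 : u ^ 7920 = 1 := by
          rcases Int.units_eq_one_or u with rfl | rfl
          · exact one_pow _
          · exact Even.neg_one_pow ⟨3960, rfl⟩
        rw [← map_pow, Prod.pow_mk, h1, h2]
        exact map_one β
      · obtain ⟨y, rfl⟩ := hx
        rw [← map_pow, ← hcard, pow_card_eq_one', map_one]
    · intro f hf
      have := hrigid (MonoidHom.toAdditive f) hf
      ext x
      exact DFunLike.congr_fun this x
    · rintro _ ⟨a, rfl⟩ ha
      rw [hmem]
      refine hnorm a fun c hc => ?_
      have := ha (η c) ((hmem c).2 hc)
      rwa [← map_inv, ← map_mul, ← map_mul, hmem] at this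
    · rintro _ ⟨x, rfl⟩ hx
      rw [hcent x fun c hc => hη (by
        have := hx (η c) ((hmem c).2 hc)
        rwa [← map_mul, ← map_mul] at this), map_one]
    · have : Nontrivial C := Finite.one_lt_card_iff_nontrivial.1 (by rw [hC]; norm_num)
      obtain ⟨c, hc⟩ := exists_ne (1 : C)
      refine ⟨η c, (hmem c).2 c.2, ?_⟩
      rw [Ne, map_eq_one_iff η hη]
      simpa using hc
  let q : Multiplicative E₀ →* Multiplicative E₀ ⧸ Subgroup.zpowers (z ^ 2) := QuotientGroup.mk' _
  obtain ⟨ε, hε⟩ := exists_hom_intUnits (q := q z) (by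
    rw [← map_mul, ← sq]
    exact (QuotientGroup.eq_one_iff _).2 (Subgroup.mem_zpowers _))
  obtain ⟨ρ, hρη, hρβ⟩ := hHuniv (Multiplicative E₀ ⧸ Subgroup.zpowers (z ^ 2)) 1
    (ε.comp (MonoidHom.snd C ℤˣ)) (by ext x; simp)
  have hρζ : ρ ζ = q z := by
    have h1 : ρ (η s) = 1 := DFunLike.congr_fun hρη s
    have h2 : ρ (β (1, -1)) = ε (-1) := DFunLike.congr_fun hρβ (1, -1)
    rw [map_mul, h1, h2, hε, one_mul]
  obtain ⟨π, hπι, hπj⟩ := hLuniv (Multiplicative E₀ ⧸ Subgroup.zpowers (z ^ 2)) ρ q (by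
    refine MonoidHom.ext fun k => ?_
    change ρ (ζ ^ Multiplicative.toAdd k.down) = q (z ^ Multiplicative.toAdd k.down)
    rw [map_zpow, hρζ, map_zpow])
  have : Finite ↥(bif false then η.range else β.range) := by
    change Finite β.range
    exact Nat.finite_of_card_ne_zero (by rw [hcardB]; norm_num)
  exact ⟨{
    L := L
    η := ι.comp η
    inj := hι.comp hη
    closed := htower.bijective_comp rfl hη hInner (by
      change Nat.card β.range < _
      rw [hcardB, hcard]
      norm_num)
    large := hκ.trans (Cardinal.mk_le_of_injective hj)
    E := Multiplicative E₀
    j := j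
    jinj := hj
    gen := htower.closure_eq_top rfl
    z := z ^ 2
    zinf := by
      rw [isOfFinOrder_iff_pow_eq_one]
      rintro ⟨n, hn, h⟩
      rw [← pow_mul] at h
      exact hz _ (by omega) h
    π := π
    πsurj := by
      intro x
      obtain ⟨e, rfl⟩ := QuotientGroup.mk'_surjective _ x
      exact ⟨j e, DFunLike.congr_fun hπj e⟩
    πtriv := fun x => by
      have h1 : π (ι (η x)) = ρ (η x) := DFunLike.congr_fun hπι (η x)
      have h2 : ρ (η x) = 1 := DFunLike.congr_fun hρη x
      exact h1.trans h2 }⟩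

theorem ClosedEmbeddingWitness.nonempty_of_mulEquiv {S : Type v} {S' : Type u} [Group S] [Group S']
    (e : S ≃* S') {κ : Cardinal.{u}} (h : Nonempty (ClosedEmbeddingWitness.{u, u} S' κ)) :
    Nonempty (ClosedEmbeddingWitness.{u, v} S κ) := by
  obtain ⟨w⟩ := h
  let _ := w.grpL
  let _ := w.grpE
  refine ⟨{
    L := w.L
    η := w.η.comp e.toMonoidHom
    inj := w.inj.comp e.injective
    closed := ?_
    large := w.large
    E := w.E
    j := w.j
    jinj := w.jinj
    gen := ?_
    z := w.z
    zinf := w.zinf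
    π := w.π
    πsurj := w.πsurj
    πtriv := fun x => w.πtriv (e x) }⟩
  · refine ⟨fun f f' hff => w.closed.1 ?_, fun g => ?_⟩
    · ext x
      simpa using DFunLike.congr_fun hff (e.symm x)
    · obtain ⟨f, hf⟩ := w.closed.2 (g.comp e.symm.toMonoidHom)
      refine ⟨f, ?_⟩
      ext x
      simpa using DFunLike.congr_fun hf (e x)
  · have : (w.η.comp e.toMonoidHom).range = w.η.range := by
      rw [MonoidHom.range_comp, MonoidHom.range_eq_top.2
        (show Function.Surjective e.toMonoidHom from e.surjective), ← MonoidHom.range_eq_map]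
    rw [this]
    exact w.gen

end Construction

theorem stmt19 (S : Type v) [Group S] [Finite S]
    (hsimple : IsSimpleGroup S) (hcard : Nat.card S = 7920)
    (hInner : ∀ f : S ≃* S, ∃ s : S, ∀ x, f x = s * x * s⁻¹) :
    ∀ κ : Cardinal.{u}, Nonempty (ClosedEmbeddingWitness.{u, v} S κ) := by
  intro κ
  obtain ⟨S', _, _, ⟨e⟩⟩ := Finite.exists_type_univ_nonempty_mulEquiv.{v, u} S
  have : Finite S' := Finite.of_equiv S e.toEquiv
  have : IsSimpleGroup S' := e.symm.isSimpleGroup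
  refine ClosedEmbeddingWitness.nonempty_of_mulEquiv e
    (nonempty_witness S' ((Nat.card_congr e.symm.toEquiv).trans hcard) (fun f => ?_) κ)
  obtain ⟨s, hs⟩ := hInner ((e.trans f).trans e.symm)
  refine ⟨e s, fun x => ?_⟩
  have := hs (e.symm x)
  simp only [MulEquiv.trans_apply, MulEquiv.apply_symm_apply] at this
  rw [MulEquiv.symm_apply_eq] at this
  simpa using this
end
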